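/- There exists a calibrated curve; consequently, the projected Mather set M is not empty. -/

import Mathlib

/- Common framework for "On the long time convergence of potential MFG" (M. Masoero).

We work on the flat torus `𝕋^d`, modeled as `Td d := Fin d → AddCircle 1`.
Smooth functions on the torus are represented by `ℤ^d`-periodic functions on
`Vd d := Fin d → ℝ`; a function on `Vd d` is transported to the torus through the
canonical (measurable) section `secT : Td d → Vd d`.  Probability measures on the
torus are `PTd d := ProbabilityMeasure (Td d)`, endowed with the 1-Wasserstein
distance `W1` defined through Kantorovich duality.  The Fokker--Planck equations
and their stationary analogues are stated in the sense of distributions, i.e.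
against smooth periodic test functions; `σ` is the viscosity parameter
(everywhere `σ = 1` except in the non-convex example). -/

open MeasureTheory Real Set Filter

noncomputable section

abbrev Vd (d : ℕ) : Type := Fin d → ℝ
abbrev Td (d : ℕ) : Type := Fin d → AddCircle (1 : ℝ)

instance factOneposR : Fact ((0:ℝ) < 1) := ⟨one_pos⟩

/-- The canonical measurable section of the torus, with values in `[0,1)^d`. -/
def secT {d : ℕ} (y : Td d) : Vd d := fun i => ((AddCircle.equivIco 1 0) (y i)).1

/-- The vector of `ℝ^d` associated with an integer vector. -/
def intVec {d : ℕ} (z : Fin d → ℤ) : Vd d := fun i => (z i : ℝ)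

/-- Euclidean scalar product on `ℝ^d`. -/
def dotp {d : ℕ} (a b : Vd d) : ℝ := ∑ i, a i * b i

/-- Squared euclidean norm on `ℝ^d`. -/
def sqnorm {d : ℕ} (a : Vd d) : ℝ := ∑ i, (a i)^2

/-- Spatial gradient. -/
def gradv {d : ℕ} (g : Vd d → ℝ) (x : Vd d) : Vd d := fun i => fderiv ℝ g x (Pi.single i 1)

/-- Second derivative of `g` at `x` in the directions `v, w`. -/
def D2 {d : ℕ} (g : Vd d → ℝ) (x v w : Vd d) : ℝ := fderiv ℝ (fun y => fderiv ℝ g y v) x w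

/-- Laplacian. -/
def lapl {d : ℕ} (g : Vd d → ℝ) (x : Vd d) : ℝ := ∑ i, D2 g x (Pi.single i 1) (Pi.single i 1)

/-- Divergence of a vector field. -/
def divv {d : ℕ} (b : Vd d → Vd d) (x : Vd d) : ℝ :=
  ∑ i, fderiv ℝ (fun y => b y i) x (Pi.single i 1)

/-- Time derivative of a time dependent function. -/
def tderiv {d : ℕ} (u : ℝ → Vd d → ℝ) (t : ℝ) (x : Vd d) : ℝ := deriv (fun s => u s x) t

abbrev PTd (d : ℕ) := ProbabilityMeasure (Td d)

/-- The 1-Wasserstein (Monge--Kantorovich) distance, via Kantorovich duality. -/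
def W1 {d : ℕ} (μ ν : PTd d) : ℝ :=
  sSup { r | ∃ φ : Td d → ℝ, LipschitzWith 1 φ ∧
    r = (∫ y, φ y ∂(μ : Measure (Td d))) - ∫ y, φ y ∂(ν : Measure (Td d)) }

/-- The convex combination `(1-t) μ + t ν`. -/
def lineComb {d : ℕ} (t : ℝ) (μ ν : PTd d) : Measure (Td d) :=
  ENNReal.ofReal (1 - t) • (μ : Measure (Td d)) + ENNReal.ofReal t • (ν : Measure (Td d))

/-- The standing assumptions of the paper: a Hamiltonian `H` (a `ℤ^d`-periodic function of
`(x,p)`), its convex conjugate `Hstar` in the `p` variable, a `C²` coupling function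
`Fc` on `P(𝕋^d)` with flat derivative `Fd` (represented by periodic functions on `ℝ^d`),
with the regularity and growth conditions of the paper. -/
structure MFGSetting (d : ℕ) where
  H : Vd d → Vd d → ℝ
  Hstar : Vd d → Vd d → ℝ
  Fc : PTd d → ℝ
  Fd : Measure (Td d) → Vd d → ℝ
  Cbar : ℝ
  Cbar_pos : 0 < Cbar
  θ : ℝ
  θ_mem : θ ∈ Set.Ioo (0:ℝ) 1
  Cg : ℝ
  Cg_pos : 0 < Cg
  CF : ℝ
  H_smooth : ContDiff ℝ 2 (fun q : Vd d × Vd d => H q.1 q.2)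
  H_per : ∀ (x : Vd d) (z : Fin d → ℤ) (p : Vd d), H (x + intVec z) p = H x p
  Dpp_lip : ∃ L : ℝ, 0 ≤ L ∧ ∀ (x p₁ p₂ v w : Vd d),
    |D2 (fun p => H x p) p₁ v w - D2 (fun p => H x p) p₂ v w| ≤ L * ‖p₁ - p₂‖ * ‖v‖ * ‖w‖
  Dpp_lower : ∀ x p v : Vd d, Cbar⁻¹ * sqnorm v ≤ D2 (fun p' => H x p') p v v
  Dpp_upper : ∀ x p v : Vd d, D2 (fun p' => H x p') p v v ≤ Cbar * sqnorm v
  Dxx_growth : ∀ x p v w : Vd d,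
    |D2 (fun x' => H x' p) x v w| ≤ Cg * (1 + ‖p‖) ^ (1 + θ) * ‖v‖ * ‖w‖
  Dxp_growth : ∀ x p v w : Vd d,
    |fderiv ℝ (fun x' => fderiv ℝ (fun p' => H x' p') p v) x w| ≤ Cg * (1 + ‖p‖) ^ θ * ‖v‖ * ‖w‖
  Hstar_eq : ∀ x q : Vd d, IsLUB (Set.range fun p => dotp q p - H x p) (Hstar x q)
  Fd_per : ∀ (μ : Measure (Td d)) (x : Vd d) (z : Fin d → ℤ), Fd μ (x + intVec z) = Fd μ x
  Fd_smooth : ∀ μ : Measure (Td d), IsProbabilityMeasure μ → ContDiff ℝ 2 (Fd μ)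
  Fd_D2_bound : ∀ μ : Measure (Td d), IsProbabilityMeasure μ →
    ∀ x v w : Vd d, |D2 (Fd μ) x v w| ≤ CF * ‖v‖ * ‖w‖
  flat_deriv : ∀ μ ν : PTd d,
    Fc ν - Fc μ = ∫ t in Set.Icc (0:ℝ) 1,
      ((∫ y, Fd (lineComb t μ ν) (secT y) ∂(ν : Measure (Td d))) -
        ∫ y, Fd (lineComb t μ ν) (secT y) ∂(μ : Measure (Td d)))
  Fd_normalized : ∀ μ : PTd d, (∫ y, Fd (μ : Measure (Td d)) (secT y) ∂(μ : Measure (Td d))) = 0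
  Fc_bounded : ∃ M : ℝ, ∀ μ : PTd d, |Fc μ| ≤ M
  Fd_bounded : ∃ M : ℝ, ∀ (μ : PTd d) (x : Vd d), |Fd (μ : Measure (Td d)) x| ≤ M

/-- Smooth periodic test functions on `[0,∞) × 𝕋^d` (resp. `ℝ × 𝕋^d`). -/
def IsTestFun {d : ℕ} (φ : ℝ → Vd d → ℝ) : Prop :=
  ContDiff ℝ 2 (fun q : ℝ × Vd d => φ q.1 q.2) ∧
  ∀ (t : ℝ) (x : Vd d) (z : Fin d → ℤ), φ t (x + intVec z) = φ t x

/-- The weak (distributional) formulation of the Fokker--Planck equation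
`-∂ₜ m + σ Δ m + div(m α) = 0` between times `s₁` and `s₂`. -/
def FPeq {d : ℕ} (σ : ℝ) (m : ℝ → PTd d) (α : ℝ → Td d → Vd d) (s₁ s₂ : ℝ) : Prop :=
  ∀ φ : ℝ → Vd d → ℝ, IsTestFun φ →
    (∫ y, φ s₂ (secT y) ∂(m s₂ : Measure (Td d))) -
      (∫ y, φ s₁ (secT y) ∂(m s₁ : Measure (Td d))) =
    ∫ s in s₁..s₂, ∫ y, (tderiv φ s (secT y) + σ * lapl (φ s) (secT y)
        - dotp (α s y) (gradv (φ s) (secT y))) ∂(m s : Measure (Td d))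

/-- Continuity of a curve of measures with respect to the 1-Wasserstein distance. -/
def W1ContOn {d : ℕ} (m : ℝ → PTd d) (I : Set ℝ) : Prop :=
  ∀ t ∈ I, ∀ ε > 0, ∃ η > 0, ∀ s ∈ I, |s - t| < η → W1 (m s) (m t) < ε

/-- Continuity of a function on `P(𝕋^d)` with respect to the 1-Wasserstein distance. -/
def W1Continuous {d : ℕ} (χ : PTd d → ℝ) : Prop :=
  ∀ μ : PTd d, ∀ ε > 0, ∃ η > 0, ∀ ν : PTd d, W1 μ ν < η → |χ ν - χ μ| < ε

/-- W1-closed subsets of `P(𝕋^d)`. -/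
def IsClosedW1 {d : ℕ} (C : Set (PTd d)) : Prop :=
  ∀ μ : PTd d, (∀ ε > 0, ∃ ν ∈ C, W1 μ ν < ε) → μ ∈ C

/-- The running cost `∫ H*(x,α(s)) dm(s) + 𝓕(m(s))`. -/
def runCost {d : ℕ} (S : MFGSetting d) (m : ℝ → PTd d) (α : ℝ → Td d → Vd d) (s : ℝ) : ℝ :=
  (∫ y, S.Hstar (secT y) (α s y) ∂(m s : Measure (Td d))) + S.Fc (m s)

/-- Admissible pairs `(m,α)` on `[0,T]` starting from `m₀` (with `α ∈ L²_m`). -/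
def AdmOn {d : ℕ} (S : MFGSetting d) (σ : ℝ) (m₀ : PTd d) (T : ℝ)
    (m : ℝ → PTd d) (α : ℝ → Td d → Vd d) : Prop :=
  m 0 = m₀ ∧ W1ContOn m (Set.Icc 0 T) ∧
  (∀ s₁ s₂ : ℝ, 0 ≤ s₁ → s₁ ≤ s₂ → s₂ ≤ T → FPeq σ m α s₁ s₂) ∧
  Measurable (fun q : ℝ × Td d => α q.1 q.2) ∧
  (∫⁻ s in Set.Ioc (0:ℝ) T, ∫⁻ y, ENNReal.ofReal (sqnorm (α s y)) ∂(m s : Measure (Td d))) < ⊤ ∧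
  IntervalIntegrable (runCost S m α) volume 0 T

/-- Admissible pairs `(m,α)` on `[0,T]` starting from `m₀`, with `α` merely in `L¹_m`
(the class `Π_T` used for problems with prescribed endpoints). -/
def AdmOn1 {d : ℕ} (S : MFGSetting d) (σ : ℝ) (m₀ : PTd d) (T : ℝ)
    (m : ℝ → PTd d) (α : ℝ → Td d → Vd d) : Prop :=
  m 0 = m₀ ∧ W1ContOn m (Set.Icc 0 T) ∧
  (∀ s₁ s₂ : ℝ, 0 ≤ s₁ → s₁ ≤ s₂ → s₂ ≤ T → FPeq σ m α s₁ s₂) ∧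
  Measurable (fun q : ℝ × Td d => α q.1 q.2) ∧
  (∫⁻ s in Set.Ioc (0:ℝ) T, ∫⁻ y, ENNReal.ofReal (Real.sqrt (sqnorm (α s y)))
      ∂(m s : Measure (Td d))) < ⊤ ∧
  IntervalIntegrable (runCost S m α) volume 0 T

/-- The finite horizon cost. -/
def costT {d : ℕ} (S : MFGSetting d) (m : ℝ → PTd d) (α : ℝ → Td d → Vd d) (T : ℝ) : ℝ :=
  ∫ s in (0:ℝ)..T, runCost S m α s

/-- The value `𝒰(T,m₀)` of the finite horizon problem. -/
def Ufun {d : ℕ} (S : MFGSetting d) (σ : ℝ) (T : ℝ) (m₀ : PTd d) : ℝ :=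
  sInf { r | ∃ m α, AdmOn S σ m₀ T m α ∧ r = costT S m α T }

/-- Admissible pairs for the infinite horizon `δ`-discounted problem. -/
def AdmDisc {d : ℕ} (S : MFGSetting d) (σ : ℝ) (δ : ℝ) (m₀ : PTd d)
    (m : ℝ → PTd d) (α : ℝ → Td d → Vd d) : Prop :=
  m 0 = m₀ ∧ W1ContOn m (Set.Ici 0) ∧
  (∀ s₁ s₂ : ℝ, 0 ≤ s₁ → s₁ ≤ s₂ → FPeq σ m α s₁ s₂) ∧
  Measurable (fun q : ℝ × Td d => α q.1 q.2) ∧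
  (∫⁻ s in Set.Ioi (0:ℝ), ENNReal.ofReal (Real.exp (-δ * s)) *
      ∫⁻ y, ENNReal.ofReal (sqnorm (α s y)) ∂(m s : Measure (Td d))) < ⊤ ∧
  Integrable (fun s => Real.exp (-δ * s) * runCost S m α s) (volume.restrict (Set.Ioi 0))

/-- The discounted cost. -/
def costDisc {d : ℕ} (S : MFGSetting d) (δ : ℝ) (m : ℝ → PTd d) (α : ℝ → Td d → Vd d) : ℝ :=
  ∫ s in Set.Ioi (0:ℝ), Real.exp (-δ * s) * runCost S m α s

/-- The value `𝒱_δ(m₀)` of the discounted problem. -/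
def Vfun {d : ℕ} (S : MFGSetting d) (σ : ℝ) (δ : ℝ) (m₀ : PTd d) : ℝ :=
  sInf { r | ∃ m α, AdmDisc S σ δ m₀ m α ∧ r = costDisc S δ m α }

/-- `D_p H (x, p)`. -/
def DpH {d : ℕ} (S : MFGSetting d) (x p : Vd d) : Vd d :=
  fun i => fderiv ℝ (fun p' => S.H x p') p (Pi.single i 1)

/-- `C^{1,2}` regularity on `I × 𝕋^d` of a (periodic) time-dependent function. -/
def Creg12 {d : ℕ} (u : ℝ → Vd d → ℝ) (I : Set ℝ) : Prop :=
  ContinuousOn (fun q : ℝ × Vd d => u q.1 q.2) (I ×ˢ Set.univ) ∧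
  (∀ x : Vd d, ∀ t ∈ I, DifferentiableAt ℝ (fun s => u s x) t) ∧
  (∀ t ∈ I, ContDiff ℝ 2 (u t)) ∧
  (∀ t ∈ I, ∀ (x : Vd d) (z : Fin d → ℤ), u t (x + intVec z) = u t x)

/-- `(u,m)` is a classical solution of the `δ`-discounted MFG system on `[0,∞) × 𝕋^d`:
`-∂ₜ u - Δ u + δ u + H(x,Du) = F(x,m)` and `-∂ₜ m + Δ m + div(m D_pH(x,Du)) = 0`. -/
def SolvesDiscMFG {d : ℕ} (S : MFGSetting d) (δ : ℝ) (u : ℝ → Vd d → ℝ) (m : ℝ → PTd d) : Prop :=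
  Creg12 u (Set.Ici 0) ∧
  (∀ t ∈ Set.Ici (0:ℝ), ∀ x : Vd d,
    - tderiv u t x - lapl (u t) x + δ * u t x + S.H x (gradv (u t) x)
      = S.Fd (m t : Measure (Td d)) x) ∧
  W1ContOn m (Set.Ici 0) ∧
  (∀ s₁ s₂ : ℝ, 0 ≤ s₁ → s₁ ≤ s₂ →
    FPeq 1 m (fun s y => DpH S (secT y) (gradv (u s) (secT y))) s₁ s₂)

/-- Admissible pairs for the stationary (ergodic) problem:
`σ Δ m + div(m α) = 0` in the sense of distributions and `α ∈ L²_m`. -/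
def StatAdm {d : ℕ} (σ : ℝ) (m : PTd d) (α : Td d → Vd d) : Prop :=
  Measurable α ∧
  (∫⁻ y, ENNReal.ofReal (sqnorm (α y)) ∂(m : Measure (Td d))) < ⊤ ∧
  ∀ g : Vd d → ℝ, ContDiff ℝ 2 g → (∀ (x : Vd d) (z : Fin d → ℤ), g (x + intVec z) = g x) →
    (∫ y, (σ * lapl g (secT y) - dotp (α y) (gradv g (secT y))) ∂(m : Measure (Td d))) = 0

/-- `ergInf S σ = -λ̄`, the value of the stationary minimization problem. -/
def ergInf {d : ℕ} (S : MFGSetting d) (σ : ℝ) : ℝ :=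
  sInf { r | ∃ m α, StatAdm σ m α ∧
    r = (∫ y, S.Hstar (secT y) (α y) ∂(m : Measure (Td d))) + S.Fc m }

/-- The set of values over which the dynamic programming principle for a corrector
`χ` takes its infimum. -/
def DPPval {d : ℕ} (S : MFGSetting d) (σ : ℝ) (χ : PTd d → ℝ) (lam t : ℝ) (m₀ : PTd d) :
    Set ℝ :=
  { r | ∃ m α, AdmOn S σ m₀ t m α ∧
      r = (∫ s in (0:ℝ)..t, runCost S m α s) + χ (m t) + lam * t }

/-- `χ` is a corrector function: it is continuous and satisfies the dynamic
programming principle with the critical value `λ`. -/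
def IsCorrector {d : ℕ} (S : MFGSetting d) (σ : ℝ) (lam : ℝ) (χ : PTd d → ℝ) : Prop :=
  W1Continuous χ ∧ ∀ (m₀ : PTd d) (t : ℝ), 0 < t → χ m₀ = sInf (DPPval S σ χ lam t m₀)

/-- `(m,α)` is a calibrated curve (defined on all of `ℝ`). -/
def IsCalibrated {d : ℕ} (S : MFGSetting d) (σ : ℝ) (lam : ℝ)
    (m : ℝ → PTd d) (α : ℝ → Td d → Vd d) : Prop :=
  W1ContOn m Set.univ ∧
  (∀ s₁ s₂ : ℝ, s₁ ≤ s₂ → FPeq σ m α s₁ s₂) ∧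
  Measurable (fun q : ℝ × Td d => α q.1 q.2) ∧
  (∀ t₁ t₂ : ℝ, (∫⁻ s in Set.Ioc t₁ t₂,
      ∫⁻ y, ENNReal.ofReal (sqnorm (α s y)) ∂(m s : Measure (Td d))) < ⊤) ∧
  (∀ t₁ t₂ : ℝ, IntervalIntegrable (runCost S m α) volume t₁ t₂) ∧
  ∃ χ : PTd d → ℝ, IsCorrector S σ lam χ ∧ ∀ t₁ t₂ : ℝ, t₁ < t₂ →
    χ (m t₁) = lam * (t₂ - t₁) + (∫ s in t₁..t₂, runCost S m α s) + χ (m t₂)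

/-- The projected Mather set. -/
def MatherSet {d : ℕ} (S : MFGSetting d) (σ : ℝ) (lam : ℝ) : Set (PTd d) :=
  { μ | ∃ m α, IsCalibrated S σ lam m α ∧ m 0 = μ }

/-- Invariant subsets of the projected Mather set. -/
def IsInvariantMFG {d : ℕ} (S : MFGSetting d) (σ : ℝ) (lam : ℝ) (C : Set (PTd d)) : Prop :=
  ∀ μ ∈ C, ∃ m α, IsCalibrated S σ lam m α ∧ m 0 = μ ∧ ∀ t : ℝ, m t ∈ C

/-- Minimal invariant subsets of the projected Mather set. -/
def IsMinimalInvariant {d : ℕ} (S : MFGSetting d) (σ : ℝ) (lam : ℝ) (N : Set (PTd d)) : Prop :=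
  N.Nonempty ∧ N ⊆ MatherSet S σ lam ∧ IsClosedW1 N ∧ IsInvariantMFG S σ lam N ∧
  ∀ C : Set (PTd d), C ⊆ N → C.Nonempty → IsClosedW1 C → IsInvariantMFG S σ lam C → C = N

/-- `δ 𝒱_δ → -λ` uniformly as `δ → 0⁺`. -/
def IsLimitValueV {d : ℕ} (S : MFGSetting d) (σ : ℝ) (lam : ℝ) : Prop :=
  ∀ ε > 0, ∃ δ₀ > 0, ∀ δ : ℝ, 0 < δ → δ ≤ δ₀ → ∀ μ : PTd d,
    |δ * Vfun S σ δ μ - (-lam)| < ε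

/-- `𝒰(T,·)/T → -λ` uniformly as `T → ∞`. -/
def IsLimitValueU {d : ℕ} (S : MFGSetting d) (σ : ℝ) (lam : ℝ) : Prop :=
  ∀ ε > 0, ∃ T₀ : ℝ, ∀ T : ℝ, T₀ ≤ T → ∀ μ : PTd d,
    |Ufun S σ T μ / T - (-lam)| < ε

/-- A function `Φ` on `P(𝕋^d)` is `C¹` with flat derivative `dΦ` (normalized so that
`∫ dΦ(m,·) dm = 0`, periodic in the space variable and jointly continuous). -/
def IsC1Flat {d : ℕ} (Φ : PTd d → ℝ) (dΦ : Measure (Td d) → Vd d → ℝ) : Prop :=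
  (∀ (μ : Measure (Td d)) (x : Vd d) (z : Fin d → ℤ), dΦ μ (x + intVec z) = dΦ μ x) ∧
  (∀ μ ν : PTd d,
    Φ ν - Φ μ = ∫ t in Set.Icc (0:ℝ) 1,
      ((∫ y, dΦ (lineComb t μ ν) (secT y) ∂(ν : Measure (Td d))) -
        ∫ y, dΦ (lineComb t μ ν) (secT y) ∂(μ : Measure (Td d)))) ∧
  (∀ μ : PTd d, (∫ y, dΦ (μ : Measure (Td d)) (secT y) ∂(μ : Measure (Td d))) = 0) ∧
  (∀ ε > 0, ∀ (μ : PTd d) (x : Vd d), ∃ η > 0, ∀ (ν : PTd d) (x' : Vd d),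
    W1 μ ν < η → ‖x' - x‖ < η → |dΦ (ν : Measure (Td d)) x' - dΦ (μ : Measure (Td d)) x| < ε)

section
open MeasureTheory Real Set Filter
open scoped Topology NNReal ENNReal ProbabilityTheory
lemma mlL {a b c : ℝ} (h : b ≤ c) (k : 0 ≤ a) : a * b ≤ a * c := mul_le_mul_of_nonneg_left h k
lemma mlR {a b c : ℝ} (h : b ≤ c) (k : 0 ≤ a) : b * a ≤ c * a := mul_le_mul_of_nonneg_right h k
section
open scoped Topology NNReal ENNReal
instance instTopPTd {d : ℕ} : TopologicalSpace (PTd d) := inferInstance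
def pT {d : ℕ} (x : Vd d) : Td d := fun i => (x i : AddCircle (1 : ℝ))
def Per {d : ℕ} (f : Vd d → ℝ) : Prop := ∀ (x : Vd d) (z : Fin d → ℤ), f (x + intVec z) = f x
variable {d : ℕ}
lemma pT_secT (y : Td d) : pT (secT y) = y := by
  funext i
  exact (AddCircle.equivIco 1 0).symm_apply_apply (y i)
lemma pT_add (x x' : Vd d) : pT (x + x') = pT x + pT x' := by
  funext i; simp [pT]
lemma pT_zero : pT (0 : Vd d) = 0 := by
  funext i; simp [pT]
lemma pT_eq {x x' : Vd d} (h : pT x = pT x') : ∃ z : Fin d → ℤ, x = x' + intVec z := by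
  have : ∀ i, ∃ n : ℤ, x i = x' i + n := fun i => by
    have := congrFun h i
    simp only [pT] at this
    obtain ⟨n, hn⟩ := AddSubgroup.mem_zmultiples_iff.1 (QuotientAddGroup.eq.1 this.symm)
    exact ⟨n, by simp at hn; linarith⟩
  choose z hz using this
  exact ⟨z, funext fun i => hz i⟩
lemma per_sec {f : Vd d → ℝ} (hf : Per f) (x : Vd d) : f (secT (pT x)) = f x := by
  obtain ⟨z, hz⟩ := pT_eq (pT_secT (pT x))
  rw [hz, hf]
lemma per_sec_add {f : Vd d → ℝ} (hf : Per f) (y : Td d) (x : Vd d) :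
    f (secT (y + pT x)) = f (secT y + x) := by
  rw [← per_sec hf (secT y + x), pT_add, pT_secT]
lemma pT_quot : IsOpenQuotientMap (pT : Vd d → Td d) :=
  IsOpenQuotientMap.piMap (f := fun (_ : Fin d) (x : ℝ) => (x : AddCircle (1:ℝ)))
    (fun _ => QuotientAddGroup.isOpenQuotientMap_mk)
lemma pT_cont : Continuous (pT : Vd d → Td d) := pT_quot.continuous
lemma cont_sec {P : Type*} [TopologicalSpace P] {f : P → Vd d → ℝ}
    (hf : Continuous fun q : P × Vd d => f q.1 q.2) (hp : ∀ p, Per (f p)) :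
    Continuous fun q : P × Td d => f q.1 (secT q.2) := by
  rw [← (IsOpenQuotientMap.id.prodMap pT_quot).continuous_comp_iff]
  convert hf using 2 with q
  exact per_sec (hp _) _
lemma cont_sec' {f : Vd d → ℝ} (hf : Continuous f) (hp : Per f) :
    Continuous fun y : Td d => f (secT y) := by
  rw [← pT_quot.continuous_comp_iff]
  have : (fun y => f (secT y)) ∘ pT = f := funext fun x => per_sec hp x
  rw [this]; exact hf
lemma meas_secT : Measurable (secT : Td d → Vd d) := by
  refine measurable_pi_lambda _ fun i => ?_
  exact measurable_subtype_coe.comp ((AddCircle.measurableEquivIco 1 0).measurable.comp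
    (measurable_pi_apply i))
lemma integrable_cont (μ : PTd d) {f : Td d → ℝ} (hf : Continuous f) :
    Integrable f (μ : Measure (Td d)) :=
  hf.integrable_of_hasCompactSupport (HasCompactSupport.of_compactSpace f)
lemma cont_integral {P : Type*} [TopologicalSpace P] {m : P → PTd d} (hm : Continuous m)
    {f : P → Td d → ℝ} (hf : Continuous fun q : P × Td d => f q.1 q.2) :
    Continuous fun p => ∫ y, f p y ∂(m p : Measure (Td d)) := by
  let F : C(P, C(Td d, ℝ)) := ContinuousMap.curry ⟨_, hf⟩
  rw [continuous_iff_continuousAt]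
  intro p0
  rw [ContinuousAt, Metric.tendsto_nhds]
  intro ε hε
  have h1 : ∀ᶠ p in 𝓝 p0, dist (F p) (F p0) < ε / 2 :=
    (Metric.tendsto_nhds.1 F.continuous.continuousAt.tendsto) _ (half_pos hε)
  have h2 : ∀ᶠ p in 𝓝 p0, dist (∫ y, F p0 y ∂(m p : Measure (Td d)))
      (∫ y, F p0 y ∂(m p0 : Measure (Td d))) < ε / 2 :=
    (Metric.tendsto_nhds.1 (((ProbabilityMeasure.continuous_integral_continuousMap (F p0)).comp
      hm).continuousAt.tendsto)) _ (half_pos hε)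
  filter_upwards [h1, h2] with p h1 h2
  have h3 : dist (∫ y, f p y ∂(m p : Measure (Td d))) (∫ y, F p0 y ∂(m p : Measure (Td d)))
      ≤ ε / 2 := by
    have e : (∫ y, f p y ∂(m p : Measure (Td d))) = ∫ y, F p y ∂(m p : Measure (Td d)) := rfl
    rw [e, dist_eq_norm, ← integral_sub (integrable_cont _ (F p).continuous)
      (integrable_cont _ (F p0).continuous)]
    refine (norm_integral_le_of_norm_le_const (C := ε/2) (Eventually.of_forall fun y => ?_)).trans
      (by simp)
    rw [← dist_eq_norm]
    exact (ContinuousMap.dist_apply_le_dist y).trans h1.le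
  calc _ ≤ _ := dist_triangle _ _ _
    _ < ε / 2 + ε / 2 := add_lt_add_of_le_of_lt h3 h2
    _ = ε := by ring
lemma lift_near (y y' : Td d) : ∃ x x' : Vd d, pT x = y ∧ pT x' = y' ∧ ‖x - x'‖ ≤ dist y y' := by
  have : ∀ i, ∃ a : ℝ, ((a : ℝ) : AddCircle (1:ℝ)) = y i - y' i ∧ |a| ≤ dist y y' := fun i => by
    have h := AddCircle.norm_eq (p := 1) (x := secT y i - secT y' i)
    have h1 : ((secT y i - secT y' i : ℝ) : AddCircle (1:ℝ)) = y i - y' i := by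
      have e1 := congrFun (pT_secT y) i
      have e2 := congrFun (pT_secT y') i
      simp only [pT] at e1 e2
      rw [AddCircle.coe_sub, e1, e2]
    refine ⟨secT y i - secT y' i - round ((1:ℝ)⁻¹ * (secT y i - secT y' i)) * 1, ?_, ?_⟩
    · rw [AddCircle.coe_sub, h1]
      simp
    · rw [← h, h1, ← dist_eq_norm]; exact dist_le_pi_dist y y' i
  choose a ha hb using this
  refine ⟨secT y' + a, secT y', ?_, pT_secT _, ?_⟩
  · rw [pT_add, pT_secT]; funext i; simp [pT, ha]
  · simp only [add_sub_cancel_left]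
    exact (pi_norm_le_iff_of_nonneg dist_nonneg).2 hb
lemma lip_sec {f : Vd d → ℝ} (hp : Per f) {L : ℝ≥0} (hf : LipschitzWith L f) :
    LipschitzWith L fun y : Td d => f (secT y) := by
  refine LipschitzWith.of_dist_le_mul fun y y' => ?_
  obtain ⟨x, x', hx, hx', h⟩ := lift_near y y'
  rw [← hx, ← hx', per_sec hp, per_sec hp]
  refine (hf.dist_le_mul x x').trans ?_
  rw [dist_eq_norm, hx, hx']; gcongr
lemma dist_pT (x x' : Vd d) : dist (pT x) (pT x') ≤ ‖x - x'‖ := by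
  refine (dist_pi_le_iff (norm_nonneg _)).2 fun i => ?_
  rw [dist_eq_norm, pT, pT, ← AddCircle.coe_sub, AddCircle.norm_eq]
  have h1 : |x i - x' i| ≤ ‖x - x'‖ := norm_le_pi_norm (x - x') i
  refine le_trans ?_ h1
  simp only [inv_one, one_mul, mul_one]
  exact round_le _ 0 |>.trans (by simp)
lemma dist_Td_le (y y' : Td d) : dist y y' ≤ 1 := by
  refine (dist_pi_le_iff zero_le_one).2 fun i => ?_
  rw [dist_eq_norm]
  refine (AddCircle.norm_le_half_period (p := 1) (x := y i - y' i) one_ne_zero).trans (by norm_num)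
lemma per_bdd {f : Vd d → ℝ} (hf : Continuous f) (hp : Per f) : ∃ C, 0 ≤ C ∧ ∀ x, |f x| ≤ C := by
  obtain ⟨C, hC⟩ := (isCompact_univ (X := Td d)).exists_bound_of_continuousOn (cont_sec' hf hp).continuousOn
  refine ⟨|C|, abs_nonneg _, fun x => ?_⟩
  rw [← per_sec hp]; exact (hC _ trivial).trans (le_abs_self _)
lemma per_bdd_on {P : Type*} [TopologicalSpace P] {f : P → Vd d → ℝ}
    (hf : Continuous fun q : P × Vd d => f q.1 q.2) (hp : ∀ p, Per (f p)) {K : Set P}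
    (hK : IsCompact K) : ∃ C, 0 ≤ C ∧ ∀ p ∈ K, ∀ x, |f p x| ≤ C := by
  obtain ⟨C, hC⟩ := (hK.prod (isCompact_univ (X := Td d))).exists_bound_of_continuousOn
    (cont_sec hf hp).continuousOn
  refine ⟨|C|, abs_nonneg _, fun p hpK x => ?_⟩
  rw [← per_sec (hp p)]; exact (hC (p, pT x) ⟨hpK, trivial⟩).trans (le_abs_self _)
/-! W1 -/
lemma osc_lip {φ : Td d → ℝ} {L : ℝ≥0} (h : LipschitzWith L φ) (y y' : Td d) :
    |φ y - φ y'| ≤ L := by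
  rw [← Real.dist_eq]
  refine (h.dist_le_mul y y').trans ?_
  have := dist_Td_le y y'
  have h2 : (0:ℝ) ≤ L := L.2
  nlinarith
lemma int_sub_const (μ ν : PTd d) {φ : Td d → ℝ} (h : Continuous φ) (c : ℝ) :
    (∫ y, φ y ∂(μ : Measure (Td d))) - ∫ y, φ y ∂(ν : Measure (Td d)) =
    (∫ y, (φ y - c) ∂(μ : Measure (Td d))) - ∫ y, (φ y - c) ∂(ν : Measure (Td d)) := by
  rw [integral_sub (integrable_cont _ h) (integrable_const _),
    integral_sub (integrable_cont _ h) (integrable_const _)]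
  simp
lemma W1_set_le (μ ν : PTd d) {φ : Td d → ℝ} (h : LipschitzWith 1 φ) :
    (∫ y, φ y ∂(μ : Measure (Td d))) - ∫ y, φ y ∂(ν : Measure (Td d)) ≤ 2 := by
  rw [int_sub_const μ ν h.continuous (φ 0)]
  have key : ∀ μ : PTd d, |∫ y, (φ y - φ 0) ∂(μ : Measure (Td d))| ≤ 1 := fun μ => by
    have h1 := norm_integral_le_of_norm_le_const (μ := (μ : Measure (Td d)))
      (f := fun y => φ y - φ 0) (C := 1)
      (Eventually.of_forall fun y => by simpa using osc_lip h y 0)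
    simpa using h1
  linarith [abs_le.1 (key μ), abs_le.1 (key ν)]
lemma W1_bdd (μ ν : PTd d) : BddAbove { r | ∃ φ : Td d → ℝ, LipschitzWith 1 φ ∧
    r = (∫ y, φ y ∂(μ : Measure (Td d))) - ∫ y, φ y ∂(ν : Measure (Td d)) } :=
  ⟨2, by rintro _ ⟨φ, h, rfl⟩; exact W1_set_le μ ν h⟩
lemma le_W1 (μ ν : PTd d) {φ : Td d → ℝ} (h : LipschitzWith 1 φ) :
    (∫ y, φ y ∂(μ : Measure (Td d))) - ∫ y, φ y ∂(ν : Measure (Td d)) ≤ W1 μ ν :=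
  le_csSup (W1_bdd μ ν) ⟨φ, h, rfl⟩
lemma W1_le (μ ν : PTd d) {c : ℝ} (h : ∀ φ : Td d → ℝ, LipschitzWith 1 φ →
    (∫ y, φ y ∂(μ : Measure (Td d))) - ∫ y, φ y ∂(ν : Measure (Td d)) ≤ c) : W1 μ ν ≤ c :=
  csSup_le ⟨0, fun _ => 0, LipschitzWith.const' 0 |>.weaken zero_le_one, by simp⟩
    (by rintro _ ⟨φ, hφ, rfl⟩; exact h φ hφ)
lemma W1_nonneg (μ ν : PTd d) : 0 ≤ W1 μ ν := by
  have := le_W1 μ ν (φ := fun _ => 0) (LipschitzWith.const' 0 |>.weaken zero_le_one)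
  simpa using this
lemma W1_comm (μ ν : PTd d) : W1 μ ν = W1 ν μ := by
  have key : ∀ μ ν : PTd d, W1 μ ν ≤ W1 ν μ := fun μ ν => W1_le _ _ fun φ hφ => by
    have := le_W1 ν μ (φ := fun y => - φ y) hφ.neg
    rw [integral_neg, integral_neg] at this
    linarith
  exact le_antisymm (key _ _) (key _ _)
lemma lip_W1 (μ ν : PTd d) {φ : Td d → ℝ} {L : ℝ} (hL : 0 ≤ L)
    (h : ∀ y y', |φ y - φ y'| ≤ L * dist y y') :
    |(∫ y, φ y ∂(μ : Measure (Td d))) - ∫ y, φ y ∂(ν : Measure (Td d))| ≤ L * W1 μ ν := by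
  rcases hL.eq_or_lt with rfl | hL
  · have : ∀ y, φ y = φ 0 := fun y => by
      have := h y 0
      rw [zero_mul] at this
      linarith [abs_nonpos_iff.1 this]
    rw [integral_congr_ae (Eventually.of_forall this), integral_congr_ae (Eventually.of_forall this)]
    simp
  have hφ : LipschitzWith 1 fun y => L⁻¹ * φ y := by
    refine LipschitzWith.of_dist_le_mul fun y y' => ?_
    rw [Real.dist_eq, ← mul_sub, abs_mul, abs_of_pos (inv_pos.2 hL), inv_mul_le_iff₀ hL]
    simpa using h y y'
  have h1 := le_W1 μ ν hφ
  have h2 := le_W1 ν μ hφ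
  rw [W1_comm ν μ] at h2
  simp only [integral_const_mul, ← mul_sub] at h1 h2
  rw [inv_mul_le_iff₀ hL] at h1 h2
  exact abs_le.2 ⟨by linarith, h1⟩
lemma W1_cont {d : ℕ} : Continuous fun q : PTd d × PTd d => W1 q.1 q.2 := by
  let K : Set (BoundedContinuousFunction (Td d) ℝ) := {f | LipschitzWith 1 f ∧ f 0 = 0}
  have hK : IsCompact K := by
    refine BoundedContinuousFunction.arzela_ascoli₂ (Icc (-1) 1) isCompact_Icc K ?_ ?_ ?_
    · have : K = (⋂ (y : Td d) (y' : Td d), {f | dist (f y) (f y') ≤ dist y y'}) ∩ {f | f 0 = 0} := by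
        ext f
        simp only [K, mem_ofPred_eq, mem_inter_iff, mem_iInter]
        refine and_congr_left fun _ => ⟨fun h y y' => by simpa using h.dist_le_mul y y',
          fun h => LipschitzWith.of_dist_le_mul (by simpa using h)⟩
      rw [this]
      refine IsClosed.inter (isClosed_iInter fun y => isClosed_iInter fun y' => ?_) ?_
      · exact isClosed_le (by fun_prop) continuous_const
      · exact isClosed_eq (by fun_prop) continuous_const
    · rintro f y ⟨h, h0⟩
      have := osc_lip h y 0
      rw [h0, sub_zero] at this
      exact abs_le.1 (by simpa using this)
    · refine UniformEquicontinuous.equicontinuous (Metric.uniformEquicontinuous_of_continuity_modulus (fun x => x) tendsto_id _ ?_)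
      rintro y y' ⟨f, hf⟩
      simpa using hf.1.dist_le_mul y y'
  have hc : Continuous (fun q : (PTd d × PTd d) × BoundedContinuousFunction (Td d) ℝ =>
      (∫ y, q.2 y ∂(q.1.1 : Measure (Td d))) - ∫ y, q.2 y ∂(q.1.2 : Measure (Td d))) := by
    refine Continuous.sub ?_ ?_
    · exact cont_integral (m := fun q : (PTd d × PTd d) × BoundedContinuousFunction (Td d) ℝ => q.1.1)
        (f := fun q y => q.2 y) (by fun_prop) (by fun_prop)
    · exact cont_integral (m := fun q : (PTd d × PTd d) × BoundedContinuousFunction (Td d) ℝ => q.1.2)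
        (f := fun q y => q.2 y) (by fun_prop) (by fun_prop)
  have := hK.continuous_sSup (f := fun (q : PTd d × PTd d) (φ : BoundedContinuousFunction (Td d) ℝ) =>
    (∫ y, φ y ∂(q.1 : Measure (Td d))) - ∫ y, φ y ∂(q.2 : Measure (Td d))) hc
  convert this using 2 with q
  unfold W1
  congr 1
  ext r
  constructor
  · rintro ⟨φ, hφ, rfl⟩
    have hb : LipschitzWith 1 fun y => φ y - φ 0 :=
      LipschitzWith.of_dist_le_mul fun y y' => by simpa using hφ.dist_le_mul y y'
    refine ⟨BoundedContinuousFunction.mkOfCompact ⟨_, hb.continuous⟩, ⟨hb, by simp⟩, ?_⟩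
    exact (int_sub_const _ _ hφ.continuous _).symm
  · rintro ⟨f, hf, rfl⟩
    exact ⟨f, hf.1, rfl⟩
lemma W1_self (μ : PTd d) : W1 μ μ = 0 :=
  le_antisymm (W1_le _ _ fun _ _ => by simp) (W1_nonneg _ _)
lemma tendsto_of_W1 {ι : Type*} {l : Filter ι} [l.IsCountablyGenerated] {m : ι → PTd d} {μ : PTd d}
    (h : Tendsto (fun i => W1 (m i) μ) l (𝓝 0)) : Tendsto m l (𝓝 μ) := by
  rw [tendsto_iff_forall_lipschitz_integral_tendsto]
  rintro f - ⟨L, hL⟩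
  rw [tendsto_iff_dist_tendsto_zero]
  refine squeeze_zero (fun _ => dist_nonneg) (fun i => ?_) (by simpa using h.const_mul (L:ℝ))
  rw [Real.dist_eq]
  exact lip_W1 _ _ L.2 fun y y' => by simpa [Real.dist_eq] using hL.dist_le_mul y y'
lemma tendsto_W1 {ι : Type*} {l : Filter ι} {m : ι → PTd d} {μ : PTd d}
    (h : Tendsto m l (𝓝 μ)) : Tendsto (fun i => W1 (m i) μ) l (𝓝 0) := by
  have := (W1_cont (d := d)).tendsto (μ, μ) |>.comp (h.prodMk_nhds (tendsto_const_nhds (x := μ)))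
  simpa [Function.comp_def, W1_self] using this
lemma W1ContOn_of_cont {m : ℝ → PTd d} {I : Set ℝ} (h : ContinuousOn m I) : W1ContOn m I := by
  intro t ht ε hε
  have := (tendsto_W1 (h t ht)).eventually (gt_mem_nhds hε)
  obtain ⟨η, hη, h⟩ := Metric.mem_nhdsWithin_iff.1 this
  exact ⟨η, hη, fun s hs hst => h ⟨by simpa [Real.dist_eq] using hst, hs⟩⟩
lemma cont_of_W1ContOn {m : ℝ → PTd d} {I : Set ℝ} (h : W1ContOn m I) : ContinuousOn m I := by
  intro t ht
  refine tendsto_of_W1 (Metric.tendsto_nhds.2 fun ε hε => ?_)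
  obtain ⟨η, hη, h⟩ := h t ht ε hε
  refine Metric.mem_nhdsWithin_iff.2 ⟨η, hη, fun s hs => ?_⟩
  have := h s hs.2 (by simpa [Real.dist_eq] using hs.1)
  simpa [abs_of_nonneg (W1_nonneg _ _)] using this
lemma cont_of_W1Continuous {χ : PTd d → ℝ} (h : W1Continuous χ) : Continuous χ := by
  refine continuous_iff_continuousAt.2 fun μ => Metric.tendsto_nhds.2 fun ε hε => ?_
  obtain ⟨η, hη, h⟩ := h μ ε hε
  filter_upwards [(tendsto_W1 (m := fun ν : PTd d => ν) (μ := μ) tendsto_id).eventually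
    (gt_mem_nhds hη)] with ν hν
  exact h ν (by rwa [W1_comm])
end
section
open scoped Topology NNReal ENNReal
variable {d : ℕ}
def algC2 (d : ℕ) : Subalgebra ℝ C(Td d, ℝ) where
  carrier := {f | ContDiff ℝ 2 fun x => f (pT x)}
  mul_mem' := fun ha hb => by
    simp only [mem_ofPred_eq] at *
    exact ContDiff.mul ha hb
  add_mem' := fun ha hb => by
    simp only [mem_ofPred_eq] at *
    exact ContDiff.add ha hb
  algebraMap_mem' := fun r => by
    simp only [mem_ofPred_eq]
    exact contDiff_const
lemma algC2_dense : (algC2 d).topologicalClosure = ⊤ := by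
  refine ContinuousMap.subalgebra_topologicalClosure_eq_top_of_separatesPoints _ ?_
  intro y y' hne
  obtain ⟨i, hi⟩ := Function.ne_iff.1 hne
  have hc : AddCircle.toCircle (y i) ≠ AddCircle.toCircle (y' i) := fun h =>
    hi (AddCircle.injective_toCircle one_ne_zero h)
  have hcont : Continuous fun y : Td d => ((AddCircle.toCircle (y i) : Circle) : ℂ) :=
    continuous_subtype_val.comp (AddCircle.continuous_toCircle.comp (continuous_apply i))
  have hform : ∀ x : Vd d, ((AddCircle.toCircle ((x i : ℝ) : AddCircle (1:ℝ)) : Circle) : ℂ) =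
      Complex.exp ((2 * π / 1 * x i : ℝ) * Complex.I) := fun x => by
    rw [AddCircle.toCircle_apply_mk, Circle.coe_exp]
  by_cases hre : ((AddCircle.toCircle (y i) : Circle) : ℂ).re = ((AddCircle.toCircle (y' i) : Circle) : ℂ).re
  · have him : ((AddCircle.toCircle (y i) : Circle) : ℂ).im ≠ ((AddCircle.toCircle (y' i) : Circle) : ℂ).im :=
      fun h => hc (Subtype.ext (Complex.ext hre h))
    refine ⟨_, ⟨⟨fun y : Td d => ((AddCircle.toCircle (y i) : Circle) : ℂ).im,
      Complex.continuous_im.comp hcont⟩, ?_, rfl⟩, him⟩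
    change ContDiff ℝ 2 fun x : Vd d => ((AddCircle.toCircle ((x i : ℝ) : AddCircle (1:ℝ)) : Circle) : ℂ).im
    simp only [hform, Complex.exp_ofReal_mul_I_im]
    fun_prop
  · refine ⟨_, ⟨⟨fun y : Td d => ((AddCircle.toCircle (y i) : Circle) : ℂ).re,
      Complex.continuous_re.comp hcont⟩, ?_, rfl⟩, hre⟩
    change ContDiff ℝ 2 fun x : Vd d => ((AddCircle.toCircle ((x i : ℝ) : AddCircle (1:ℝ)) : Circle) : ℂ).re
    simp only [hform, Complex.exp_ofReal_mul_I_re]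
    fun_prop
lemma pT_int (x : Vd d) (z : Fin d → ℤ) : pT (x + intVec z) = pT x := by
  funext i
  simp [pT, intVec]
lemma dense_C2 (f : C(Td d, ℝ)) {ε : ℝ} (hε : 0 < ε) : ∃ g : Vd d → ℝ, ContDiff ℝ 2 g ∧ Per g ∧
    ∀ y, |f y - g (secT y)| ≤ ε := by
  have : f ∈ (algC2 d).topologicalClosure := by rw [algC2_dense]; trivial
  obtain ⟨g, hg, hfg⟩ := Metric.mem_closure_iff.1 this ε hε
  refine ⟨fun x => g (pT x), hg, fun x z => by simp only [pT_int], fun y => ?_⟩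
  simp only [pT_secT]; rw [← Real.dist_eq]
  exact (ContinuousMap.dist_apply_le_dist y).trans hfg.le
lemma int_sub_le (μ : PTd d) {f g : Td d → ℝ} (hf : Continuous f) (hg : Continuous g) {ε : ℝ}
    (h : ∀ y, |f y - g y| ≤ ε) :
    |(∫ y, f y ∂(μ : Measure (Td d))) - ∫ y, g y ∂(μ : Measure (Td d))| ≤ ε := by
  rw [← integral_sub (integrable_cont _ hf) (integrable_cont _ hg)]
  have := norm_integral_le_of_norm_le_const (μ := (μ : Measure (Td d))) (f := fun y => f y - g y)
      (C := ε) (Eventually.of_forall h)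
  simpa using this
lemma tendsto_C2 {ι : Type*} {l : Filter ι} {m : ι → PTd d} {μ : PTd d}
    (h : ∀ f : Vd d → ℝ, ContDiff ℝ 2 f → Per f →
      Tendsto (fun i => ∫ y, f (secT y) ∂(m i : Measure (Td d))) l
        (𝓝 (∫ y, f (secT y) ∂(μ : Measure (Td d))))) : Tendsto m l (𝓝 μ) := by
  refine ProbabilityMeasure.tendsto_iff_forall_integral_tendsto.2 fun f => ?_
  rw [Metric.tendsto_nhds]
  intro ε hε
  obtain ⟨g, hg, hgp, hfg⟩ := dense_C2 f.toContinuousMap (show 0 < ε / 4 by positivity)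
  filter_upwards [(Metric.tendsto_nhds.1 (h g hg hgp)) (ε / 4) (by positivity)] with i hi
  have hgc := cont_sec' hg.continuous hgp
  have h1 := int_sub_le (m i) f.continuous hgc hfg
  have h2 := int_sub_le μ f.continuous hgc hfg
  rw [Real.dist_eq] at hi ⊢
  rw [abs_le] at h1 h2
  rw [abs_lt] at hi ⊢
  constructor <;> linarith
lemma eq_of_C2 {μ ν : PTd d} (h : ∀ f : Vd d → ℝ, ContDiff ℝ 2 f → Per f →
      ∫ y, f (secT y) ∂(μ : Measure (Td d)) = ∫ y, f (secT y) ∂(ν : Measure (Td d))) : μ = ν := by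
  have : Tendsto (fun _ : ℕ => μ) atTop (𝓝 ν) := tendsto_C2 fun f hf hp => by
    rw [h f hf hp]; exact tendsto_const_nhds
  exact tendsto_nhds_unique tendsto_const_nhds this
lemma cont_C2 {P : Type*} [TopologicalSpace P] {m : P → PTd d} (h : ∀ f : Vd d → ℝ, ContDiff ℝ 2 f →
    Per f → Continuous fun p => ∫ y, f (secT y) ∂(m p : Measure (Td d))) : Continuous m :=
  continuous_iff_continuousAt.2 fun p => tendsto_C2 fun f hf hp => (h f hf hp).continuousAt.tendsto
end
section
open scoped Topology NNReal ENNReal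
variable {d : ℕ}
lemma dotp_add_left (a b c : Vd d) : dotp (a + b) c = dotp a c + dotp b c := by
  simp [dotp, add_mul, Finset.sum_add_distrib]
lemma dotp_add_right (a b c : Vd d) : dotp a (b + c) = dotp a b + dotp a c := by
  simp [dotp, mul_add, Finset.sum_add_distrib]
lemma dotp_sub_left (a b c : Vd d) : dotp (a - b) c = dotp a c - dotp b c := by
  simp [dotp, sub_mul, Finset.sum_sub_distrib]
lemma dotp_sub_right (a b c : Vd d) : dotp a (b - c) = dotp a b - dotp a c := by
  simp [dotp, mul_sub, Finset.sum_sub_distrib]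
lemma dotp_smul_right (t : ℝ) (a b : Vd d) : dotp a (t • b) = t * dotp a b := by
  simp only [dotp, Finset.mul_sum, Pi.smul_apply, smul_eq_mul]
  exact Finset.sum_congr rfl fun i _ => by ring
lemma dotp_smul_left (t : ℝ) (a b : Vd d) : dotp (t • a) b = t * dotp a b := by
  simp only [dotp, Finset.mul_sum, Pi.smul_apply, smul_eq_mul]
  exact Finset.sum_congr rfl fun i _ => by ring
lemma dotp_self (a : Vd d) : dotp a a = sqnorm a := by
  simp [dotp, sqnorm, sq]
lemma dotp_comm (a b : Vd d) : dotp a b = dotp b a := by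
  simp [dotp, mul_comm]
lemma sqnorm_nonneg (a : Vd d) : 0 ≤ sqnorm a := Finset.sum_nonneg fun _ _ => sq_nonneg _
lemma sqnorm_smul (t : ℝ) (a : Vd d) : sqnorm (t • a) = t ^ 2 * sqnorm a := by
  rw [← dotp_self, dotp_smul_left, dotp_smul_right, dotp_self]; ring
lemma dotp_young {ε : ℝ} (hε : 0 < ε) (a b : Vd d) : dotp a b ≤ ε * sqnorm a + sqnorm b / (4 * ε) := by
  have h := sqnorm_nonneg ((2 * ε) • a - b)
  rw [← dotp_self, dotp_sub_left, dotp_sub_right, dotp_sub_right, dotp_smul_left, dotp_smul_left,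
    dotp_smul_right, dotp_smul_right, dotp_comm b a, dotp_self, dotp_self] at h
  have : ε * sqnorm a + sqnorm b / (4 * ε) - dotp a b =
    (2 * ε * (2 * ε * sqnorm a) - 2 * ε * dotp a b - (2 * ε * dotp a b - sqnorm b)) / (4 * ε) := by
    field_simp; ring
  have h2 := div_nonneg h (show 0 ≤ 4 * ε by positivity)
  linarith
lemma sqnorm_add_le (a b : Vd d) : sqnorm (a + b) ≤ 2 * sqnorm a + 2 * sqnorm b := by
  simp only [sqnorm, Finset.mul_sum, ← Finset.sum_add_distrib, Pi.add_apply]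
  exact Finset.sum_le_sum fun i _ => by nlinarith [sq_nonneg (a i - b i)]
lemma sqnorm_sub_comm (a b : Vd d) : sqnorm (a - b) = sqnorm (b - a) := by
  simp only [sqnorm, Pi.sub_apply]
  exact Finset.sum_congr rfl fun i _ => by ring
lemma abs_le_norm (a : Vd d) (i : Fin d) : |a i| ≤ ‖a‖ := norm_le_pi_norm a i
lemma sqnorm_le (a : Vd d) : sqnorm a ≤ d * ‖a‖ ^ 2 := by
  calc sqnorm a ≤ ∑ _i : Fin d, ‖a‖ ^ 2 := Finset.sum_le_sum fun i _ => by
        rw [← sq_abs]; exact pow_le_pow_left₀ (abs_nonneg _) (abs_le_norm a i) 2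
    _ = _ := by simp
lemma norm_sq_le (a : Vd d) : ‖a‖ ^ 2 ≤ sqnorm a := by
  have : ‖a‖ ≤ √(sqnorm a) := (pi_norm_le_iff_of_nonneg (Real.sqrt_nonneg _)).2 fun i => by
    rw [Real.norm_eq_abs]
    refine Real.abs_le_sqrt ?_
    exact Finset.single_le_sum (f := fun i => (a i) ^ 2) (fun _ _ => sq_nonneg _) (Finset.mem_univ i)
  calc _ ≤ (√(sqnorm a)) ^ 2 := pow_le_pow_left₀ (norm_nonneg _) this 2
    _ = _ := Real.sq_sqrt (sqnorm_nonneg a)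
lemma dotp_le (a b : Vd d) : |dotp a b| ≤ d * ‖a‖ * ‖b‖ := by
  calc |dotp a b| ≤ ∑ i : Fin d, |a i * b i| := Finset.abs_sum_le_sum_abs _ _
    _ ≤ ∑ _i : Fin d, ‖a‖ * ‖b‖ := Finset.sum_le_sum fun i _ => by
        rw [abs_mul]; exact mul_le_mul (abs_le_norm a i) (abs_le_norm b i) (abs_nonneg _) (norm_nonneg _)
    _ = _ := by simp [mul_assoc]
lemma fderiv_eq_dotp (f : Vd d → ℝ) (x v : Vd d) : fderiv ℝ f x v = dotp (gradv f x) v := by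
  have := LinearMap.pi_apply_eq_sum_univ (fderiv ℝ f x : Vd d →ₗ[ℝ] ℝ) v
  rw [ContinuousLinearMap.coe_coe] at this
  rw [this]
  simp only [dotp, gradv, smul_eq_mul]
  refine Finset.sum_congr rfl fun i _ => ?_
  rw [mul_comm]; congr 2
  funext j; simp [Pi.single_apply, eq_comm]
lemma taylor1 {g g' g'' : ℝ → ℝ} {k : ℝ} (h1 : ∀ t, HasDerivAt g (g' t) t)
    (h2 : ∀ t, HasDerivAt g' (g'' t) t) (hk : ∀ t, k ≤ g'' t) : g 0 + g' 0 + k / 2 ≤ g 1 := by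
  have e1 : Monotone fun t => g' t - k * t := by
    have h4 : ∀ t, HasDerivAt (fun t => g' t - k * t) (g'' t - k) t := fun t => by
      exact HasDerivAt.congr_deriv ((h2 t).sub ((hasDerivAt_id t).const_mul k)) (by simp)
    refine monotone_of_deriv_nonneg (fun t => (h4 t).differentiableAt) fun t => ?_
    rw [(h4 t).deriv]
    simpa using hk t
  have h3 : ∀ t, HasDerivAt (fun t => g t - g' 0 * t - k * t ^ 2 / 2) (g' t - g' 0 - k * t) t :=
    fun t => by
      refine HasDerivAt.congr_deriv (((h1 t).sub ((hasDerivAt_id t).const_mul (g' 0))).sub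
        ((((hasDerivAt_id t).pow 2).const_mul k).div_const 2)) ?_
      simp; ring
  have e2 : MonotoneOn (fun t => g t - g' 0 * t - k * t ^ 2 / 2) (Icc 0 1) := by
    refine monotoneOn_of_deriv_nonneg (convex_Icc 0 1)
      (fun t _ => (h3 t).continuousAt.continuousWithinAt)
      (fun t _ => (h3 t).differentiableAt.differentiableWithinAt) fun t ht => ?_
    rw [interior_Icc] at ht
    rw [(h3 t).deriv]
    have := e1 ht.1.le
    simp at this
    linarith
  have := e2 (left_mem_Icc.2 zero_le_one) (right_mem_Icc.2 zero_le_one) zero_le_one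
  simp at this
  linarith
lemma line_deriv {f : Vd d → ℝ} (hf : Differentiable ℝ f) (p q : Vd d) (t : ℝ) :
    HasDerivAt (fun t : ℝ => f (p + t • q)) (fderiv ℝ f (p + t • q) q) t := by
  have h1 : HasDerivAt (fun t : ℝ => p + t • q) q t := by
    simpa using ((hasDerivAt_id t).smul_const q).const_add p
  exact (hf _).hasFDerivAt.comp_hasDerivAt t h1
lemma diff_fderiv {f : Vd d → ℝ} (hf : ContDiff ℝ 2 f) (v : Vd d) :
    ContDiff ℝ 1 fun y => fderiv ℝ f y v :=
  (hf.fderiv_right (m := 1) (by norm_num)).clm_apply contDiff_const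
variable (S : MFGSetting d)
lemma H_p (x : Vd d) : ContDiff ℝ 2 (S.H x) :=
  S.H_smooth.comp (contDiff_const.prodMk contDiff_id)
lemma H_x (p : Vd d) : ContDiff ℝ 2 (fun x => S.H x p) :=
  S.H_smooth.comp (contDiff_id.prodMk contDiff_const)
lemma fderiv_p (x p v : Vd d) : fderiv ℝ (S.H x) p v =
    fderiv ℝ (fun q : Vd d × Vd d => S.H q.1 q.2) (x, p) (0, v) := by
  have h1 : HasFDerivAt (fun q : Vd d × Vd d => S.H q.1 q.2)
    (fderiv ℝ (fun q : Vd d × Vd d => S.H q.1 q.2) (x, p)) (x, p) :=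
    (S.H_smooth.differentiable (by norm_num) _).hasFDerivAt
  have h2 : HasFDerivAt (fun p : Vd d => (x, p)) (ContinuousLinearMap.inr ℝ (Vd d) (Vd d)) p :=
    hasFDerivAt_prodMk_right x p
  have := (h1.comp p h2).fderiv
  change fderiv ℝ (S.H x) p = _ at this
  rw [this]; simp
lemma fderiv_p_smooth (v : Vd d) :
    ContDiff ℝ 1 fun q : Vd d × Vd d => fderiv ℝ (S.H q.1) q.2 v := by
  simp only [fderiv_p]
  exact (S.H_smooth.fderiv_right (m := 1) (by norm_num)).clm_apply contDiff_const
lemma DpH_cont : Continuous fun q : Vd d × Vd d => DpH S q.1 q.2 :=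
  continuous_pi fun _ => (fderiv_p_smooth S _).continuous
lemma H_per' (p : Vd d) : Per fun x => S.H x p := fun x z => S.H_per x z p
lemma DpH_per (p : Vd d) (i : Fin d) : Per fun x => DpH S x p i := fun x z => by
  simp only [DpH, S.H_per]
lemma H_lower (x p q : Vd d) :
    S.H x p + dotp (DpH S x p) q + S.Cbar⁻¹ * sqnorm q / 2 ≤ S.H x (p + q) := by
  have := taylor1 (g := fun t => S.H x (p + t • q)) (k := S.Cbar⁻¹ * sqnorm q)
    (fun t => line_deriv ((H_p S x).differentiable (by norm_num)) p q t)
    (fun t => line_deriv ((diff_fderiv (H_p S x) q).differentiable (by norm_num)) p q t)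
    (fun t => S.Dpp_lower x (p + t • q) q)
  have e : fderiv ℝ (S.H x) p q = dotp (DpH S x p) q := fderiv_eq_dotp _ _ _
  simp only [zero_smul, add_zero, one_smul, e] at this
  linarith
lemma H_upper (x p q : Vd d) :
    S.H x (p + q) ≤ S.H x p + dotp (DpH S x p) q + S.Cbar * sqnorm q / 2 := by
  have := taylor1 (g := fun t => - S.H x (p + t • q)) (k := - (S.Cbar * sqnorm q))
    (fun t => (line_deriv ((H_p S x).differentiable (by norm_num)) p q t).neg)
    (fun t => (line_deriv ((diff_fderiv (H_p S x) q).differentiable (by norm_num)) p q t).neg)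
    (fun t => neg_le_neg (S.Dpp_upper x (p + t • q) q))
  have e : fderiv ℝ (S.H x) p q = dotp (DpH S x p) q := fderiv_eq_dotp _ _ _
  simp only [zero_smul, add_zero, one_smul, e] at this
  linarith
lemma DpH_lip (x p q : Vd d) :
    sqnorm (DpH S x p - DpH S x q) ≤ 2 * S.Cbar ^ 2 * sqnorm (p - q) := by
  have hC := S.Cbar_pos
  set g := DpH S x p - DpH S x q with hg
  have hi : ∀ v : Vd d, 0 ≤ S.Cbar⁻¹ * sqnorm v / 2 := fun v => by
    have := sqnorm_nonneg v; positivity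
  have e1 := H_upper S x q (S.Cbar⁻¹ • g)
  have e2 := H_lower S x p (q + S.Cbar⁻¹ • g - p)
  have e3 := H_lower S x q (p - q)
  have e4 := H_upper S x q (p - q)
  have e5 := H_lower S x p (q - p)
  have e6 := H_upper S x p (q - p)
  have i2 := hi (q + S.Cbar⁻¹ • g - p)
  have i3 := hi (p - q)
  have i5 := hi (q - p)
  simp only [add_sub_cancel] at e1 e2 e3 e4 e5 e6
  have e7 : dotp g (S.Cbar⁻¹ • g) = S.Cbar⁻¹ * sqnorm g := by rw [dotp_smul_right, dotp_self]
  rw [hg, dotp_sub_left, ← hg] at e7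
  rw [dotp_sub_right, dotp_add_right] at e2
  rw [dotp_sub_right] at e3 e4 e5 e6
  rw [sqnorm_smul] at e1
  rw [sqnorm_sub_comm q p] at e6
  have e8 : S.Cbar * (S.Cbar⁻¹ ^ 2 * sqnorm g) / 2 = S.Cbar⁻¹ * sqnorm g / 2 := by field_simp
  have e9 : S.Cbar⁻¹ * sqnorm g / 2 ≤ S.Cbar * sqnorm (p - q) := by
    linarith
  have : sqnorm g = S.Cbar * (S.Cbar⁻¹ * sqnorm g / 2) * 2 := by field_simp
  rw [this]
  nlinarith
end
section
open scoped Topology NNReal ENNReal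
variable {d : ℕ} (S : MFGSetting d)
lemma H_cont : Continuous fun q : Vd d × Vd d => S.H q.1 q.2 := S.H_smooth.continuous
lemma H_zero_bd : ∃ C, 0 ≤ C ∧ (∀ x, |S.H x 0| ≤ C) ∧ ∀ x, sqnorm (DpH S x 0) ≤ C := by
  obtain ⟨C, hC, h⟩ := per_bdd (H_x S 0).continuous (H_per' S 0)
  have h1 : Per fun x => sqnorm (DpH S x 0) := fun x z => by
    have : DpH S (x + intVec z) 0 = DpH S x 0 := funext fun i => DpH_per S 0 i x z
    simp only [this]
  have h2 : Continuous fun x => sqnorm (DpH S x 0) := by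
    have : Continuous fun x => DpH S x 0 := (DpH_cont S).comp (continuous_id.prodMk continuous_const)
    unfold sqnorm
    fun_prop
  obtain ⟨C', hC', h'⟩ := per_bdd h2 h1
  exact ⟨C + C', by positivity, fun x => (h x).trans (by linarith), fun x =>
    (le_abs_self _).trans ((h' x).trans (by linarith))⟩
/-- quadratic bounds -/
lemma H_quad : ∃ c C : ℝ, 0 < c ∧ 0 < C ∧ (∀ x p, c * sqnorm p - C ≤ S.H x p) ∧
    (∀ x p, S.H x p ≤ C * (1 + sqnorm p)) ∧ (∀ x p, sqnorm (DpH S x p) ≤ C * (1 + sqnorm p)) := by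
  obtain ⟨C, hC, h0, h1⟩ := H_zero_bd S
  have hb := S.Cbar_pos
  have hbi : 0 < S.Cbar⁻¹ := inv_pos.2 hb
  refine ⟨S.Cbar⁻¹ / 4, C + C * S.Cbar + 2 * C + 1 + S.Cbar + 4 * S.Cbar ^ 2, by positivity,
    by positivity, fun x p => ?_, fun x p => ?_, fun x p => ?_⟩
  · have e := H_lower S x 0 p
    rw [zero_add] at e
    have y := dotp_young (ε := S.Cbar) hb (-DpH S x 0) p
    have e2 : dotp (-DpH S x 0) p = - dotp (DpH S x 0) p := by simp [dotp]
    have e3 : sqnorm (-DpH S x 0) = sqnorm (DpH S x 0) := by simp [sqnorm]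
    have e4 : sqnorm p / (4 * S.Cbar) = S.Cbar⁻¹ / 4 * sqnorm p := by field_simp
    rw [e2, e3, e4] at y
    have := mlL (h1 x) hb.le
    have := (abs_le.1 (h0 x)).1
    have : 0 ≤ 2 * C + S.Cbar + 4 * S.Cbar ^ 2 := by positivity
    linarith
  · have e := H_upper S x 0 p
    rw [zero_add] at e
    have y := dotp_young (ε := 1) one_pos (DpH S x 0) p
    have := (abs_le.1 (h0 x)).2
    have := h1 x
    have hp := sqnorm_nonneg p
    have : 0 ≤ (C + C * S.Cbar + 2 * C + 4 * S.Cbar ^ 2) * sqnorm p := by positivity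
    have : 0 ≤ C * S.Cbar + S.Cbar + 4 * S.Cbar ^ 2 := by positivity
    have : 0 ≤ S.Cbar * sqnorm p := by positivity
    linarith
  · have e := DpH_lip S x p 0
    have e2 := sqnorm_add_le (DpH S x p - DpH S x 0) (DpH S x 0)
    rw [sub_add_cancel] at e2
    rw [sub_zero] at e
    have := h1 x
    have hp := sqnorm_nonneg p
    have : 0 ≤ (C + C * S.Cbar + 2 * C + 1 + S.Cbar) * sqnorm p := by positivity
    have : 0 ≤ C * S.Cbar + S.Cbar + 4 * S.Cbar ^ 2 := by positivity
    linarith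
/-- scaling -/
lemma H_scale (x p : Vd d) {k : ℝ} (hk : 0 ≤ k) :
    (1 + k) * S.H x ((1 + k)⁻¹ • p) ≤ S.H x p + k * S.H x 0
      - S.Cbar⁻¹ / 2 * (k / (1 + k)) * sqnorm p := by
  have h1 : (0:ℝ) < 1 + k := by linarith
  set q := (1 + k)⁻¹ • p
  have e1 := H_lower S x q (p - q)
  have e2 := H_lower S x q (0 - q)
  rw [add_sub_cancel] at e1 e2
  have hpq : p = (1 + k) • q := by simp only [q]; rw [smul_smul, mul_inv_cancel₀ h1.ne', one_smul]
  have f1 : p - q = k • q := by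
    nth_rewrite 1 [hpq]; rw [add_smul, one_smul, add_sub_cancel_left]
  have f2 : 0 - q = (-1 : ℝ) • q := by simp
  rw [f1, dotp_smul_right, sqnorm_smul] at e1
  rw [f2, dotp_smul_right, sqnorm_smul] at e2
  rw [show sqnorm p = (1 + k) ^ 2 * sqnorm q by rw [← sqnorm_smul, ← hpq]]
  have e3 : S.Cbar⁻¹ / 2 * (k / (1 + k)) * ((1 + k) ^ 2 * sqnorm q) =
    S.Cbar⁻¹ * (k ^ 2 * sqnorm q) / 2 + k * (S.Cbar⁻¹ * ((-1) ^ 2 * sqnorm q) / 2) := by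
    field_simp; ring
  rw [e3]
  have := mlL e2 hk
  linarith
lemma red_int (h : Vd d) : ∃ (h' : Vd d) (z : Fin d → ℤ), h = h' + intVec z ∧ ‖h'‖ ≤ 1 ∧ ‖h'‖ ≤ ‖h‖ := by
  by_cases hh : ‖h‖ ≤ 1
  · exact ⟨h, 0, by funext i; simp [intVec], hh, le_rfl⟩
  · have : ‖fun i => Int.fract (h i)‖ ≤ 1 := (pi_norm_le_iff_of_nonneg zero_le_one).2 fun i => by
      rw [Real.norm_eq_abs, abs_of_nonneg (Int.fract_nonneg _)]; exact (Int.fract_lt_one _).le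
    exact ⟨fun i => Int.fract (h i), fun i => ⌊h i⌋, by funext i; exact (Int.fract_add_floor (h i)).symm, this,
      this.trans (not_le.1 hh).le⟩
lemma H_x_lip : ∃ C, 0 < C ∧ ∀ x h p : Vd d,
    |S.H (x + h) p - S.H x p| ≤ C * (min 1 ‖h‖) * (1 + ‖p‖) ^ (1 + S.θ) := by
  obtain ⟨θ0, θ1⟩ := S.θ_mem
  -- Lipschitz bound of H(·,0)
  obtain ⟨C0, hC0, hl0⟩ : ∃ C, 0 ≤ C ∧ ∀ x, ‖fderiv ℝ (fun x => S.H x 0) x‖ ≤ C := by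
    have hc : Continuous fun x => ‖fderiv ℝ (fun x => S.H x 0) x‖ :=
      ((H_x S 0).continuous_fderiv (by norm_num)).norm
    obtain ⟨C, hC, h⟩ := per_bdd hc (fun x z => by
      have : (fun y => S.H (y + intVec z) 0) = fun y => S.H y 0 := funext fun y => S.H_per y z 0
      rw [← fderiv_comp_add_right, this])
    exact ⟨C, hC, fun x => by simpa using h x⟩
  have hCg := S.Cg_pos
  refine ⟨C0 + S.Cg, by positivity, fun x h p => ?_⟩
  obtain ⟨h', z, hz, hn1, hn⟩ := red_int h
  rw [hz, ← add_assoc, S.H_per, ← hz]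
  have hmin : ‖h'‖ ≤ min 1 ‖h‖ := le_min hn1 hn
  have hone : (1:ℝ) ≤ (1 + ‖p‖) ^ (1 + S.θ) :=
    Real.one_le_rpow (by linarith [norm_nonneg p]) (by linarith)
  have b0 : |S.H (x + h') 0 - S.H x 0| ≤ C0 * ‖h'‖ := by
    have := Convex.norm_image_sub_le_of_norm_fderiv_le (𝕜 := ℝ) (f := fun x => S.H x 0)
      (C := C0) (s := univ) (x := x) (y := x + h')
      (fun y _ => (H_x S 0).differentiable (by norm_num) y) (fun y _ => hl0 y) convex_univ trivial trivial
    simpa using this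
  have b1 : ∀ t ∈ Icc (0:ℝ) 1, |fderiv ℝ (S.H (x + h')) (0 + t • p) p - fderiv ℝ (S.H x) (0 + t • p) p| ≤
      S.Cg * (1 + ‖p‖) ^ (1 + S.θ) * ‖h'‖ := by
    intro t ht
    have hd : Differentiable ℝ fun x' => fderiv ℝ (S.H x') (0 + t • p) p :=
      ((fderiv_p_smooth S p).comp (contDiff_id.prodMk contDiff_const)).differentiable (by norm_num)
    have := Convex.norm_image_sub_le_of_norm_fderiv_le (𝕜 := ℝ)
      (f := fun x' => fderiv ℝ (S.H x') (0 + t • p) p)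
      (C := S.Cg * (1 + ‖p‖) ^ (1 + S.θ)) (s := univ) (x := x) (y := x + h')
      (fun y _ => hd y) (fun y _ => ?_) convex_univ trivial trivial
    · simpa using this
    · have hp1 : 0 < 1 + ‖p‖ := by positivity
      refine ContinuousLinearMap.opNorm_le_bound _ (by positivity) fun w => ?_
      refine (S.Dxp_growth y (0 + t • p) p w).trans ?_
      have h3 : ‖0 + t • p‖ ≤ ‖p‖ := by
        rw [zero_add, norm_smul, Real.norm_eq_abs, abs_of_nonneg ht.1]
        nlinarith [norm_nonneg p, ht.2]
      rw [Real.rpow_add hp1, Real.rpow_one, mul_comm (1 + ‖p‖), ← mul_assoc]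
      gcongr
      linarith
  have b2 : |(S.H (x + h') p - S.H x p) - (S.H (x + h') 0 - S.H x 0)| ≤
      S.Cg * (1 + ‖p‖) ^ (1 + S.θ) * ‖h'‖ := by
    have := Convex.norm_image_sub_le_of_norm_hasDerivWithin_le
      (f := fun t : ℝ => S.H (x + h') (0 + t • p) - S.H x (0 + t • p)) (s := Icc 0 1) (x := 0) (y := 1)
      (C := S.Cg * (1 + ‖p‖) ^ (1 + S.θ) * ‖h'‖)
      (fun t _ => ((line_deriv ((H_p S (x+h')).differentiable (by norm_num)) 0 p t).sub
        (line_deriv ((H_p S x).differentiable (by norm_num)) 0 p t)).hasDerivWithinAt) b1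
      (convex_Icc 0 1) (by simp) (by simp)
    simpa using this
  have b3 : |S.H (x + h') p - S.H x p| ≤ C0 * ‖h'‖ + S.Cg * (1 + ‖p‖) ^ (1 + S.θ) * ‖h'‖ := by
    rw [abs_le] at b0 b2 ⊢
    constructor <;> linarith
  refine b3.trans ?_
  have : (C0 + S.Cg) * ‖h'‖ * (1 + ‖p‖) ^ (1 + S.θ) ≤
    (C0 + S.Cg) * (min 1 ‖h‖) * (1 + ‖p‖) ^ (1 + S.θ) := by gcongr
  refine le_trans ?_ this
  have : 0 ≤ C0 * ‖h'‖ * ((1 + ‖p‖) ^ (1 + S.θ) - 1) :=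
    mul_nonneg (by positivity) (by linarith)
  linarith
lemma rpow_young {θ ε : ℝ} (h0 : 0 < θ) (h1 : θ < 1) (hε : 0 < ε) :
    ∃ B, 0 ≤ B ∧ ∀ u : ℝ, 1 ≤ u → u ^ (1 + θ) ≤ ε * u ^ 2 + B := by
  have h := (tendsto_rpow_neg_atTop (show 0 < 1 - θ by linarith)).eventually (gt_mem_nhds hε)
  obtain ⟨U, hU⟩ := eventually_atTop.1 h
  refine ⟨|U| ^ (1 + θ), by positivity, fun u hu => ?_⟩
  rcases le_total U u with hUu | hUu
  · have e := (hU u hUu).le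
    have : u ^ (1 + θ) = u ^ (-(1 - θ)) * u ^ 2 := by
      rw [← Real.rpow_two, ← Real.rpow_add (by linarith)]; congr 1; ring
    rw [this]
    have : 0 ≤ |U| ^ (1 + θ) := by positivity
    nlinarith [mlR e (sq_nonneg u)]
  · have : u ^ (1 + θ) ≤ |U| ^ (1 + θ) :=
      Real.rpow_le_rpow (by linarith) (hUu.trans (le_abs_self U)) (by linarith)
    nlinarith [mul_nonneg hε.le (sq_nonneg u)]
lemma sq_aux (a : ℝ) : (1 + a) ^ 2 ≤ 2 + 2 * a ^ 2 := by nlinarith [sq_nonneg (a - 1)]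
lemma sq_aux' (a : ℝ) : a ≤ 1 + a ^ 2 := by nlinarith [sq_nonneg (a - 1)]
lemma H_shift : ∃ C1 C2 : ℝ, 0 < C1 ∧ 0 < C2 ∧ ∀ (x h v p : Vd d) (ξ : ℝ), ‖h‖ + ‖v‖ ≤ ξ →
    (1 + min (1/4) (C1 * ξ)) * S.H x ((1 + min (1/4) (C1 * ξ))⁻¹ • p) ≤
      S.H (x + h) p + dotp v p + C2 * (ξ + ξ ^ 2) := by
  obtain ⟨θ0, θ1⟩ := S.θ_mem
  obtain ⟨K, hK, hKl⟩ := H_x_lip S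
  obtain ⟨H0, hH0, hb, -⟩ := H_zero_bd S
  have hc : 0 < S.Cbar⁻¹ := inv_pos.2 S.Cbar_pos
  set c := S.Cbar⁻¹ with hcdef
  have hε : 0 < c / (64 * K) := by positivity
  obtain ⟨B, hB, hy⟩ := rpow_young θ0 θ1 hε
  set R := K * (2 * (c / (64 * K)) + B) + H0 / 4 with hR
  have hRn : 0 ≤ R := by positivity
  set C1 := 4 * (2 * K + d) / c with hC1
  have hC1p : 0 < C1 := by positivity
  refine ⟨C1, 4 * C1 * R + 8 * d ^ 2 / c + 2 * K + d + C1 * H0, hC1p, by positivity,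
    fun x h v p ξ hξ => ?_⟩
  set k := min (1/4) (C1 * ξ) with hk
  have hξ0 : 0 ≤ ξ := by linarith [norm_nonneg h, norm_nonneg v]
  have hk0 : 0 ≤ k := le_min (by norm_num) (by positivity)
  have hk4 : k ≤ 1 / 4 := min_le_left _ _
  refine (H_scale S x p hk0).trans ?_
  rw [← hcdef]
  set a := ‖p‖ with ha
  have ha0 : 0 ≤ a := norm_nonneg p
  have hn := norm_sq_le p
  rw [← ha] at hn
  have e1 := (abs_le.1 (hKl x h p)).1
  have e2 := (abs_le.1 (dotp_le v p)).1
  have e3 : c / 4 * k * a ^ 2 ≤ c / 2 * (k / (1 + k)) * sqnorm p := by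
    have : k / 2 ≤ k / (1 + k) := div_le_div_of_nonneg_left hk0 (by linarith) (by linarith)
    calc c / 4 * k * a ^ 2 = c / 2 * (k / 2) * a ^ 2 := by ring
      _ ≤ _ := by gcongr
  have e4 : k * S.H x 0 ≤ k * H0 := mlL ((abs_le.1 (hb x)).2) hk0
  have e5 : (d : ℝ) * ‖v‖ * a ≤ d * ξ * a := by gcongr; linarith [norm_nonneg h]
  have hP : 0 ≤ (1 + a) ^ (1 + S.θ) := by positivity
  suffices hs : K * min 1 ‖h‖ * (1 + a) ^ (1 + S.θ) + d * ξ * a + k * H0 ≤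
      c / 4 * k * a ^ 2 + (4 * C1 * R + 8 * d ^ 2 / c + 2 * K + d + C1 * H0) * (ξ + ξ ^ 2) by
    linarith
  clear_value k a C1 R c
  rcases le_total (C1 * ξ) (1/4) with hcase | hcase
  · have hkk : k = C1 * ξ := hk.trans (min_eq_right hcase)
    have f1 : (1 + a) ^ (1 + S.θ) ≤ 2 + 2 * a ^ 2 := by
      calc (1 + a) ^ (1 + S.θ) ≤ (1 + a) ^ (2:ℝ) :=
            Real.rpow_le_rpow_of_exponent_le (by linarith) (by linarith)
        _ = (1 + a) ^ 2 := Real.rpow_two _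
        _ ≤ _ := sq_aux a
    have f2 : K * min 1 ‖h‖ * (1 + a) ^ (1 + S.θ) ≤ K * ξ * (2 + 2 * a ^ 2) := by
      gcongr
      exact (min_le_right _ _).trans (by linarith [norm_nonneg v])
    have f3 : c / 4 * k * a ^ 2 = (2 * K + d) * ξ * a ^ 2 := by
      rw [hkk, hC1]; field_simp
    rw [f3, hkk]
    have f4 : (d : ℝ) * ξ * a ≤ d * ξ * (1 + a ^ 2) := by
      gcongr; exact sq_aux' a
    have f5 : 0 ≤ (4 * C1 * R + 8 * d ^ 2 / c) * (ξ + ξ ^ 2) := by positivity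
    have f6 : 0 ≤ (2 * K + d + C1 * H0) * ξ ^ 2 := by positivity
    linarith
  · have hkk : k = 1/4 := hk.trans (min_eq_left hcase)
    have f1 := hy (1 + a) (by linarith)
    have f2 : K * min 1 ‖h‖ * (1 + a) ^ (1 + S.θ) ≤
        K * 1 * (c / (64 * K) * (1 + a) ^ 2 + B) := by
      gcongr
      exact min_le_left _ _
    have f3 : K * 1 * (c / (64 * K) * (1 + a) ^ 2 + B) ≤
        K * (c / (64 * K) * (2 + 2 * a ^ 2) + B) := by
      rw [mul_one]; gcongr; exact sq_aux a
    have f4 : K * (c / (64 * K) * (2 + 2 * a ^ 2) + B) = c / 32 * a ^ 2 + (R - H0 / 4) := by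
      rw [hR]; field_simp; ring
    have f5 : (d : ℝ) * ξ * a ≤ c / 32 * a ^ 2 + 8 * d ^ 2 / c * ξ ^ 2 := by
      have : c / 32 * a ^ 2 + 8 * d ^ 2 / c * ξ ^ 2 - d * ξ * a = (c * a - 16 * d * ξ) ^ 2 / (32 * c) := by
        field_simp; ring
      have h2 : 0 ≤ (c * a - 16 * d * ξ) ^ 2 / (32 * c) := by positivity
      linarith
    rw [hkk]
    have f6 : R ≤ 4 * C1 * R * ξ := by linarith [mlL hcase hRn]
    have f7 : 0 ≤ (4 * C1 * R + 2 * K + d + C1 * H0) * ξ ^ 2 := by positivity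
    have f8 : 0 ≤ (8 * d ^ 2 / c + 2 * K + d + C1 * H0) * ξ := by positivity
    linarith
/-! Hstar -/
lemma Hstar_ge (x q p : Vd d) : dotp q p - S.H x p ≤ S.Hstar x q :=
  (S.Hstar_eq x q).1 ⟨p, rfl⟩
lemma Hstar_DpH (x p : Vd d) : S.Hstar x (DpH S x p) = dotp (DpH S x p) p - S.H x p := by
  refine le_antisymm ((S.Hstar_eq x _).2 ?_) (Hstar_ge S _ _ _)
  rintro _ ⟨q, rfl⟩
  have := H_lower S x p (q - p)
  rw [add_sub_cancel, dotp_sub_right] at this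
  have h2 : 0 ≤ S.Cbar⁻¹ * sqnorm (q - p) / 2 := by
    have := sqnorm_nonneg (q - p); have := S.Cbar_pos; positivity
  simp only
  linarith
lemma Hstar_le : ∃ C, 0 < C ∧ (∀ x q, S.Hstar x q ≤ C * (1 + sqnorm q)) ∧ (∀ x q, - C ≤ S.Hstar x q) := by
  obtain ⟨c, C, hc, hC, h1, h2, -⟩ := H_quad S
  refine ⟨C + 1 / (4 * c), by positivity, fun x q => (S.Hstar_eq x q).2 ?_, fun x q => ?_⟩
  · rintro _ ⟨p, rfl⟩
    have := dotp_young hc p q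
    rw [dotp_comm] at this
    have h3 := h1 x p
    have hq := sqnorm_nonneg q
    have : 0 ≤ C * sqnorm q + 1 / (4 * c) := by positivity
    have : sqnorm q / (4 * c) = 1 / (4 * c) * sqnorm q := by ring
    simp only
    nlinarith
  · have := Hstar_ge S x q 0
    have h3 := h2 x 0
    have e : sqnorm (0 : Vd d) = 0 := by simp [sqnorm]
    have e2 : dotp q (0 : Vd d) = 0 := by simp [dotp]
    rw [e] at h3
    have : 0 < 1 / (4 * c) := by positivity
    linarith
lemma Hstar_meas : Measurable fun r : Vd d × Vd d => S.Hstar r.1 r.2 := by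
  have hc : ∀ p : Vd d, Continuous fun r : Vd d × Vd d => dotp r.2 p - S.H r.1 p := fun p => by
    have := (H_x S p).continuous
    unfold dotp
    fun_prop
  have : LowerSemicontinuous fun r : Vd d × Vd d => S.Hstar r.1 r.2 := by
    intro r y hy
    obtain ⟨_, ⟨p, rfl⟩, hp, -⟩ := (S.Hstar_eq r.1 r.2).exists_between hy
    filter_upwards [(hc p).continuousAt.eventually (lt_mem_nhds hp)] with r' hr'
    exact hr'.trans_le (Hstar_ge S _ _ _)
  exact this.measurable
end
section
open scoped Topology NNReal ENNReal
variable {d : ℕ}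
lemma lineComb_prob {t : ℝ} (ht : t ∈ Icc (0:ℝ) 1) (μ ν : PTd d) :
    IsProbabilityMeasure (lineComb t μ ν) := by
  refine ⟨?_⟩
  simp only [lineComb, Measure.add_apply, Measure.smul_apply, measure_univ, smul_eq_mul, mul_one]
  rw [← ENNReal.ofReal_add (by linarith [ht.2]) ht.1]
  simp
def lc (t : Icc (0:ℝ) 1) (μ ν : PTd d) : PTd d := ⟨lineComb t μ ν, lineComb_prob t.2 μ ν⟩
lemma integral_lc (t : Icc (0:ℝ) 1) (μ ν : PTd d) {f : Td d → ℝ} (hf : Continuous f) :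
    ∫ y, f y ∂(lc t μ ν : Measure (Td d)) =
      (1 - t) * ∫ y, f y ∂(μ : Measure (Td d)) + t * ∫ y, f y ∂(ν : Measure (Td d)) := by
  change ∫ y, f y ∂(lineComb t μ ν) = _
  unfold lineComb
  rw [integral_add_measure, integral_smul_measure, integral_smul_measure]
  · rw [ENNReal.toReal_ofReal (by linarith [t.2.2]), ENNReal.toReal_ofReal t.2.1]; simp
  · exact (integrable_cont μ hf).smul_measure ENNReal.ofReal_ne_top
  · exact (integrable_cont ν hf).smul_measure ENNReal.ofReal_ne_top
lemma grad_bd {f : Vd d → ℝ} (hf : ContDiff ℝ 2 f) {M C : ℝ} (hM : ∀ x, |f x| ≤ M)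
    (hC : ∀ x v : Vd d, |D2 f x v v| ≤ C * ‖v‖ * ‖v‖) (x v : Vd d) :
    |fderiv ℝ f x v| ≤ (2 * M + C / 2) * ‖v‖ := by
  have key : ∀ v : Vd d, ‖v‖ = 1 → fderiv ℝ f x v ≤ 2 * M + C / 2 := fun v hv => by
    have := taylor1 (g := fun t => f (x + t • v)) (k := - C)
      (fun t => line_deriv (hf.differentiable (by norm_num)) x v t)
      (fun t => line_deriv ((diff_fderiv hf v).differentiable (by norm_num)) x v t)
      (fun t => by have := (abs_le.1 (hC (x + t • v) v)).1; rw [hv] at this; simpa [D2] using this)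
    simp only [zero_smul, add_zero, one_smul] at this
    have h1 := abs_le.1 (hM x)
    have h2 := abs_le.1 (hM (x + v))
    linarith
  by_cases h0 : v = 0
  · simp [h0]
  have hn : 0 < ‖v‖ := norm_pos_iff.2 h0
  have hu : ‖(‖v‖⁻¹ • v)‖ = 1 := by rw [norm_smul, norm_inv, norm_norm, inv_mul_cancel₀ hn.ne']
  have k1 := key _ hu
  have k2 := key (-(‖v‖⁻¹ • v)) (by rw [norm_neg, hu])
  rw [map_neg] at k2
  rw [map_smul, smul_eq_mul] at k1 k2
  rw [abs_le]
  have e : fderiv ℝ f x v = ‖v‖ * (‖v‖⁻¹ * fderiv ℝ f x v) := by field_simp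
  rw [e]
  constructor <;> nlinarith
lemma lip_of_fderiv {f : Vd d → ℝ} (hf : Differentiable ℝ f) {L : ℝ} (hL : 0 ≤ L)
    (h : ∀ x v, |fderiv ℝ f x v| ≤ L * ‖v‖) (x y : Vd d) : |f x - f y| ≤ L * ‖x - y‖ := by
  have := Convex.norm_image_sub_le_of_norm_fderiv_le (𝕜 := ℝ) (f := f) (C := L) (s := univ)
    (x := y) (y := x) (fun y _ => hf y)
    (fun y _ => ContinuousLinearMap.opNorm_le_bound _ hL (h y)) convex_univ trivial trivial
  simpa using this
lemma lip_sec' {f : Vd d → ℝ} (hp : Per f) {L : ℝ} (hL : 0 ≤ L)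
    (h : ∀ x y, |f x - f y| ≤ L * ‖x - y‖) (y y' : Td d) :
    |f (secT y) - f (secT y')| ≤ L * dist y y' := by
  have := (lip_sec (L := ⟨L, hL⟩) hp (LipschitzWith.of_dist_le_mul fun x y => by
    rw [Real.dist_eq, dist_eq_norm]; exact h x y)).dist_le_mul y y'
  rwa [Real.dist_eq] at this
lemma Fc_lip (S : MFGSetting d) : ∃ L, 0 ≤ L ∧ ∀ μ ν, |S.Fc ν - S.Fc μ| ≤ L * W1 μ ν := by
  obtain ⟨M, hM⟩ := S.Fd_bounded
  set L := 2 * |M| + |S.CF| / 2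
  have hL : 0 ≤ L := by positivity
  refine ⟨L, hL, fun μ ν => ?_⟩
  rw [S.flat_deriv μ ν, ← Real.norm_eq_abs]
  refine (norm_setIntegral_le_of_norm_le_const (C := L * W1 μ ν) (by simp) fun t ht => ?_).trans
    (by simp)
  have hp := lineComb_prob ht μ ν
  have hs := S.Fd_smooth _ hp
  have hper : Per (S.Fd (lineComb t μ ν)) := S.Fd_per _
  rw [W1_comm]
  exact lip_W1 ν μ hL (lip_sec' hper hL (lip_of_fderiv (hs.differentiable (by norm_num)) hL
    (grad_bd hs (fun x => (hM (lc ⟨t, ht⟩ μ ν) x).trans (le_abs_self M))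
      fun x v => (S.Fd_D2_bound _ hp x v v).trans (by gcongr; exact le_abs_self _))))
lemma Fc_cont (S : MFGSetting d) : Continuous S.Fc := by
  obtain ⟨L, hL, h⟩ := Fc_lip S
  refine cont_of_W1Continuous fun μ ε hε => ⟨ε / (L + 1), by positivity, fun ν hν => ?_⟩
  refine (h μ ν).trans_lt ?_
  rw [lt_div_iff₀ (by positivity)] at hν
  nlinarith [W1_nonneg μ ν]
end
section
open scoped Topology NNReal ENNReal
variable {d : ℕ}
def iT (μ : PTd d) (f : Vd d → ℝ) : ℝ := ∫ y, f (secT y) ∂(μ : Measure (Td d))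
def CP (f : Vd d → ℝ) : Prop := Continuous f ∧ Per f
lemma CP.int {f : Vd d → ℝ} (h : CP f) (μ : PTd d) :
    Integrable (fun y => f (secT y)) (μ : Measure (Td d)) := integrable_cont μ (cont_sec' h.1 h.2)
lemma iT_add {f g : Vd d → ℝ} (hf : CP f) (hg : CP g) (μ : PTd d) :
    iT μ (fun x => f x + g x) = iT μ f + iT μ g := integral_add (hf.int μ) (hg.int μ)
lemma iT_sub {f g : Vd d → ℝ} (hf : CP f) (hg : CP g) (μ : PTd d) :
    iT μ (fun x => f x - g x) = iT μ f - iT μ g := integral_sub (hf.int μ) (hg.int μ)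
lemma iT_mul (c : ℝ) (f : Vd d → ℝ) (μ : PTd d) : iT μ (fun x => c * f x) = c * iT μ f :=
  integral_const_mul _ _
lemma iT_mono {f g : Vd d → ℝ} (hf : CP f) (hg : CP g) (μ : PTd d) (h : ∀ x, f x ≤ g x) :
    iT μ f ≤ iT μ g := integral_mono (hf.int μ) (hg.int μ) fun _ => h _
lemma iT_const (c : ℝ) (μ : PTd d) : iT μ (fun _ => c) = c := by simp [iT]
lemma CP_const (c : ℝ) : CP (fun _ : Vd d => c) := ⟨continuous_const, fun _ _ => rfl⟩
lemma iT_le {f : Vd d → ℝ} (hf : CP f) (μ : PTd d) {c : ℝ} (h : ∀ x, f x ≤ c) : iT μ f ≤ c := by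
  simpa [iT_const] using iT_mono hf (CP_const c) μ h
lemma iT_abs {f : Vd d → ℝ} (hf : CP f) (μ : PTd d) {c : ℝ} (h : ∀ x, |f x| ≤ c) :
    |iT μ f| ≤ c := by
  refine abs_le.2 ⟨?_, iT_le hf μ fun x => (abs_le.1 (h x)).2⟩
  simpa [iT_const] using iT_mono (CP_const (-c)) hf μ fun x => (abs_le.1 (h x)).1
lemma CP_of {P : Type*} [TopologicalSpace P] {f : P → Vd d → ℝ}
    (hf : Continuous fun q : P × Vd d => f q.1 q.2) (hp : ∀ p, Per (f p)) (p : P) : CP (f p) :=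
  ⟨hf.comp (continuous_const.prodMk continuous_id), hp p⟩
lemma iT_cont {P : Type*} [TopologicalSpace P] {m : P → PTd d} (hm : Continuous m) {f : P → Vd d → ℝ}
    (hf : Continuous fun q : P × Vd d => f q.1 q.2) (hp : ∀ p, Per (f p)) :
    Continuous fun p => iT (m p) (f p) := cont_integral hm (cont_sec hf hp)
/-! regularity of test functions -/
section test
variable {φ : ℝ → Vd d → ℝ} (h : IsTestFun φ)
include h
lemma test_diff (q : ℝ × Vd d) : HasFDerivAt (fun q : ℝ × Vd d => φ q.1 q.2)
    (fderiv ℝ (fun q : ℝ × Vd d => φ q.1 q.2) q) q :=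
  (h.1.differentiable (by norm_num) _).hasFDerivAt
lemma test_t (s : ℝ) (x : Vd d) : HasDerivAt (fun s => φ s x)
    (fderiv ℝ (fun q : ℝ × Vd d => φ q.1 q.2) (s, x) (1, 0)) s := by
  have h2 : HasDerivAt (fun s : ℝ => (s, x)) ((1 : ℝ), (0 : Vd d)) s :=
    (hasDerivAt_id s).prodMk (hasDerivAt_const s x)
  exact (test_diff h (s, x)).comp_hasDerivAt s h2
lemma test_x (s : ℝ) (x v : Vd d) : fderiv ℝ (φ s) x v =
    fderiv ℝ (fun q : ℝ × Vd d => φ q.1 q.2) (s, x) (0, v) := by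
  have := ((test_diff h (s, x)).comp x (hasFDerivAt_prodMk_right s x)).fderiv
  change fderiv ℝ (φ s) x = _ at this
  rw [this]; simp
lemma test_C1 (v : ℝ × Vd d) : ContDiff ℝ 1 fun q : ℝ × Vd d =>
    fderiv ℝ (fun q : ℝ × Vd d => φ q.1 q.2) q v :=
  (h.1.fderiv_right (m := 1) (by norm_num)).clm_apply contDiff_const
lemma test_s (s : ℝ) : ContDiff ℝ 2 (φ s) := h.1.comp (contDiff_const.prodMk contDiff_id)
lemma test_cont : Continuous fun q : ℝ × Vd d => φ q.1 q.2 := h.1.continuous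
lemma test_per (s : ℝ) : Per (φ s) := h.2 s
lemma test_CP (s : ℝ) : CP (φ s) := ⟨(test_s h s).continuous, h.2 s⟩
lemma tderiv_cont : Continuous fun q : ℝ × Vd d => tderiv φ q.1 q.2 := by
  have : (fun q : ℝ × Vd d => tderiv φ q.1 q.2) = fun q =>
    fderiv ℝ (fun q : ℝ × Vd d => φ q.1 q.2) q (1, 0) := by
    funext q; exact (test_t h q.1 q.2).deriv
  rw [this]; exact (test_C1 h _).continuous
lemma grad_cont : Continuous fun q : ℝ × Vd d => gradv (φ q.1) q.2 := by
  refine continuous_pi fun i => ?_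
  simp only [gradv, test_x h]
  exact (test_C1 h _).continuous
lemma lapl_cont : Continuous fun q : ℝ × Vd d => lapl (φ q.1) q.2 := by
  unfold lapl
  refine continuous_finsetSum _ fun i _ => ?_
  simp only [D2, test_x h]
  have e : ∀ q : ℝ × Vd d, fderiv ℝ (fun y => fderiv ℝ (fun q : ℝ × Vd d => φ q.1 q.2) (q.1, y)
      (0, Pi.single i 1)) q.2 (Pi.single i 1) = fderiv ℝ (fun q : ℝ × Vd d =>
      fderiv ℝ (fun q : ℝ × Vd d => φ q.1 q.2) q (0, Pi.single i 1)) q (0, Pi.single i 1) := by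
    intro q
    have h1 := ((test_C1 h (0, Pi.single i 1)).differentiable (by norm_num) q).hasFDerivAt
    have := (HasFDerivAt.comp q.2 (f := fun y => (q.1, y)) h1 (hasFDerivAt_prodMk_right q.1 q.2)).fderiv
    simp only [Function.comp_def] at this
    rw [this]; simp
  simp only [e]
  exact ((test_C1 h _).continuous_fderiv (by norm_num)).clm_apply continuous_const
lemma fderiv_per (s : ℝ) (x : Vd d) (z : Fin d → ℤ) : fderiv ℝ (φ s) (x + intVec z) = fderiv ℝ (φ s) x := by
  rw [← fderiv_comp_add_right, show (fun y => φ s (y + intVec z)) = φ s from funext fun y => h.2 s y z]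
lemma grad_per (s : ℝ) (x : Vd d) (z : Fin d → ℤ) : gradv (φ s) (x + intVec z) = gradv (φ s) x := by
  unfold gradv; rw [fderiv_per h]
lemma lapl_per (s : ℝ) : Per (lapl (φ s)) := fun x z => by
  unfold lapl D2
  refine Finset.sum_congr rfl fun i _ => ?_
  rw [← fderiv_comp_add_right]
  simp only [fderiv_per h]
lemma tderiv_per (s : ℝ) : Per (tderiv φ s) := fun x z => by
  unfold tderiv; simp only [h.2]
end test
def opL (φ : ℝ → Vd d → ℝ) (s : ℝ) (x : Vd d) : ℝ := tderiv φ s x + lapl (φ s) x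
def hamF (S : MFGSetting d) (φ : ℝ → Vd d → ℝ) (s : ℝ) (x : Vd d) : ℝ := S.H x (gradv (φ s) x)
lemma opL_cont {φ : ℝ → Vd d → ℝ} (h : IsTestFun φ) : Continuous fun q : ℝ × Vd d => opL φ q.1 q.2 :=
  (tderiv_cont h).add (lapl_cont h)
lemma opL_per {φ : ℝ → Vd d → ℝ} (h : IsTestFun φ) (s : ℝ) : Per (opL φ s) := fun x z => by
  unfold opL; rw [tderiv_per h, lapl_per h]
lemma hm_cont (S : MFGSetting d) {φ : ℝ → Vd d → ℝ} (h : IsTestFun φ) :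
    Continuous fun q : ℝ × Vd d => hamF S φ q.1 q.2 :=
  (H_cont S).comp (continuous_snd.prodMk (grad_cont h))
lemma hm_per (S : MFGSetting d) {φ : ℝ → Vd d → ℝ} (h : IsTestFun φ) (s : ℝ) : Per (hamF S φ s) :=
  fun x z => by unfold hamF; rw [grad_per h, S.H_per]
/-- the linear part -/
def Jf (a b : ℝ) (m : ℝ → PTd d) (φ : ℝ → Vd d → ℝ) : ℝ :=
  iT (m a) (φ a) - iT (m b) (φ b) + ∫ s in a..b, iT (m s) (opL φ s)
def Hf (S : MFGSetting d) (a b : ℝ) (m : ℝ → PTd d) (φ : ℝ → Vd d → ℝ) : ℝ :=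
  ∫ s in a..b, iT (m s) (hamF S φ s)
def RelC (S : MFGSetting d) (a b : ℝ) (m : ℝ → PTd d) (A : ℝ) : Prop :=
  Continuous m ∧ ∀ φ, IsTestFun φ → Jf a b m φ - Hf S a b m φ ≤ A
variable {S : MFGSetting d} {a b c A A' : ℝ} {m m' : ℝ → PTd d}
lemma RelC.mono (h : RelC S a b m A) (hA : A ≤ A') : RelC S a b m A' :=
  ⟨h.1, fun φ hφ => (h.2 φ hφ).trans hA⟩
lemma Jf_congr (hab : a ≤ b) (he : ∀ s ∈ Icc a b, m s = m' s) (φ : ℝ → Vd d → ℝ) :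
    Jf a b m φ = Jf a b m' φ := by
  unfold Jf
  rw [he a (left_mem_Icc.2 hab), he b (right_mem_Icc.2 hab),
    intervalIntegral.integral_congr fun s hs => ?_]
  rw [uIcc_of_le hab] at hs
  simp only [he s hs]
lemma Hf_congr (hab : a ≤ b) (he : ∀ s ∈ Icc a b, m s = m' s) (φ : ℝ → Vd d → ℝ) :
    Hf S a b m φ = Hf S a b m' φ := by
  refine intervalIntegral.integral_congr fun s hs => ?_
  rw [uIcc_of_le hab] at hs
  simp only [he s hs]
lemma RelC.congr (hab : a ≤ b) (h : RelC S a b m A) (hm' : Continuous m')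
    (he : ∀ s ∈ Icc a b, m s = m' s) : RelC S a b m' A :=
  ⟨hm', fun φ hφ => by rw [← Jf_congr hab he, ← Hf_congr hab he]; exact h.2 φ hφ⟩
lemma opL_int (hm : Continuous m) {φ : ℝ → Vd d → ℝ} (h : IsTestFun φ) (a b : ℝ) :
    IntervalIntegrable (fun s => iT (m s) (opL φ s)) volume a b :=
  (iT_cont hm (opL_cont h) (opL_per h)).intervalIntegrable a b
lemma hm_int (S : MFGSetting d) (hm : Continuous m) {φ : ℝ → Vd d → ℝ} (h : IsTestFun φ) (a b : ℝ) :
    IntervalIntegrable (fun s => iT (m s) (hamF S φ s)) volume a b :=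
  (iT_cont hm (hm_cont S h) (hm_per S h)).intervalIntegrable a b
lemma RelC.concat (h1 : RelC S a b m A) (h2 : RelC S b c m A') : RelC S a c m (A + A') := by
  refine ⟨h1.1, fun φ hφ => ?_⟩
  have e1 := h1.2 φ hφ
  have e2 := h2.2 φ hφ
  have e3 := intervalIntegral.integral_add_adjacent_intervals
    (opL_int h1.1 hφ a b) (opL_int h1.1 hφ b c)
  have e4 := intervalIntegral.integral_add_adjacent_intervals
    (hm_int S h1.1 hφ a b) (hm_int S h1.1 hφ b c)
  unfold Jf Hf at *
  linarith
def glue (b : ℝ) (m m' : ℝ → PTd d) (s : ℝ) : PTd d := if s ≤ b then m s else m' s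
lemma RelC.glue (hab : a ≤ b) (hbc : b ≤ c) (h1 : RelC S a b m A) (h2 : RelC S b c m' A') (he : m b = m' b) :
    RelC S a c (glue b m m') (A + A') := by
  have hc : Continuous (_root_.glue b m m') :=
    Continuous.if_le h1.1 h2.1 continuous_id continuous_const (by rintro x rfl; exact he)
  refine RelC.concat (b := b) (h1.congr hab hc fun s hs => ?_) (h2.congr hbc hc fun s hs => ?_)
  · simp [_root_.glue, hs.2]
  · simp only [_root_.glue]
    split_ifs with h
    · have : s = b := le_antisymm h hs.1
      rw [this, he]
    · rfl
lemma test_shift {φ : ℝ → Vd d → ℝ} (h : IsTestFun φ) (c : ℝ) : IsTestFun fun s => φ (s + c) :=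
  ⟨h.1.comp (by fun_prop : ContDiff ℝ 2 fun q : ℝ × Vd d => (q.1 + c, q.2)), fun t x z => h.2 _ x z⟩
lemma tderiv_shift (φ : ℝ → Vd d → ℝ) (c s : ℝ) (x : Vd d) :
    tderiv (fun s => φ (s + c)) s x = tderiv φ (s + c) x := by
  unfold tderiv
  exact deriv_comp_add_const (f := fun s => φ s x) c s
lemma RelC.shift (h : RelC S a b m A) (c : ℝ) : RelC S (a + c) (b + c) (fun s => m (s - c)) A := by
  refine ⟨h.1.comp (continuous_id.sub continuous_const), fun φ hφ => ?_⟩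
  have := h.2 _ (test_shift hφ c)
  refine le_trans (le_of_eq ?_) this
  unfold Jf Hf
  rw [← intervalIntegral.integral_comp_add_right, ← intervalIntegral.integral_comp_add_right]
  simp only [add_sub_cancel_right]
  congr 2
  have : ∀ s, opL (fun s => φ (s + c)) s = opL φ (s + c) := fun s => by
    funext x; unfold opL; rw [tderiv_shift]
  simp only [this]
lemma lc_cont (t : Icc (0:ℝ) 1) (hm : Continuous m) (hm' : Continuous m') :
    Continuous fun s => lc t (m s) (m' s) := by
  refine cont_C2 fun f hf hp => ?_
  have hc := cont_sec' hf.continuous hp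
  simp only [integral_lc _ _ _ hc]
  have h1 : Continuous fun s => ∫ y, f (secT y) ∂(m s : Measure (Td d)) :=
    cont_integral hm (f := fun _ y => f (secT y)) (hc.comp continuous_snd)
  have h2 : Continuous fun s => ∫ y, f (secT y) ∂(m' s : Measure (Td d)) :=
    cont_integral hm' (f := fun _ y => f (secT y)) (hc.comp continuous_snd)
  fun_prop
lemma RelC.mix (t : Icc (0:ℝ) 1) (h : RelC S a b m A) (h' : RelC S a b m' A') :
    RelC S a b (fun s => lc t (m s) (m' s)) ((1 - t) * A + t * A') := by
  refine ⟨lc_cont t h.1 h'.1, fun φ hφ => ?_⟩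
  have e1 := mlL (h.2 φ hφ) (show (0:ℝ) ≤ 1 - t by linarith [t.2.2])
  have e2 := mlL (h'.2 φ hφ) t.2.1
  have k : ∀ f, CP f → ∀ s, iT (lc t (m s) (m' s)) f = (1 - t) * iT (m s) f + t * iT (m' s) f :=
    fun f hf s => integral_lc _ _ _ (cont_sec' hf.1 hf.2)
  have i1 : ∫ s in a..b, iT (lc t (m s) (m' s)) (opL φ s) =
      (1 - t) * (∫ s in a..b, iT (m s) (opL φ s)) + t * ∫ s in a..b, iT (m' s) (opL φ s) := by
    rw [← intervalIntegral.integral_const_mul, ← intervalIntegral.integral_const_mul,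
      ← intervalIntegral.integral_add ((opL_int h.1 hφ a b).const_mul _)
      ((opL_int h'.1 hφ a b).const_mul _)]
    exact intervalIntegral.integral_congr fun s _ => k _ (CP_of (opL_cont hφ) (opL_per hφ) s) s
  have i2 : ∫ s in a..b, iT (lc t (m s) (m' s)) (hamF S φ s) =
      (1 - t) * (∫ s in a..b, iT (m s) (hamF S φ s)) + t * ∫ s in a..b, iT (m' s) (hamF S φ s) := by
    rw [← intervalIntegral.integral_const_mul, ← intervalIntegral.integral_const_mul,
      ← intervalIntegral.integral_add ((hm_int S h.1 hφ a b).const_mul _)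
      ((hm_int S h'.1 hφ a b).const_mul _)]
    exact intervalIntegral.integral_congr fun s _ => k _ (CP_of (hm_cont S hφ) (hm_per S hφ) s) s
  unfold Jf Hf at *
  rw [i1, i2, k _ (test_CP hφ a), k _ (test_CP hφ b)]
  linarith
end
section
open scoped Topology NNReal ENNReal
variable {d : ℕ}
lemma trn_meas (r : ℝ) : Continuous (fun q : Td d × Vd d => q.1 + pT (r • q.2)) := by
  have : Continuous fun q : Td d × Vd d => pT (r • q.2) := pT_cont.comp (by fun_prop)
  exact continuous_fst.add this
def trn (ρ : ProbabilityMeasure (Vd d)) (μ : PTd d) (r : ℝ) : PTd d :=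
  ⟨Measure.map (fun q : Td d × Vd d => q.1 + pT (r • q.2)) ((μ : Measure (Td d)).prod (ρ : Measure (Vd d))),
    Measure.isProbabilityMeasure_map (trn_meas r).aemeasurable⟩
lemma sec_jc {f : Vd d → ℝ} (hf : CP f) (r : ℝ) :
    Continuous fun q : Td d × Vd d => f (secT q.1 + r • q.2) := by
  have : (fun q : Td d × Vd d => f (secT q.1 + r • q.2)) =
      fun q : Td d × Vd d => f (secT (q.1 + pT (r • q.2))) := by
    funext q; rw [per_sec_add hf.2]
  rw [this]
  exact (cont_sec' hf.1 hf.2).comp (trn_meas r)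
lemma trn_prod (ρ : ProbabilityMeasure (Vd d)) (μ : PTd d) (r : ℝ) {f : Vd d → ℝ} (hf : CP f) :
    iT (trn ρ μ r) f = ∫ q : Td d × Vd d, f (secT q.1 + r • q.2)
      ∂((μ : Measure (Td d)).prod (ρ : Measure (Vd d))) := by
  unfold iT trn
  simp only [ProbabilityMeasure.coe_mk]
  rw [integral_map (trn_meas r).aemeasurable (cont_sec' hf.1 hf.2).aestronglyMeasurable]
  simp only [per_sec_add hf.2]
lemma bdd_int {X : Type*} [TopologicalSpace X] [SecondCountableTopology X] [MeasurableSpace X]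
    [BorelSpace X] (μ : Measure X) [IsFiniteMeasure μ] {f : X → ℝ} (hf : Continuous f) {C : ℝ}
    (h : ∀ x, |f x| ≤ C) : Integrable f μ :=
  Integrable.of_bound hf.aestronglyMeasurable C (Eventually.of_forall h)
lemma iT_trn (ρ : ProbabilityMeasure (Vd d)) (μ : PTd d) (r : ℝ) {f : Vd d → ℝ} (hf : CP f) :
    iT (trn ρ μ r) f = ∫ z, iT μ (fun x => f (x + r • z)) ∂(ρ : Measure (Vd d)) := by
  obtain ⟨C, -, hC⟩ := per_bdd hf.1 hf.2
  rw [trn_prod ρ μ r hf]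
  exact integral_prod_symm _ (bdd_int _ (sec_jc hf r) fun q => hC _)
lemma CP.tr {f : Vd d → ℝ} (hf : CP f) (v : Vd d) : CP fun x => f (x + v) :=
  ⟨hf.1.comp (continuous_id.add continuous_const), fun x z => by
    change f (x + intVec z + v) = f (x + v)
    rw [add_right_comm]; exact hf.2 _ _⟩
/-- joint continuity of translated averages -/
lemma tr_jc {m : ℝ → PTd d} (hm : Continuous m) {f : ℝ → Vd d → ℝ}
    (hf : Continuous fun q : ℝ × Vd d => f q.1 q.2) (hp : ∀ p, Per (f p)) {r : ℝ → ℝ} (hr : Continuous r) :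
    Continuous fun q : ℝ × Vd d => iT (m q.1) (fun x => f q.1 (x + r q.1 • q.2)) := by
  refine iT_cont (f := fun q : ℝ × Vd d => fun x => f q.1 (x + r q.1 • q.2)) (hm.comp continuous_fst)
    ?_ fun q => ((CP_of hf hp q.1).tr _).2
  exact hf.comp (by fun_prop : Continuous fun q : (ℝ × Vd d) × Vd d => (q.1.1, q.2 + r q.1.1 • q.1.2))
lemma trn_cont (ρ : ProbabilityMeasure (Vd d)) {m : ℝ → PTd d} (hm : Continuous m) {r : ℝ → ℝ}
    (hr : Continuous r) : Continuous fun s => trn ρ (m s) (r s) := by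
  refine cont_C2 fun f hf hp => ?_
  have hc : CP f := ⟨hf.continuous, hp⟩
  obtain ⟨C, -, hC⟩ := per_bdd hc.1 hc.2
  change Continuous fun s => iT (trn ρ (m s) (r s)) f
  simp only [iT_trn ρ _ _ hc]
  have hj := tr_jc hm (f := fun _ => f) (hc.1.comp continuous_snd) (fun _ => hp) hr
  refine continuous_of_dominated (bound := fun _ => C) (fun s => ?_) (fun s => ?_) ?_ ?_
  · exact (hj.comp (continuous_const.prodMk continuous_id)).aestronglyMeasurable
  · exact Eventually.of_forall fun z => iT_abs (hc.tr _) _ fun x => hC _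
  · exact integrable_const _
  · exact Eventually.of_forall fun z => hj.comp (continuous_id.prodMk continuous_const)
lemma trn_swap (ρ : ProbabilityMeasure (Vd d)) {m : ℝ → PTd d} (hm : Continuous m) {f : ℝ → Vd d → ℝ}
    (hf : Continuous fun q : ℝ × Vd d => f q.1 q.2) (hp : ∀ p, Per (f p)) {r : ℝ → ℝ} (hr : Continuous r)
    (a b : ℝ) :
    Integrable (fun z => ∫ s in a..b, iT (m s) (fun x => f s (x + r s • z))) (ρ : Measure (Vd d)) ∧
    ∫ s in a..b, iT (trn ρ (m s) (r s)) (f s) =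
      ∫ z, (∫ s in a..b, iT (m s) (fun x => f s (x + r s • z))) ∂(ρ : Measure (Vd d)) := by
  obtain ⟨C, -, hC⟩ := per_bdd_on hf hp (isCompact_uIcc (a := a) (b := b))
  have hj := tr_jc hm hf hp hr
  haveI : IsFiniteMeasure (volume.restrict (uIoc a b)) := ⟨by simp [uIoc]⟩
  have hi : Integrable (Function.uncurry fun (s : ℝ) (z : Vd d) => iT (m s) (fun x => f s (x + r s • z)))
      ((volume.restrict (uIoc a b)).prod (ρ : Measure (Vd d))) := by
    refine Integrable.of_bound hj.aestronglyMeasurable C ?_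
    have : ∀ᵐ q : ℝ × Vd d ∂((volume.restrict (uIoc a b)).prod (ρ : Measure (Vd d))), q.1 ∈ uIoc a b :=
      Measure.quasiMeasurePreserving_fst.ae (ae_restrict_mem measurableSet_uIoc)
    filter_upwards [this] with q hq
    exact iT_abs ((CP_of hf hp _).tr _) _ fun x => hC _ (uIoc_subset_uIcc hq) _
  constructor
  · have := hi.integral_prod_right
    simp only [Function.uncurry, intervalIntegral.intervalIntegral_eq_integral_uIoc] at this ⊢
    exact this.smul (if a ≤ b then (1:ℝ) else -1)
  · rw [← intervalIntegral_integral_swap hi]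
    exact intervalIntegral.integral_congr fun s _ => iT_trn ρ _ _ (CP_of hf hp s)
/-! translated test functions -/
section
variable {φ : ℝ → Vd d → ℝ} (h : IsTestFun φ) (a0 b0 : ℝ) (z : Vd d)
def phz (φ : ℝ → Vd d → ℝ) (a0 b0 : ℝ) (z : Vd d) (s : ℝ) (x : Vd d) : ℝ := φ s (x + (a0 + b0 * s) • z)
include h
lemma phz_test : IsTestFun (phz φ a0 b0 z) :=
  ⟨h.1.comp (by fun_prop : ContDiff ℝ 2 fun q : ℝ × Vd d => (q.1, q.2 + (a0 + b0 * q.1) • z)),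
    fun t x w => ((test_CP h t).tr _).2 x w⟩
omit h in
lemma phz_fd (s : ℝ) (x : Vd d) : fderiv ℝ (phz φ a0 b0 z s) x = fderiv ℝ (φ s) (x + (a0 + b0 * s) • z) :=
  fderiv_comp_add_right _
omit h in
lemma phz_grad (s : ℝ) (x : Vd d) : gradv (phz φ a0 b0 z s) x = gradv (φ s) (x + (a0 + b0 * s) • z) := by
  unfold gradv; rw [phz_fd]
omit h in
lemma phz_lapl (s : ℝ) (x : Vd d) : lapl (phz φ a0 b0 z s) x = lapl (φ s) (x + (a0 + b0 * s) • z) := by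
  unfold lapl D2
  refine Finset.sum_congr rfl fun i _ => ?_
  simp only [phz_fd]
  rw [← fderiv_comp_add_right]
lemma test_t' (s : ℝ) (x : Vd d) : tderiv φ s x = fderiv ℝ (fun q : ℝ × Vd d => φ q.1 q.2) (s, x) (1, 0) :=
  (test_t h s x).deriv
lemma test_dot (s : ℝ) (x v : Vd d) : dotp v (gradv (φ s) x) =
    fderiv ℝ (fun q : ℝ × Vd d => φ q.1 q.2) (s, x) (0, v) := by
  rw [← test_x h, fderiv_eq_dotp, dotp_comm]
lemma curve_deriv {r : ℝ → ℝ} {r' s : ℝ} (hr : HasDerivAt r r' s) (x z : Vd d) :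
    HasDerivAt (fun s => φ s (x + r s • z))
      (tderiv φ s (x + r s • z) + r' * dotp z (gradv (φ s) (x + r s • z))) s := by
  have h2 : HasDerivAt (fun s : ℝ => (s, x + r s • z)) ((1 : ℝ), r' • z) s :=
    (hasDerivAt_id s).prodMk ((hr.smul_const z).const_add x)
  refine ((test_diff h (s, x + r s • z)).comp_hasDerivAt s h2).congr_deriv ?_
  rw [test_t' h, test_dot h, ← smul_eq_mul, ← map_smul, ← map_add]
  simp
lemma phz_t (s : ℝ) (x : Vd d) : tderiv (phz φ a0 b0 z) s x = tderiv φ s (x + (a0 + b0 * s) • z) +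
    b0 * dotp z (gradv (phz φ a0 b0 z s) x) := by
  have hr : HasDerivAt (fun s => a0 + b0 * s) b0 s := by
    simpa using ((hasDerivAt_id s).const_mul b0).const_add a0
  rw [phz_grad]
  exact (curve_deriv h hr x z).deriv
end
lemma test_smul {φ : ℝ → Vd d → ℝ} (h : IsTestFun φ) (c : ℝ) : IsTestFun fun s x => c * φ s x :=
  ⟨contDiff_const.mul h.1, fun t x z => by simp only [h.2]⟩
lemma smul_fd {φ : ℝ → Vd d → ℝ} (h : IsTestFun φ) (c : ℝ) (s : ℝ) (x : Vd d) :
    fderiv ℝ (fun x => c * φ s x) x = c • fderiv ℝ (φ s) x :=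
  fderiv_const_mul ((test_s h s).differentiable (by norm_num) x) c
lemma smul_grad {φ : ℝ → Vd d → ℝ} (h : IsTestFun φ) (c : ℝ) (s : ℝ) (x : Vd d) :
    gradv (fun x => c * φ s x) x = c • gradv (φ s) x := by
  unfold gradv; rw [smul_fd h]; rfl
lemma smul_opL {φ : ℝ → Vd d → ℝ} (h : IsTestFun φ) (c : ℝ) (s : ℝ) :
    opL (fun s x => c * φ s x) s = fun x => c * opL φ s x := by
  funext x
  have h1 : tderiv (fun s x => c * φ s x) s x = c * tderiv φ s x := deriv_const_mul _ (test_t h s x).differentiableAt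
  have h2 : lapl (fun x => c * φ s x) x = c * lapl (φ s) x := by
    unfold lapl D2
    rw [Finset.mul_sum]
    refine Finset.sum_congr rfl fun i _ => ?_
    simp only [smul_fd h, _root_.smul_apply, smul_eq_mul]
    rw [fderiv_const_mul]; · rfl
    have := (((test_s h s).fderiv_right (m := 1) (by norm_num)).clm_apply
      (contDiff_const (c := (Pi.single i 1 : Vd d))))
    exact this.differentiable (by norm_num) x
  simp only [opL, h1, h2]; ring
lemma Jf_smul {φ : ℝ → Vd d → ℝ} (h : IsTestFun φ) (c a b : ℝ) (m : ℝ → PTd d) :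
    Jf a b m (fun s x => c * φ s x) = c * Jf a b m φ := by
  unfold Jf
  simp only [smul_opL h, iT_mul, intervalIntegral.integral_const_mul]
  ring
end
section
open scoped Topology NNReal ENNReal
variable {d : ℕ}
def momI (ρ : ProbabilityMeasure (Vd d)) : Prop := Integrable (fun z => ‖z‖ + ‖z‖ ^ 2) (ρ : Measure (Vd d))
def mom (ρ : ProbabilityMeasure (Vd d)) : ℝ := ∫ z, ‖z‖ + ‖z‖ ^ 2 ∂(ρ : Measure (Vd d))
lemma mom_nonneg (ρ : ProbabilityMeasure (Vd d)) : 0 ≤ mom ρ := integral_nonneg fun z => by positivity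
lemma iI_mono {f g : ℝ → ℝ} {a b : ℝ} (hab : a ≤ b) (hf : Continuous f) (hg : Continuous g)
    (h : ∀ s ∈ Icc a b, f s ≤ g s) : ∫ s in a..b, f s ≤ ∫ s in a..b, g s :=
  intervalIntegral.integral_mono_on hab (hf.intervalIntegrable a b) (hg.intervalIntegrable a b) h
lemma ci_sub {f g : ℝ → ℝ} (hf : Continuous f) (hg : Continuous g) (a b : ℝ) :
    ∫ s in a..b, (f s - g s) = (∫ s in a..b, f s) - ∫ s in a..b, g s :=
  intervalIntegral.integral_sub (hf.intervalIntegrable a b) (hg.intervalIntegrable a b)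
lemma ci_add {f g : ℝ → ℝ} (hf : Continuous f) (hg : Continuous g) (a b : ℝ) :
    ∫ s in a..b, (f s + g s) = (∫ s in a..b, f s) + ∫ s in a..b, g s :=
  intervalIntegral.integral_add (hf.intervalIntegrable a b) (hg.intervalIntegrable a b)
lemma CP.sub {f g : Vd d → ℝ} (hf : CP f) (hg : CP g) : CP fun x => f x - g x :=
  ⟨hf.1.sub hg.1, fun x z => by simp only [hf.2 x z, hg.2 x z]⟩
lemma CP.add {f g : Vd d → ℝ} (hf : CP f) (hg : CP g) : CP fun x => f x + g x :=
  ⟨hf.1.add hg.1, fun x z => by simp only [hf.2 x z, hg.2 x z]⟩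
lemma CP.cmul {f : Vd d → ℝ} (hf : CP f) (c : ℝ) : CP fun x => c * f x :=
  ⟨hf.1.const_mul c, fun x z => by simp only [hf.2 x z]⟩
lemma int4 {X : Type*} [MeasurableSpace X] {μ : Measure X} {f g h k : X → ℝ} (hf : Integrable f μ)
    (hg : Integrable g μ) (hh : Integrable h μ) (hk : Integrable k μ) :
    Integrable (fun x => f x - g x + h x - k x) μ ∧
    ∫ x, f x - g x + h x - k x ∂μ = ∫ x, f x ∂μ - ∫ x, g x ∂μ + ∫ x, h x ∂μ - ∫ x, k x ∂μ := by
  refine ⟨((hf.sub hg).add hh).sub hk, ?_⟩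
  have h1 : Integrable (fun x => f x - g x) μ := hf.sub hg
  have h2 : Integrable (fun x => f x - g x + h x) μ := h1.add hh
  rw [integral_sub h2 hk, integral_add h1 hh, integral_sub hf hg]
lemma trn_rel_z {S : MFGSetting d} {C1 C2 : ℝ} (hC2 : 0 < C2)
    (hC : ∀ (x h v p : Vd d) (ξ : ℝ), ‖h‖ + ‖v‖ ≤ ξ →
    (1 + min (1/4) (C1 * ξ)) * S.H x ((1 + min (1/4) (C1 * ξ))⁻¹ • p) ≤
      S.H (x + h) p + dotp v p + C2 * (ξ + ξ ^ 2)) (hC1 : 0 < C1)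
    {m : ℝ → PTd d} {a b A R a0 b0 : ℝ} (hab : a ≤ b) (h : RelC S a b m A) (hR : 0 ≤ R)
    (hr : ∀ s ∈ Icc a b, |a0 + b0 * s| + |b0| ≤ R) {φ : ℝ → Vd d → ℝ} (hφ : IsTestFun φ) (z : Vd d) :
    iT (m a) (phz φ a0 b0 z a) - iT (m b) (phz φ a0 b0 z b)
      + (∫ s in a..b, iT (m s) (fun x => opL φ s (x + (a0 + b0 * s) • z)))
      - (∫ s in a..b, iT (m s) (fun x => hamF S φ s (x + (a0 + b0 * s) • z)))
      ≤ A + min (1/4) (C1 * R * (‖z‖ + ‖z‖ ^ 2)) * |A| + C2 * (b - a) * (R + R ^ 2) * (‖z‖ + ‖z‖ ^ 2) := by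
  set κ := min (1/4) (C1 * (R * ‖z‖)) with hκ
  have hκ0 : 0 ≤ κ := le_min (by norm_num) (by positivity)
  have hψ := phz_test hφ a0 b0 z
  set ψ := phz φ a0 b0 z with hψd
  have hψ' := test_smul hψ (1 + κ)⁻¹
  have e1 := mlL (h.2 _ hψ') (show 0 ≤ 1 + κ by linarith)
  rw [mul_sub, Jf_smul hψ, mul_inv_cancel_left₀ (by linarith : 1 + κ ≠ 0)] at e1
  have hop : Continuous fun s => iT (m s) (opL ψ s) := iT_cont h.1 (opL_cont hψ) (opL_per hψ)
  have hh : Continuous fun s => iT (m s) (hamF S (fun s x => (1 + κ)⁻¹ * ψ s x) s) :=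
    iT_cont h.1 (hm_cont S hψ') (hm_per S hψ')
  have hro : Continuous fun s : ℝ => a0 + b0 * s := by fun_prop
  have c1 : Continuous fun s => iT (m s) (fun x => opL φ s (x + (a0 + b0 * s) • z)) :=
    (tr_jc h.1 (opL_cont hφ) (opL_per hφ) hro).comp (continuous_id.prodMk continuous_const)
  have c2 : Continuous fun s => iT (m s) (fun x => hamF S φ s (x + (a0 + b0 * s) • z)) :=
    (tr_jc h.1 (hm_cont S hφ) (hm_per S hφ) hro).comp (continuous_id.prodMk continuous_const)
  have key : ∫ s in a..b, (iT (m s) (fun x => opL φ s (x + (a0 + b0 * s) • z)) -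
      iT (m s) (fun x => hamF S φ s (x + (a0 + b0 * s) • z))) ≤
      ∫ s in a..b, (iT (m s) (opL ψ s) - (1 + κ) * iT (m s) (hamF S (fun s x => (1 + κ)⁻¹ * ψ s x) s)
        + C2 * (R * ‖z‖ + (R * ‖z‖) ^ 2)) := by
    refine iI_mono hab (c1.sub c2) ((hop.sub (hh.const_mul (1 + κ))).add continuous_const) fun s hs => ?_
    have k1 := (CP_of (opL_cont hφ) (opL_per hφ) s).tr ((a0 + b0 * s) • z)
    have k2 := (CP_of (hm_cont S hφ) (hm_per S hφ) s).tr ((a0 + b0 * s) • z)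
    have k3 := CP_of (opL_cont hψ) (opL_per hψ) s
    have k4 := CP_of (hm_cont S hψ') (hm_per S hψ') s
    have k4' := k4.cmul (1 + κ)
    have k34 := k3.sub k4'
    rw [← iT_mul, ← iT_sub k1 k2, ← iT_sub k3 k4', ← iT_const (C2 * (R * ‖z‖ + (R * ‖z‖) ^ 2)) (m s),
      ← iT_add k34 (CP_const _)]
    refine iT_mono (k1.sub k2) (k34.add (CP_const _)) _ fun x => ?_
    have hx := hC x ((a0 + b0 * s) • z) (b0 • z) (gradv (ψ s) x) (R * ‖z‖) (by
      rw [norm_smul, norm_smul, ← add_mul]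
      exact mlR (hr s hs) (norm_nonneg _))
    rw [← hκ] at hx
    simp only [hamF, opL, smul_grad hψ]
    rw [phz_t hφ, phz_lapl]
    rw [dotp_smul_left] at hx
    rw [← phz_grad]
    rw [← hψd]
    linarith
  have hh' : Continuous fun s => (1 + κ) * iT (m s) (hamF S (fun s x => (1 + κ)⁻¹ * ψ s x) s) := hh.const_mul _
  rw [ci_sub c1 c2, ci_add (f := fun s => iT (m s) (opL ψ s) - (1 + κ) *
    iT (m s) (hamF S (fun s x => (1 + κ)⁻¹ * ψ s x) s)) (hop.sub hh') continuous_const, ci_sub hop hh',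
    intervalIntegral.integral_const, intervalIntegral.integral_const_mul, smul_eq_mul] at key
  unfold Jf Hf at e1
  have b1 : κ * A ≤ min (1/4) (C1 * R * (‖z‖ + ‖z‖ ^ 2)) * |A| := by
    refine (mlL (le_abs_self A) hκ0).trans (mlR ?_ (abs_nonneg _))
    refine min_le_min le_rfl ?_
    rw [← mul_assoc]
    exact mlL (by nlinarith [sq_nonneg ‖z‖]) (by positivity)
  have b2 : (b - a) * (C2 * (R * ‖z‖ + (R * ‖z‖) ^ 2)) ≤ C2 * (b - a) * (R + R ^ 2) * (‖z‖ + ‖z‖ ^ 2) := by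
    have hz := norm_nonneg z
    have : R * ‖z‖ + (R * ‖z‖) ^ 2 ≤ (R + R ^ 2) * (‖z‖ + ‖z‖ ^ 2) := by
      have q1 : 0 ≤ R * ‖z‖ ^ 2 := by positivity
      have q2 : 0 ≤ R ^ 2 * ‖z‖ := by positivity
      linarith
    have := mlL this (mul_nonneg hC2.le (sub_nonneg.2 hab))
    linarith
  linarith
lemma trn_rel (S : MFGSetting d) : ∃ C : ℝ, 0 < C ∧ ∀ (ρ : ProbabilityMeasure (Vd d)), momI ρ →
    ∀ {m : ℝ → PTd d} {a b A R a0 b0 : ℝ}, a ≤ b → RelC S a b m A → 0 ≤ R →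
    (∀ s ∈ Icc a b, |a0 + b0 * s| + |b0| ≤ R) →
    RelC S a b (fun s => trn ρ (m s) (a0 + b0 * s))
      (A + min (1/4) (C * R * mom ρ) * |A| + C * (b - a) * (R + R ^ 2) * mom ρ) := by
  obtain ⟨C1, C2, hC1, hC2, hC⟩ := H_shift S
  refine ⟨max C1 C2, lt_max_of_lt_left hC1, fun ρ hρ m a b A R a0 b0 hab h hR hr => ?_⟩
  have hro : Continuous fun s : ℝ => a0 + b0 * s := by fun_prop
  refine ⟨trn_cont ρ h.1 hro, fun φ hφ => ?_⟩
  obtain ⟨i1, e1⟩ := trn_swap ρ h.1 (opL_cont hφ) (opL_per hφ) hro a b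
  obtain ⟨i2, e2⟩ := trn_swap ρ h.1 (hm_cont S hφ) (hm_per S hφ) hro a b
  have i3 : ∀ s, Integrable (fun z => iT (m s) (phz φ a0 b0 z s)) (ρ : Measure (Vd d)) := fun s => by
    obtain ⟨C, -, hC⟩ := per_bdd (test_CP hφ s).1 (test_CP hφ s).2
    refine bdd_int _ ?_ (C := C) fun z => iT_abs ((test_CP hφ s).tr _) _ fun x => hC _
    exact (tr_jc h.1 hφ.1.continuous hφ.2 hro).comp (continuous_const.prodMk continuous_id)
  obtain ⟨i4, e4⟩ := int4 (i3 a) (i3 b) i1 i2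
  unfold Jf Hf
  rw [e1, e2, iT_trn ρ _ _ (test_CP hφ a), iT_trn ρ _ _ (test_CP hφ b)]
  refine (le_of_eq e4.symm).trans ?_
  have im : Integrable (fun z => min (1/4) (C1 * R * (‖z‖ + ‖z‖ ^ 2))) (ρ : Measure (Vd d)) := by
    refine bdd_int _ (by fun_prop) (C := 1/4) fun z => ?_
    rw [abs_of_nonneg (le_min (by norm_num) (by positivity))]
    exact min_le_left _ _
  have iz : Integrable (fun z => C1 * R * (‖z‖ + ‖z‖ ^ 2)) (ρ : Measure (Vd d)) := hρ.const_mul _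
  have iz2 : Integrable (fun z => C2 * (b - a) * (R + R ^ 2) * (‖z‖ + ‖z‖ ^ 2)) (ρ : Measure (Vd d)) :=
    hρ.const_mul _
  have hM : Integrable (fun z => A + min (1/4) (C1 * R * (‖z‖ + ‖z‖ ^ 2)) * |A|
      + C2 * (b - a) * (R + R ^ 2) * (‖z‖ + ‖z‖ ^ 2)) (ρ : Measure (Vd d)) :=
    ((integrable_const A).add (im.mul_const _)).add iz2
  refine (integral_mono i4 hM fun z =>
    trn_rel_z hC2 hC hC1 hab h hR hr hφ z).trans ?_
  have i6 : Integrable (fun z => A + min (1/4) (C1 * R * (‖z‖ + ‖z‖ ^ 2)) * |A|) (ρ : Measure (Vd d)) :=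
    (integrable_const A).add (im.mul_const _)
  rw [integral_add i6 iz2, integral_add (integrable_const A) (im.mul_const _), integral_const, integral_mul_const,
    integral_const_mul]
  have hmm := mom_nonneg ρ
  have f1 : ∫ z, min (1/4) (C1 * R * (‖z‖ + ‖z‖ ^ 2)) ∂(ρ : Measure (Vd d)) ≤
      min (1/4) (max C1 C2 * R * mom ρ) := by
    refine le_min ?_ ?_
    · have := integral_mono im (integrable_const (1/4:ℝ)) fun z => min_le_left _ _
      simpa using this
    · refine (integral_mono im iz fun z => min_le_right _ _).trans ?_
      rw [integral_const_mul]
      refine mlR (mlR (le_max_left _ _) hR) hmm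
  have f2 := mlR f1 (abs_nonneg A)
  have f3 : C2 * (b - a) * (R + R ^ 2) * mom ρ ≤ max C1 C2 * (b - a) * (R + R ^ 2) * mom ρ := by
    have : 0 ≤ (b - a) := sub_nonneg.2 hab
    gcongr
    exact le_max_right _ _
  simp only [probReal_univ, smul_eq_mul, one_mul]
  change _ + C2 * (b - a) * (R + R ^ 2) * mom ρ ≤ _
  linarith
end
section
open scoped Topology NNReal ENNReal
variable {d : ℕ}
lemma dens_exists {w : Vd d → ℝ} (hc : Continuous w) (h0 : ∀ x, 0 < w x) (hi : Integrable w) :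
    ∃ (ρ : ProbabilityMeasure (Vd d)) (c : ℝ), 0 < c ∧
      (ρ : Measure (Vd d)) = volume.withDensity (fun x => ENNReal.ofReal (c * w x)) ∧
      (∀ g : Vd d → ℝ, Integrable (fun x => w x * g x) → Integrable g (ρ : Measure (Vd d))) ∧
      ∀ g : Vd d → ℝ, ∫ x, g x ∂(ρ : Measure (Vd d)) = c * ∫ x, w x * g x := by
  have hpos : 0 < ∫ x, w x := by
    rw [integral_pos_iff_support_of_nonneg (fun x => (h0 x).le) hi]
    have : Function.support w = univ := by ext x; simp [(h0 x).ne']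
    rw [this]; exact isOpen_univ.measure_pos _ univ_nonempty
  set c := (∫ x, w x)⁻¹ with hcd
  have hc0 : 0 < c := inv_pos.2 hpos
  have hm : Measurable fun x => ENNReal.ofReal (c * w x) := by
    exact (hc.const_mul c).measurable.ennreal_ofReal
  have hp : IsProbabilityMeasure (volume.withDensity (fun x => ENNReal.ofReal (c * w x))) := ⟨by
    rw [withDensity_apply _ MeasurableSet.univ, Measure.restrict_univ,
      ← ofReal_integral_eq_lintegral_ofReal (hi.const_mul c)
        (Eventually.of_forall fun x => (mul_pos hc0 (h0 x)).le), integral_const_mul,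
      inv_mul_cancel₀ hpos.ne']
    simp⟩
  have hlt : ∀ᵐ x : Vd d, ENNReal.ofReal (c * w x) < ⊤ := Eventually.of_forall fun x => ENNReal.ofReal_lt_top
  have e : ∀ x, (ENNReal.ofReal (c * w x)).toReal = c * w x := fun x =>
    ENNReal.toReal_ofReal (mul_pos hc0 (h0 x)).le
  refine ⟨⟨_, hp⟩, c, hc0, rfl, fun g hg => ?_, fun g => ?_⟩
  · simp only [ProbabilityMeasure.coe_mk]
    rw [integrable_withDensity_iff_integrable_smul' hm hlt]
    simp only [e, smul_eq_mul, mul_assoc]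
    exact hg.const_mul c
  · simp only [ProbabilityMeasure.coe_mk]
    rw [integral_withDensity_eq_integral_toReal_smul hm hlt]
    simp only [e, smul_eq_mul, mul_assoc, integral_const_mul]
def gw (z : Vd d) : ℝ := exp (-(sqnorm z / 2))
lemma gw_pos (z : Vd d) : 0 < gw z := exp_pos _
lemma sqnorm_smooth : ContDiff ℝ 2 (sqnorm : Vd d → ℝ) := by unfold sqnorm; fun_prop
lemma gw_fd (z : Vd d) (i : Fin d) : fderiv ℝ gw z (Pi.single i 1) = - (z i * gw z) := by
  have h1 : HasDerivAt (fun t : ℝ => gw (z + t • (Pi.single i 1 : Vd d))) (-(z i * gw z)) 0 := by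
    have h2 : ∀ t : ℝ, sqnorm (z + t • (Pi.single i 1 : Vd d)) = sqnorm z + 2 * t * z i + t ^ 2 := by
      intro t
      have : sqnorm (Pi.single i 1 : Vd d) = 1 := by
        simp [sqnorm, Pi.single_apply]
      rw [← dotp_self, dotp_add_left, dotp_add_right, dotp_add_right, dotp_self, dotp_self, sqnorm_smul,
        dotp_comm _ z, dotp_smul_right, this]
      have : dotp z (Pi.single i 1) = z i := by simp [dotp, Pi.single_apply]
      rw [this]; ring
    unfold gw
    simp only [h2]
    have h3 : HasDerivAt (fun t : ℝ => -((sqnorm z + 2 * t * z i + t ^ 2) / 2)) (-(z i)) 0 := by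
      have := (((((hasDerivAt_id (0:ℝ)).const_mul 2).mul_const (z i)).const_add (sqnorm z)).add
        ((hasDerivAt_id (0:ℝ)).pow 2)).div_const 2 |>.neg
      refine this.congr_deriv (by simp)
    refine h3.exp.congr_deriv ?_
    simp; ring
  have hd : DifferentiableAt ℝ (gw : Vd d → ℝ) z := by
    have : Differentiable ℝ (sqnorm : Vd d → ℝ) := sqnorm_smooth.differentiable (by norm_num)
    unfold gw; fun_prop
  have h2 : HasDerivAt (fun t : ℝ => z + t • (Pi.single i 1 : Vd d)) (Pi.single i 1) 0 := by
    refine (((hasDerivAt_id (0:ℝ)).smul_const (Pi.single i 1 : Vd d)).const_add z).congr_deriv (by simp)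
  have h3 := HasFDerivAt.comp_hasDerivAt (x := (0:ℝ)) (f := fun t : ℝ => z + t • (Pi.single i 1 : Vd d))
    (l := gw) (l' := fderiv ℝ gw z) (by simpa using hd.hasFDerivAt) h2
  exact h3.unique h1
lemma gw_int : Integrable (fun z : Vd d => gw z * (1 + sqnorm z)) := by
  have h1 : Integrable (fun z : Vd d => 4 * ∏ i, exp (-(1/4) * (z i) ^ 2)) :=
    (Integrable.fintype_prod (f := fun (_ : Fin d) x => exp (-(1/4) * x ^ 2))
      fun _ => integrable_exp_neg_mul_sq (by norm_num)).const_mul 4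
  refine h1.mono' ?_ (Eventually.of_forall fun z => ?_)
  · have := (sqnorm_smooth (d := d)).continuous
    unfold gw
    exact Continuous.aestronglyMeasurable (by fun_prop)
  · have h0 := sqnorm_nonneg z
    rw [← Real.exp_sum, ← Finset.mul_sum, Real.norm_eq_abs,
      abs_of_nonneg (mul_nonneg (gw_pos z).le (by linarith))]
    change exp (-(sqnorm z / 2)) * (1 + sqnorm z) ≤ 4 * exp (-(1/4) * sqnorm z)
    have h2 : 1 + sqnorm z ≤ 4 * exp (sqnorm z / 4) := by linarith [add_one_le_exp (sqnorm z / 4)]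
    have h3 := mlL h2 (exp_pos (-(sqnorm z / 2))).le
    refine h3.trans (le_of_eq ?_)
    rw [mul_left_comm, ← exp_add]; ring_nf
lemma gw_dom {f : Vd d → ℝ} (hf : Continuous f) {C : ℝ} (h : ∀ z, |f z| ≤ C * (1 + sqnorm z)) :
    Integrable (fun z => gw z * f z) := by
  refine (gw_int.const_mul C).mono' ?_ (Eventually.of_forall fun z => ?_)
  · have := (sqnorm_smooth (d := d)).continuous
    unfold gw
    exact Continuous.aestronglyMeasurable (by fun_prop)
  · rw [Real.norm_eq_abs, abs_mul, abs_of_pos (gw_pos z)]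
    have := mlL (h z) (gw_pos z).le
    linarith
lemma gauss_exists : ∃ γ : ProbabilityMeasure (Vd d), momI γ ∧ ∀ (g : Vd d → ℝ) (C : ℝ) (i : Fin d),
    ContDiff ℝ 1 g → (∀ z, |g z| ≤ C) → (∀ z, |fderiv ℝ g z (Pi.single i 1)| ≤ C) →
    ∫ z, z i * g z ∂(γ : Measure (Vd d)) = ∫ z, fderiv ℝ g z (Pi.single i 1) ∂(γ : Measure (Vd d)) := by
  have hs := (sqnorm_smooth (d := d)).continuous
  have hgc : Continuous (gw : Vd d → ℝ) := by unfold gw; fun_prop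
  have n1 : ∀ z : Vd d, ‖z‖ ≤ 1 + sqnorm z := fun z => by nlinarith [norm_sq_le z, sq_nonneg (‖z‖ - 1), norm_nonneg z]
  obtain ⟨γ, c, -, -, hi, he⟩ := dens_exists hgc gw_pos (by
    simpa using gw_dom (f := fun _ : Vd d => 1) continuous_const (C := 1) fun z => by
      have := sqnorm_nonneg z
      rw [abs_one]; linarith)
  refine ⟨γ, hi _ (gw_dom (by fun_prop) (C := 2) fun z => ?_), fun g C i hg h1 h2 => ?_⟩
  · rw [abs_of_nonneg (by positivity)]
    linarith [n1 z, norm_sq_le z]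
  have hC : 0 ≤ C := (abs_nonneg _).trans (h1 0)
  have hgd : Continuous fun z => fderiv ℝ g z (Pi.single i 1) :=
    (hg.continuous_fderiv (by norm_num)).clm_apply continuous_const
  have b1 : ∀ z : Vd d, C ≤ C * (1 + sqnorm z) := fun z => le_mul_of_one_le_right hC (by linarith [sqnorm_nonneg z])
  have b2 : ∀ z : Vd d, |z i * g z| ≤ C * (1 + sqnorm z) := fun z => by
    rw [abs_mul, mul_comm]
    refine mul_le_mul (h1 z) ((norm_le_pi_norm z i).trans (n1 z)) (abs_nonneg _) hC
  rw [he, he]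
  congr 1
  have i1 : Integrable (fun z => gw z * (z i * g z)) := gw_dom (by fun_prop) b2
  have ibp := integral_mul_fderiv_eq_neg_fderiv_mul_of_integrable (μ := (volume : Measure (Vd d)))
    (f := g) (g := gw) (v := Pi.single i 1)
    (by simpa [mul_comm] using gw_dom hgd fun z => (h2 z).trans (b1 z))
    (by
      simp only [gw_fd]
      refine i1.neg.congr (Eventually.of_forall fun z => ?_)
      simp; ring)
    (by simpa [mul_comm] using gw_dom hg.continuous fun z => (h1 z).trans (b1 z))
    (fun x _ => hg.differentiable (by norm_num) x)
    (fun x _ => by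
      have : Differentiable ℝ (sqnorm : Vd d → ℝ) := sqnorm_smooth.differentiable (by norm_num)
      unfold gw; fun_prop)
  simp only [gw_fd] at ibp
  have e1 : ∫ z, gw z * (z i * g z) = - ∫ z, g z * -(z i * gw z) := by
    rw [← integral_neg]; congr 1; funext z; ring
  rw [e1, ibp, neg_neg]
  congr 1; funext z; ring
def gam : ProbabilityMeasure (Vd d) := Classical.choose gauss_exists
lemma gam_mom : momI (gam : ProbabilityMeasure (Vd d)) := (Classical.choose_spec gauss_exists).1
lemma gam_stein (g : Vd d → ℝ) (C : ℝ) (i : Fin d) :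
    ContDiff ℝ 1 g → (∀ z, |g z| ≤ C) → (∀ z, |fderiv ℝ g z (Pi.single i 1)| ≤ C) →
    ∫ z, z i * g z ∂((gam : ProbabilityMeasure (Vd d)) : Measure (Vd d)) = ∫ z, fderiv ℝ g z (Pi.single i 1) ∂((gam : ProbabilityMeasure (Vd d)) : Measure (Vd d)) :=
  (Classical.choose_spec gauss_exists).2 g C i
end
section
open scoped Topology NNReal ENNReal
variable {d : ℕ}
abbrev PG (μ : PTd d) : Measure (Td d × Vd d) :=
  (μ : Measure (Td d)).prod ((gam : ProbabilityMeasure (Vd d)) : Measure (Vd d))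
lemma PG_norm (μ : PTd d) : Integrable (fun q : Td d × Vd d => ‖q.2‖) (PG μ) := by
  have h : Integrable (fun z : Vd d => ‖z‖) ((gam : ProbabilityMeasure (Vd d)) : Measure (Vd d)) := by
    refine (gam_mom (d := d)).mono' (by fun_prop) (Eventually.of_forall fun z => ?_)
    have := sq_nonneg ‖z‖
    rw [norm_norm]; linarith
  exact h.comp_snd _
lemma PG_lin (μ : PTd d) {f : Td d × Vd d → ℝ} (hf : Continuous f) {C : ℝ}
    (h : ∀ q, |f q| ≤ C * (1 + ‖q.2‖)) : Integrable f (PG μ) := by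
  refine (((integrable_const (1:ℝ)).add (PG_norm μ)).const_mul C).mono' hf.aestronglyMeasurable
    (Eventually.of_forall h)
lemma stein_prod (μ : PTd d) {u : Vd d → ℝ} (hu : ContDiff ℝ 1 u) (hp : Per u) (i : Fin d) (r : ℝ) :
    Integrable (fun q : Td d × Vd d => q.2 i * u (secT q.1 + r • q.2)) (PG μ) ∧
    Integrable (fun q : Td d × Vd d => fderiv ℝ u (secT q.1 + r • q.2) (Pi.single i 1)) (PG μ) ∧
    ∫ q, q.2 i * u (secT q.1 + r • q.2) ∂(PG μ) =
      r * ∫ q, fderiv ℝ u (secT q.1 + r • q.2) (Pi.single i 1) ∂(PG μ) := by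
  have hdp : Per fun x => fderiv ℝ u x (Pi.single i 1) := fun x z => by
    have : u = fun y => u (y + intVec z) := by funext y; exact (hp y z).symm
    have h2 : fderiv ℝ u x = fderiv ℝ (fun y => u (y + intVec z)) x := congrArg (fun f => fderiv ℝ f x) this
    simp only [h2, fderiv_comp_add_right]
  have hdc : Continuous fun x => fderiv ℝ u x (Pi.single i 1) :=
    (hu.continuous_fderiv (by norm_num)).clm_apply continuous_const
  obtain ⟨C1, h1, hC1⟩ := per_bdd hu.continuous hp
  obtain ⟨C2, h2, hC2⟩ := per_bdd hdc hdp
  have i1 : Integrable (fun q : Td d × Vd d => q.2 i * u (secT q.1 + r • q.2)) (PG μ) := by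
    refine PG_lin μ (C := C1) ?_ fun q => ?_
    · exact ((continuous_apply i).comp continuous_snd).mul (sec_jc ⟨hu.continuous, hp⟩ r)
    · rw [abs_mul]
      have := abs_le_norm q.2 i
      nlinarith [abs_nonneg (q.2 i), abs_nonneg (u (secT q.1 + r • q.2)), hC1 (secT q.1 + r • q.2), norm_nonneg q.2]
  have i2 : Integrable (fun q : Td d × Vd d => fderiv ℝ u (secT q.1 + r • q.2) (Pi.single i 1)) (PG μ) :=
    bdd_int _ (sec_jc ⟨hdc, hdp⟩ r) fun q => hC2 _
  refine ⟨i1, i2, ?_⟩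
  rw [integral_prod _ i1, integral_prod _ i2, ← integral_const_mul]
  congr 1
  funext y
  have hg : ∀ z, HasFDerivAt (fun z : Vd d => u (secT y + r • z)) (r • fderiv ℝ u (secT y + r • z)) z := by
    intro z
    have h3 : HasFDerivAt (fun z : Vd d => secT y + r • z) (r • ContinuousLinearMap.id ℝ (Vd d)) z :=
      ((hasFDerivAt_id z).const_smul r).const_add _
    have := ((hu.differentiable (by norm_num) (secT y + r • z)).hasFDerivAt).comp z h3
    refine this.congr_fderiv ?_
    ext v; simp
  have := gam_stein (fun z => u (secT y + r • z)) (max C1 (|r| * C2)) i (by fun_prop)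
    (fun z => (hC1 _).trans (le_max_left _ _)) (fun z => by
      rw [(hg z).fderiv]
      refine le_trans ?_ (le_max_right _ _)
      simp only [_root_.smul_apply, smul_eq_mul, abs_mul]
      gcongr; exact hC2 _)
  simp only at this ⊢
  rw [this, ← integral_const_mul]
  congr 1; funext z
  rw [(hg z).fderiv]; simp
def heat (μ : PTd d) (s : ℝ) : PTd d := trn gam μ (√(2 * s))
lemma heat_cont (μ : PTd d) : Continuous (heat μ) :=
  trn_cont gam (m := fun _ => μ) continuous_const (by fun_prop)
lemma heat_zero (μ : PTd d) : heat μ 0 = μ := by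
  refine eq_of_C2 fun f hf hp => ?_
  have := trn_prod gam μ 0 ⟨hf.continuous, hp⟩
  have h2 := iT_trn gam μ 0 ⟨hf.continuous, hp⟩
  simp at h2
  simpa [heat, iT] using h2
lemma sqrt_deriv {s : ℝ} (hs : 0 < s) : HasDerivAt (fun s => √(2 * s)) (√(2 * s))⁻¹ s := by
  have h1 : HasDerivAt (fun s : ℝ => 2 * s) 2 s := by
    simpa using (hasDerivAt_id s).const_mul 2
  refine (h1.sqrt (by positivity)).congr_deriv ?_
  have : √(2 * s) ≠ 0 := by positivity
  field_simp
lemma heat_deriv (μ : PTd d) {φ : ℝ → Vd d → ℝ} (h : IsTestFun φ) {s : ℝ} (hs : 0 < s) :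
    HasDerivAt (fun s => iT (heat μ s) (φ s)) (iT (heat μ s) (opL φ s)) s := by
  have e : (fun s => iT (heat μ s) (φ s)) = fun s => ∫ q, φ s (secT q.1 + √(2 * s) • q.2) ∂(PG μ) := by
    funext s; exact trn_prod gam μ _ (test_CP h s)
  obtain ⟨C1, h1, hC1⟩ := per_bdd_on (tderiv_cont h) (tderiv_per h) (isCompact_Icc (a := s/2) (b := 2*s))
  have hgi : ∀ i : Fin d, ∃ C, 0 ≤ C ∧ ∀ t ∈ Icc (s/2) (2*s), ∀ x, |gradv (φ t) x i| ≤ C := fun i =>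
    per_bdd_on (f := fun t x => gradv (φ t) x i)
      ((continuous_apply i).comp (grad_cont h)) (fun t x z => by simp only [grad_per h]) isCompact_Icc
  choose C2 h2 hC2 using hgi
  have hR : 0 < √s := by positivity
  have key := hasDerivAt_integral_of_dominated_loc_of_deriv_le (μ := PG μ) (s := Icc (s/2) (2*s)) (x₀ := s)
    (F := fun s (q : Td d × Vd d) => φ s (secT q.1 + √(2 * s) • q.2))
    (F' := fun s q => tderiv φ s (secT q.1 + √(2 * s) • q.2) +
      (√(2 * s))⁻¹ * dotp q.2 (gradv (φ s) (secT q.1 + √(2 * s) • q.2)))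
    (bound := fun q => C1 + (√s)⁻¹ * ((∑ i, C2 i) * ‖q.2‖))
    (Icc_mem_nhds (by linarith) (by linarith))
    (Eventually.of_forall fun t => (sec_jc (test_CP h t) _).aestronglyMeasurable)
    (by
      obtain ⟨C, _, hC⟩ := per_bdd (test_CP h s).1 (test_CP h s).2
      exact bdd_int _ (sec_jc (test_CP h s) _) fun q => hC _)
    (by
      refine Continuous.aestronglyMeasurable ?_
      have a1 := sec_jc (CP_of (tderiv_cont h) (tderiv_per h) s) (√(2 * s))
      have a2 : ∀ i, Continuous fun q : Td d × Vd d => gradv (φ s) (secT q.1 + √(2 * s) • q.2) i := fun i =>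
        sec_jc (f := fun x => gradv (φ s) x i) ⟨by
          exact (continuous_apply i).comp ((grad_cont h).comp (by fun_prop : Continuous fun x => (s, x))),
          fun x z => by simp only [grad_per h]⟩ _
      unfold dotp
      fun_prop)
    (Eventually.of_forall fun q t ht => by
      rw [Real.norm_eq_abs]
      refine (abs_add_le _ _).trans (add_le_add (hC1 t ht _) ?_)
      rw [abs_mul, abs_of_nonneg (by positivity)]
      have hle : √s ≤ √(2 * t) := Real.sqrt_le_sqrt (by linarith [ht.1])
      refine mul_le_mul (inv_anti₀ hR hle) ?_ (abs_nonneg _) (by positivity)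
      refine (Finset.abs_sum_le_sum_abs _ _).trans ?_
      rw [Finset.sum_mul]
      refine Finset.sum_le_sum fun i _ => ?_
      rw [abs_mul, mul_comm]
      exact mul_le_mul (hC2 i t ht _) (abs_le_norm _ _) (abs_nonneg _) (h2 i))
    ((integrable_const _).add (((PG_norm μ).const_mul _).const_mul _))
    (Eventually.of_forall fun q t ht => curve_deriv h (sqrt_deriv (by linarith [ht.1])) _ _)
  rw [e]
  refine key.2.congr_deriv ?_
  have hcp : CP (opL φ s) := CP_of (opL_cont h) (opL_per h) s
  have hct := CP_of (tderiv_cont h) (tderiv_per h) s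
  rw [heat, trn_prod gam μ _ hcp]
  set r := √(2 * s)
  have hr : r ≠ 0 := by positivity
  have hst := fun i => stein_prod μ (u := fun x => fderiv ℝ (φ s) x (Pi.single i 1))
    (((test_s h s).fderiv_right (m := 1) (by norm_num)).clm_apply contDiff_const)
    (fun x z => by simp only [fderiv_per h]) i r
  obtain ⟨Ct, _, hCt⟩ := per_bdd hct.1 hct.2
  have it : Integrable (fun q : Td d × Vd d => tderiv φ s (secT q.1 + r • q.2)) (PG μ) :=
    bdd_int _ (sec_jc hct _) fun q => hCt _
  unfold opL lapl dotp D2 gradv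
  rw [integral_add it ((integrable_finsetSum _ fun i _ => (hst i).1).const_mul _),
    integral_add it (integrable_finsetSum _ fun i _ => (hst i).2.1), integral_const_mul,
    integral_finsetSum _ fun i _ => (hst i).1, integral_finsetSum _ fun i _ => (hst i).2.1]
  congr 1
  simp only [fun i => (hst i).2.2]
  rw [← Finset.mul_sum, inv_mul_cancel_left₀ hr]
lemma heat_J (μ : PTd d) {φ : ℝ → Vd d → ℝ} (h : IsTestFun φ) {a b : ℝ} (ha : 0 ≤ a) (hab : a ≤ b) :
    Jf a b (heat μ) φ = 0 := by
  have := intervalIntegral.integral_eq_sub_of_hasDerivAt_of_le hab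
    (iT_cont (heat_cont μ) (test_cont h) (test_per h)).continuousOn
    (fun s hs => heat_deriv μ h (ha.trans_lt hs.1)) (opL_int (heat_cont μ) h a b)
  unfold Jf
  rw [this]; ring
lemma heat_rel (S : MFGSetting d) : ∃ C : ℝ, 0 < C ∧ ∀ (μ : PTd d) {a b : ℝ}, 0 ≤ a → a ≤ b →
    RelC S a b (heat μ) (C * (b - a)) := by
  obtain ⟨c, C, hc, hC, h⟩ := H_quad S
  refine ⟨C, hC, fun μ a b ha hab => ⟨heat_cont μ, fun φ hφ => ?_⟩⟩
  rw [heat_J μ hφ ha hab]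
  have h1 : ∫ s in a..b, -C ≤ Hf S a b (heat μ) φ := by
    refine iI_mono hab continuous_const (iT_cont (heat_cont μ) (hm_cont S hφ) (hm_per S hφ)) fun s _ => ?_
    have := iT_mono (CP_const (-C)) (CP_of (hm_cont S hφ) (hm_per S hφ) s) (heat μ s) fun x => by
      have := h.1 x (gradv (φ s) x)
      have h0 := mul_nonneg hc.le (sqnorm_nonneg (gradv (φ s) x))
      simp only [hamF]; linarith
    rwa [iT_const] at this
  simp at h1
  linarith
end
section
open scoped Topology NNReal ENNReal
variable {d : ℕ}
lemma dubois {g f : ℝ → ℝ} {a b : ℝ} (hab : a ≤ b) (hg : Continuous g) (hf : IntervalIntegrable f volume a b)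
    (h : ∀ ζ : ℝ → ℝ, ContDiff ℝ 2 ζ → ζ b * g b - ζ a * g a = ∫ s in a..b, (deriv ζ s * g s + ζ s * f s)) :
    ∀ t ∈ Icc a b, g t - g a = ∫ s in a..t, f s := by
  rcases hab.eq_or_lt with rfl | hlt
  · intro t ht
    obtain rfl : t = a := le_antisymm ht.2 ht.1
    simp
  set K : ℝ → ℝ := fun x => ∫ s in a..x, f s with hK
  have hKac : AbsolutelyContinuousOnInterval K a b :=
    hf.absolutelyContinuousOnInterval_intervalIntegral (by simp)
  have hKc : ContinuousOn K (Icc a b) := by simpa [uIcc_of_le hab] using hKac.continuousOn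
  set E : ℝ → ℝ := fun s => g s - g a - K s with hE
  have hEc : ContinuousOn E (Icc a b) := (hg.sub continuous_const).continuousOn.sub hKc
  have key : ∀ u : ℝ → ℝ, ContDiff ℝ 1 u → ∫ s in a..b, u s * E s = 0 := by
    intro u hu
    set ζ : ℝ → ℝ := fun x => ∫ s in b..x, u s
    have hζ : ∀ x, HasDerivAt ζ (u x) x := fun x =>
      intervalIntegral.integral_hasDerivAt_right (hu.continuous.intervalIntegrable _ _)
        (hu.continuous.stronglyMeasurableAtFilter _ _) hu.continuous.continuousAt
    have hζd : deriv ζ = u := funext fun x => (hζ x).deriv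
    have hζ2 : ContDiff ℝ 2 ζ := by
      rw [show (2 : WithTop ℕ∞) = 1 + 1 by norm_num, contDiff_succ_iff_deriv]
      exact ⟨fun x => (hζ x).differentiableAt, by simp, by rwa [hζd]⟩
    have h1 := h ζ hζ2
    rw [hζd] at h1
    have hb : ζ b = 0 := by simp [ζ]
    have hac : AbsolutelyContinuousOnInterval ζ a b :=
      (hu.continuous.intervalIntegrable a b).absolutelyContinuousOnInterval_intervalIntegral (by simp)
    have h2 := hac.integral_mul_deriv_eq_deriv_mul hKac
    have h3 : ∫ s in a..b, ζ s * deriv K s = ∫ s in a..b, ζ s * f s := by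
      refine intervalIntegral.integral_congr_ae ?_
      filter_upwards [hf.ae_hasDerivAt_integral] with x hx hx2
      rw [(hx (uIoc_subset_uIcc hx2) a (by simp)).deriv]
    have hKa : K a = 0 := by simp [hK]
    rw [h3, hb, hKa, hζd] at h2
    have hζc : Continuous ζ := hζ2.continuous
    have iug : IntervalIntegrable (fun s => u s * g s) volume a b := (hu.continuous.mul hg).intervalIntegrable _ _
    have iuK : IntervalIntegrable (fun s => u s * K s) volume a b := by
      refine ContinuousOn.intervalIntegrable ?_
      rw [uIcc_of_le hab]; exact hu.continuous.continuousOn.mul hKc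
    have iu : IntervalIntegrable (fun s => u s * g a) volume a b := (hu.continuous.mul_const _).intervalIntegrable _ _
    rw [intervalIntegral.integral_add iug (hf.continuousOn_mul hζc.continuousOn), h2, hb] at h1
    have h4 : ∫ s in a..b, u s * E s = (∫ s in a..b, u s * g s) - (∫ s in a..b, u s * g a) - ∫ s in a..b, u s * K s := by
      rw [← intervalIntegral.integral_sub iug iu, ← intervalIntegral.integral_sub (iug.sub iu) iuK]
      congr 1; funext s; simp only [hE]; ring
    have h5 : ∫ s in a..b, u s * g a = - ζ a * g a := by
      rw [intervalIntegral.integral_mul_const, intervalIntegral.integral_symm]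
    rw [h4, h5]; linarith
  have h0 : ∀ᵐ x, x ∈ Ioo a b → E x = 0 := by
    refine isOpen_Ioo.ae_eq_zero_of_integral_contDiff_smul_eq_zero ?_ fun u hu _ hsu => ?_
    · exact (hEc.mono Ioo_subset_Icc_self).locallyIntegrableOn measurableSet_Ioo
    · have := key u (hu.of_le (by norm_cast))
      rw [intervalIntegral.integral_of_le hab] at this
      rw [← setIntegral_eq_integral_of_forall_compl_eq_zero (s := Ioc a b)]
      · simpa using this
      · intro x hx
        have : u x = 0 := by
          by_contra h'
          exact hx (Ioo_subset_Ioc_self (hsu (subset_tsupport u h')))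
        simp [this]
  have h1 := Measure.eqOn_Icc_of_ae_eq (μ := volume) hlt.ne (f := E) (g := fun _ => 0) (by
    rw [← restrict_Ioo_eq_restrict_Icc]
    exact (ae_restrict_iff' measurableSet_Ioo).2 h0) hEc continuousOn_const
  intro t ht
  have := h1 ht
  simp only [hE, hK] at this; linarith
lemma curve_meas {m : ℝ → PTd d} (hm : Continuous m) : Measurable fun s => (m s : Measure (Td d)) := by
  have hB : (inferInstance : MeasurableSpace (Td d)) = MeasurableSpace.generateFrom {s | IsClosed s} := by
    rw [← borel_eq_generateFrom_isClosed]; exact BorelSpace.measurable_eq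
  refine Measurable.measure_of_isPiSystem_of_isProbabilityMeasure hB isPiSystem_isClosed fun F hF => ?_
  have hδ : ∀ n : ℕ, (0:ℝ) < 1 / ((n:ℝ) + 1) := fun n => by positivity
  refine measurable_of_tendsto_metrizable (f := fun n s => ∫⁻ ω, (thickenedIndicator (hδ n) F ω : ℝ≥0∞) ∂(m s : Measure (Td d)))
    (fun n => ?_) ?_
  · have h1 := (ProbabilityMeasure.continuous_testAgainstNN_eval (thickenedIndicator (hδ n) F)).comp hm
    have h2 : Continuous fun s => ((m s).toFiniteMeasure.testAgainstNN (thickenedIndicator (hδ n) F) : ℝ≥0∞) :=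
      ENNReal.continuous_coe.comp h1
    refine Continuous.measurable ?_
    convert h2 using 2 with s
    rw [FiniteMeasure.testAgainstNN_coe_eq]; rfl
  · rw [tendsto_pi_nhds]
    intro s
    exact tendsto_lintegral_thickenedIndicator_of_isClosed _ hF hδ tendsto_one_div_add_atTop_nhds_zero_nat
lemma l2n {X : Type*} [MeasurableSpace X] {μ : Measure X} {f : X → Vd d} (hf : MemLp f 2 μ) :
    ‖hf.toLp f‖ ^ 2 = ∫ x, ‖f x‖ ^ 2 ∂μ := by
  have h0 : 0 ≤ ∫ x, ‖f x‖ ^ 2 ∂μ := integral_nonneg fun x => by positivity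
  rw [Lp.norm_toLp, hf.eLpNorm_eq_integral_rpow_norm (by norm_num) (by norm_num)]
  simp only [ENNReal.toReal_ofNat, Real.rpow_ofNat]
  rw [ENNReal.toReal_ofReal (by positivity), ← Real.rpow_natCast, ← Real.rpow_mul h0]
  norm_num
lemma sq_int {X : Type*} [MeasurableSpace X] {μ : Measure X} {f : X → Vd d} (hf : MemLp f 2 μ) :
    Integrable (fun x => sqnorm (f x)) μ := by
  have h1 : Integrable (fun x => ‖f x‖ ^ 2) μ := by
    have := hf.integrable_norm_rpow (by norm_num) (by norm_num)
    simpa using this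
  refine (h1.const_mul (d:ℝ)).mono' ?_ (Eventually.of_forall fun x => ?_)
  · exact sqnorm_smooth.continuous.comp_aestronglyMeasurable hf.1
  · rw [Real.norm_eq_abs, abs_of_nonneg (sqnorm_nonneg _)]; exact sqnorm_le _
lemma memLp_of_sq {X : Type*} [MeasurableSpace X] {μ : Measure X} {f : X → Vd d} (hf : AEStronglyMeasurable f μ)
    (h : Integrable (fun x => sqnorm (f x)) μ) : MemLp f 2 μ := by
  rw [← integrable_norm_rpow_iff hf (by norm_num) (by norm_num)]
  simp only [ENNReal.toReal_ofNat, Real.rpow_ofNat]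
  refine h.mono' (hf.norm.pow 2) (Eventually.of_forall fun x => ?_)
  rw [Real.norm_eq_abs, abs_of_nonneg (by positivity)]; exact norm_sq_le _
lemma L2_complete {X : Type*} [MeasurableSpace X] {μ : Measure X} {f : ℕ → X → Vd d} (hf : ∀ n, MemLp (f n) 2 μ)
    (hc : ∀ ε > 0, ∃ N, ∀ n ≥ N, ∀ k ≥ N, ∫ x, sqnorm (f n x - f k x) ∂μ ≤ ε) :
    ∃ p : X → Vd d, Measurable p ∧ MemLp p 2 μ ∧ Tendsto (fun n => ∫ x, sqnorm (f n x - p x) ∂μ) atTop (𝓝 0) := by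
  have hcs : CauchySeq fun n => (hf n).toLp (f n) := by
    rw [Metric.cauchySeq_iff]
    intro ε hε
    obtain ⟨N, hN⟩ := hc (ε ^ 2 / 4) (by positivity)
    refine ⟨N, fun n hn k hk => ?_⟩
    rw [dist_eq_norm, ← MemLp.toLp_sub]
    have h1 := l2n ((hf n).sub (hf k))
    have h2 : ∫ x, ‖(f n - f k) x‖ ^ 2 ∂μ ≤ ∫ x, sqnorm (f n x - f k x) ∂μ :=
      integral_mono_of_nonneg (Eventually.of_forall fun x => by positivity) (sq_int ((hf n).sub (hf k)))
        (Eventually.of_forall fun x => norm_sq_le _)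
    have h3 := hN n hn k hk
    refine lt_of_pow_lt_pow_left₀ 2 hε.le ?_
    nlinarith
  obtain ⟨q, hq⟩ := cauchySeq_tendsto_of_complete hcs
  obtain ⟨p, hp, hqp⟩ := (Lp.aestronglyMeasurable q).aemeasurable
  have hpL : MemLp p 2 μ := (memLp_congr_ae hqp).1 (Lp.memLp q)
  have e : hpL.toLp p = q := by
    rw [← Lp.toLp_coeFn q (Lp.memLp q)]
    exact (MemLp.toLp_eq_toLp_iff _ _).2 hqp.symm
  refine ⟨p, hp, hpL, ?_⟩
  rw [← e] at hq
  have h1 := ((tendsto_iff_norm_sub_tendsto_zero.1 hq).pow 2).const_mul (d:ℝ)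
  simp only [ne_eq, OfNat.ofNat_ne_zero, not_false_eq_true, zero_pow, mul_zero] at h1
  refine squeeze_zero (fun n => integral_nonneg fun x => sqnorm_nonneg _) (fun n => ?_) h1
  rw [← MemLp.toLp_sub, l2n, ← integral_const_mul]
  have h2 := (((hf n).sub hpL).integrable_norm_rpow (by norm_num) (by norm_num)).const_mul (d:ℝ)
  refine integral_mono (sq_int ((hf n).sub hpL)) (by simpa using h2) fun x => sqnorm_le _
end
section
variable {d : ℕ}
def kap {m : ℝ → PTd d} (hm : Continuous m) : ProbabilityTheory.Kernel ℝ (Td d) :=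
  ⟨fun s => (m s : Measure (Td d)), curve_meas hm⟩
instance {m : ℝ → PTd d} (hm : Continuous m) : ProbabilityTheory.IsMarkovKernel (kap hm) :=
  ⟨fun s => by unfold kap; exact (inferInstance : IsProbabilityMeasure (m s : Measure (Td d)))⟩
def muC {m : ℝ → PTd d} (hm : Continuous m) (a b : ℝ) : Measure (ℝ × Td d) :=
  (volume.restrict (Ioc a b)) ⊗ₘ kap hm
instance {m : ℝ → PTd d} (hm : Continuous m) (a b : ℝ) : IsFiniteMeasure (muC hm a b) := by
  unfold muC; infer_instance
section
variable {m : ℝ → PTd d} (hm : Continuous m) {a b : ℝ}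
lemma muC_int (hab : a ≤ b) {f : ℝ × Td d → ℝ} (hf : Integrable f (muC hm a b)) :
    IntervalIntegrable (fun s => ∫ y, f (s, y) ∂(m s : Measure (Td d))) volume a b ∧
    ∫ q, f q ∂(muC hm a b) = ∫ s in a..b, ∫ y, f (s, y) ∂(m s : Measure (Td d)) := by
  rw [intervalIntegrable_iff_integrableOn_Ioc_of_le hab, intervalIntegral.integral_of_le hab]
  exact ⟨hf.integral_compProd, Measure.integral_compProd hf⟩
lemma muC_ae {f : ℝ × Td d → ℝ} (hf : Integrable f (muC hm a b)) :
    ∀ᵐ s ∂(volume.restrict (Ioc a b)), Integrable (fun y => f (s, y)) (m s : Measure (Td d)) :=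
  hf.ae_of_compProd
lemma muC_lint {f : ℝ × Td d → ℝ≥0∞} (hf : Measurable f) :
    ∫⁻ q, f q ∂(muC hm a b) = ∫⁻ s in Ioc a b, ∫⁻ y, f (s, y) ∂(m s : Measure (Td d)) :=
  Measure.lintegral_compProd hf
lemma muC_cont {f : ℝ × Td d → ℝ} (hf : Continuous f) : Integrable f (muC hm a b) := by
  obtain ⟨C, hC⟩ := ((isCompact_Icc (a := a) (b := b)).prod (isCompact_univ (X := Td d))).exists_bound_of_continuousOn
    hf.continuousOn
  refine Integrable.mono' (integrable_const C) hf.aestronglyMeasurable ?_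
  refine Measure.ae_compProd_of_ae_ae (measurableSet_le hf.norm.measurable measurable_const) ?_
  filter_upwards [ae_restrict_mem measurableSet_Ioc] with s hs
  exact Eventually.of_forall fun y => hC (s, y) ⟨Ioc_subset_Icc_self hs, trivial⟩
lemma muC_memLp {f : ℝ × Td d → Vd d} (hf : Continuous f) : MemLp f 2 (muC hm a b) :=
  memLp_of_sq hf.aestronglyMeasurable (muC_cont hm (sqnorm_smooth.continuous.comp hf))
end
lemma dot_int {X : Type*} [MeasurableSpace X] {μ : Measure X} {f g : X → Vd d} (hf : MemLp f 2 μ)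
    (hg : MemLp g 2 μ) : Integrable (fun x => dotp (f x) (g x)) μ := by
  refine ((sq_int hf).add (sq_int hg)).mono' ?_ (Eventually.of_forall fun x => ?_)
  · have : Continuous fun q : Vd d × Vd d => dotp q.1 q.2 := by unfold dotp; fun_prop
    exact this.comp_aestronglyMeasurable (hf.1.prodMk hg.1)
  · simp only [Real.norm_eq_abs, Pi.add_apply, dotp, sqnorm, ← Finset.sum_add_distrib]
    refine (Finset.abs_sum_le_sum_abs _ _).trans (Finset.sum_le_sum fun i _ => ?_)
    rw [abs_le]; constructor <;> nlinarith [sq_nonneg (f x i + g x i), sq_nonneg (f x i - g x i), sq_nonneg (f x i), sq_nonneg (g x i)]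
def Gf (φ : ℝ → Vd d → ℝ) (q : ℝ × Td d) : Vd d := gradv (φ q.1) (secT q.2)
lemma Gf_cont {φ : ℝ → Vd d → ℝ} (h : IsTestFun φ) : Continuous (Gf φ) := by
  refine continuous_pi fun i => ?_
  exact cont_sec (f := fun t x => gradv (φ t) x i) ((continuous_apply i).comp (grad_cont h))
    (fun t x z => by simp only [grad_per h])
lemma test_lin {φ ψ : ℝ → Vd d → ℝ} (h : IsTestFun φ) (h' : IsTestFun ψ) (c e : ℝ) :
    IsTestFun fun s x => c * φ s x + e * ψ s x :=
  ⟨(h.1.const_smul c).add (h'.1.const_smul e), fun t x z => by simp only [h.2, h'.2]⟩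
lemma fd_lin {φ ψ : ℝ → Vd d → ℝ} (h : IsTestFun φ) (h' : IsTestFun ψ) (c e s : ℝ) (x : Vd d) :
    fderiv ℝ (fun x => c * φ s x + e * ψ s x) x = c • fderiv ℝ (φ s) x + e • fderiv ℝ (ψ s) x := by
  have h1 := ((test_s h s).differentiable (by norm_num) x).hasFDerivAt
  have h2 := ((test_s h' s).differentiable (by norm_num) x).hasFDerivAt
  exact ((h1.const_mul c).add (h2.const_mul e)).fderiv
lemma Gf_lin {φ ψ : ℝ → Vd d → ℝ} (h : IsTestFun φ) (h' : IsTestFun ψ) (c e : ℝ) (q : ℝ × Td d) :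
    Gf (fun s x => c * φ s x + e * ψ s x) q = c • Gf φ q + e • Gf ψ q := by
  ext i; simp only [Gf, gradv]; rw [fd_lin h h']; simp [gradv]
lemma opL_lin {φ ψ : ℝ → Vd d → ℝ} (h : IsTestFun φ) (h' : IsTestFun ψ) (c e s : ℝ) :
    opL (fun s x => c * φ s x + e * ψ s x) s = fun x => c * opL φ s x + e * opL ψ s x := by
  funext x
  unfold opL lapl D2 tderiv
  have h1 := (test_t h s x).const_mul c
  have h2 := (test_t h' s x).const_mul e
  have h12 : HasDerivAt (fun s => c * φ s x + e * ψ s x) _ s := h1.add h2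
  simp only []
  rw [h12.deriv, (test_t h s x).deriv, (test_t h' s x).deriv]
  have h3 : ∀ i : Fin d, fderiv ℝ (fun y => fderiv ℝ (fun x => c * φ s x + e * ψ s x) y (Pi.single i 1)) x (Pi.single i 1)
    = c * fderiv ℝ (fun y => fderiv ℝ (φ s) y (Pi.single i 1)) x (Pi.single i 1)
      + e * fderiv ℝ (fun y => fderiv ℝ (ψ s) y (Pi.single i 1)) x (Pi.single i 1) := by
    intro i
    have d1 := ((diff_fderiv (test_s h s) (Pi.single i 1)).differentiable (by norm_num) x).hasFDerivAt
    have d2 := ((diff_fderiv (test_s h' s) (Pi.single i 1)).differentiable (by norm_num) x).hasFDerivAt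
    have e1 : (fun y => fderiv ℝ (fun x => c * φ s x + e * ψ s x) y (Pi.single i 1)) =
      fun y => c * fderiv ℝ (φ s) y (Pi.single i 1) + e * fderiv ℝ (ψ s) y (Pi.single i 1) := by
      funext y; rw [fd_lin h h']; simp
    have d12 : HasFDerivAt (fun y => c * fderiv ℝ (φ s) y (Pi.single i 1) + e * fderiv ℝ (ψ s) y (Pi.single i 1)) _ x := (d1.const_mul c).add (d2.const_mul e)
    rw [e1, d12.fderiv]
    simp
  simp only [h3, Finset.sum_add_distrib, ← Finset.mul_sum]
  ring
lemma iT_lin {f g : Vd d → ℝ} (hf : CP f) (hg : CP g) (c e : ℝ) (μ : PTd d) :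
    iT μ (fun x => c * f x + e * g x) = c * iT μ f + e * iT μ g := by
  rw [iT_add (hf.cmul c) (hg.cmul e), iT_mul, iT_mul]
lemma Jf_lin {m : ℝ → PTd d} (hm : Continuous m) {φ ψ : ℝ → Vd d → ℝ} (h : IsTestFun φ) (h' : IsTestFun ψ) (c e a b : ℝ) :
    Jf a b m (fun s x => c * φ s x + e * ψ s x) = c * Jf a b m φ + e * Jf a b m ψ := by
  have h1 : ∀ s, iT (m s) (opL (fun s x => c * φ s x + e * ψ s x) s) = c * iT (m s) (opL φ s) + e * iT (m s) (opL ψ s) := fun s => by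
    rw [opL_lin h h', iT_lin (CP_of (opL_cont h) (opL_per h) s) (CP_of (opL_cont h') (opL_per h') s)]
  unfold Jf
  simp only [h1]
  rw [iT_lin (test_CP h _) (test_CP h' _), iT_lin (test_CP h _) (test_CP h' _),
    ci_add ((iT_cont hm (opL_cont h) (opL_per h)).const_mul c) ((iT_cont hm (opL_cont h') (opL_per h')).const_mul e),
    intervalIntegral.integral_const_mul, intervalIntegral.integral_const_mul]
  ring
lemma Hq_cont (S : MFGSetting d) {φ : ℝ → Vd d → ℝ} (h : IsTestFun φ) :
    Continuous fun q : ℝ × Td d => S.H (secT q.2) (Gf φ q) := cont_sec (hm_cont S h) (hm_per S h)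
lemma Hf_eq (S : MFGSetting d) {m : ℝ → PTd d} (hm : Continuous m) {a b : ℝ} (hab : a ≤ b) {φ : ℝ → Vd d → ℝ} (h : IsTestFun φ) :
    Hf S a b m φ = ∫ q, S.H (secT q.2) (Gf φ q) ∂(muC hm a b) :=
  (muC_int hm hab (muC_cont hm (Hq_cont S h))).2.symm
end
section
variable {d : ℕ}
lemma Dm_meas (S : MFGSetting d) {p : ℝ × Td d → Vd d} (hp : Measurable p) :
    Measurable fun q : ℝ × Td d => DpH S (secT q.2) (p q) :=
  (DpH_cont S).measurable.comp ((meas_secT.comp measurable_snd).prodMk hp)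
lemma H_int (S : MFGSetting d) {μ : Measure (ℝ × Td d)} [IsFiniteMeasure μ] {p : ℝ × Td d → Vd d} (hp : Measurable p)
    (h2 : MemLp p 2 μ) : Integrable (fun q => S.H (secT q.2) (p q)) μ := by
  obtain ⟨c, C, hc, hC, h, h', -⟩ := H_quad S
  refine Integrable.mono' (g := fun q => C * (1 + sqnorm (p q))) (((integrable_const 1).add (sq_int h2)).const_mul C)
    ((H_cont S).measurable.comp ((meas_secT.comp measurable_snd).prodMk hp)).aestronglyMeasurable (Eventually.of_forall fun q => ?_)
  have e1 := h (secT q.2) (p q)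
  have e2 := mul_nonneg hC.le (sqnorm_nonneg (p q))
  have e3 := mul_nonneg hc.le (sqnorm_nonneg (p q))
  exact abs_le.2 ⟨by linarith, h' _ _⟩
lemma Hs_int (S : MFGSetting d) {μ : Measure (ℝ × Td d)} [IsFiniteMeasure μ] {p : ℝ × Td d → Vd d} (hp : Measurable p)
    (h2 : MemLp p 2 μ) : Integrable (fun q => S.Hstar (secT q.2) (p q)) μ := by
  obtain ⟨C, hC, h, h'⟩ := Hstar_le S
  refine Integrable.mono' (g := fun q => C * (1 + sqnorm (p q))) (((integrable_const 1).add (sq_int h2)).const_mul C)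
    ((Hstar_meas S).comp ((meas_secT.comp measurable_snd).prodMk hp)).aestronglyMeasurable (Eventually.of_forall fun q => ?_)
  have e1 := h' (secT q.2) (p q)
  have e2 := mul_nonneg hC.le (sqnorm_nonneg (p q))
  exact abs_le.2 ⟨by linarith, h _ _⟩
lemma H_mid (S : MFGSetting d) (x p q : Vd d) :
    S.H x ((1/2:ℝ) • p + (1/2:ℝ) • q) + S.Cbar⁻¹ / 8 * sqnorm (p - q) ≤ (S.H x p + S.H x q) / 2 := by
  have h1 := H_lower S x ((1/2:ℝ) • p + (1/2:ℝ) • q) ((1/2:ℝ) • (p - q))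
  have h2 := H_lower S x ((1/2:ℝ) • p + (1/2:ℝ) • q) ((-(1/2):ℝ) • (p - q))
  rw [sqnorm_smul, dotp_smul_right] at h1 h2
  have e1 : (1/2:ℝ) • p + (1/2:ℝ) • q + (1/2:ℝ) • (p - q) = p := by ext i; simp; ring
  have e2 : (1/2:ℝ) • p + (1/2:ℝ) • q + (-(1/2):ℝ) • (p - q) = q := by ext i; simp; ring
  rw [e1] at h1; rw [e2] at h2
  linarith
lemma H_var (S : MFGSetting d) (x p G g : Vd d) (t : ℝ) : S.H x (G + t • g) - S.H x G ≤
    t * dotp (DpH S x p) g + S.Cbar * sqnorm (G - p) + S.Cbar * t ^ 2 * sqnorm g := by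
  have h1 := H_upper S x p (G - p + t • g)
  have h2 := H_lower S x p (G - p)
  have h3 := sqnorm_add_le (G - p) (t • g)
  have e1 : p + (G - p + t • g) = G + t • g := by abel
  have e2 : p + (G - p) = G := by abel
  rw [e1, dotp_add_right, dotp_smul_right] at h1
  rw [e2] at h2
  rw [sqnorm_smul] at h3
  have h4 := mul_nonneg (inv_pos.2 S.Cbar_pos).le (sqnorm_nonneg (G - p))
  have h5 := mlL h3 S.Cbar_pos.le
  linarith
lemma H_cst (S : MFGSetting d) (x p G : Vd d) : S.Hstar x (DpH S x p) - S.Cbar / 2 * sqnorm (G - p) ≤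
    dotp (DpH S x p) G - S.H x G := by
  have h1 := H_upper S x p (G - p)
  have e2 : p + (G - p) = G := by abel
  rw [e2, dotp_sub_right] at h1
  rw [Hstar_DpH]; linarith
lemma MemLp_sub2 {X : Type*} [MeasurableSpace X] {μ : Measure X} {f g : X → Vd d} (hf : MemLp f 2 μ) (hg : MemLp g 2 μ) :
    Integrable (fun q => sqnorm (f q - g q)) μ := sq_int (hf.sub hg)
lemma realize0 (S : MFGSetting d) {m : ℝ → PTd d} (hm : Continuous m) {a b A : ℝ} (hab : a ≤ b) (h : RelC S a b m A) :
    ∃ α : ℝ × Td d → Vd d, Measurable α ∧ MemLp α 2 (muC hm a b) ∧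
      (∀ φ, IsTestFun φ → Jf a b m φ = ∫ q, dotp (α q) (Gf φ q) ∂(muC hm a b)) ∧
      ∫ q, S.Hstar (secT q.2) (α q) ∂(muC hm a b) ≤ A := by
  set μ := muC hm a b with hμ
  have hG : ∀ {φ}, IsTestFun φ → MemLp (Gf φ) 2 μ := fun hφ => muC_memLp hm (Gf_cont hφ)
  have hHi : ∀ {φ}, IsTestFun φ → Integrable (fun q : ℝ × Td d => S.H (secT q.2) (Gf φ q)) μ := fun hφ => muC_cont hm (Hq_cont S hφ)
  set T : Set ℝ := range fun φ : {φ : ℝ → Vd d → ℝ // IsTestFun φ} => Jf a b m φ.1 - ∫ q, S.H (secT q.2) (Gf φ.1 q) ∂μ with hT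
  have hTb : ∀ r ∈ T, r ≤ A := by
    rintro _ ⟨φ, rfl⟩
    have := h.2 φ.1 φ.2
    rwa [Hf_eq S hm hab φ.2] at this
  have h0 : IsTestFun (fun _ _ => 0 : ℝ → Vd d → ℝ) := ⟨contDiff_const, fun _ _ _ => rfl⟩
  have hTn : T.Nonempty := ⟨_, ⟨⟨_, h0⟩, rfl⟩⟩
  set M := sSup T with hM
  have hMA : M ≤ A := csSup_le hTn hTb
  have hMt : ∀ φ, IsTestFun φ → Jf a b m φ - ∫ q, S.H (secT q.2) (Gf φ q) ∂μ ≤ M := fun φ hφ => le_csSup ⟨A, hTb⟩ ⟨⟨φ, hφ⟩, rfl⟩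
  have hex : ∀ n : ℕ, ∃ φ, IsTestFun φ ∧ M - 1 / ((n:ℝ) + 1) < Jf a b m φ - ∫ q, S.H (secT q.2) (Gf φ q) ∂μ := fun n => by
    obtain ⟨_, ⟨φ, rfl⟩, hh⟩ := exists_lt_of_lt_csSup hTn (sub_lt_self M (Nat.one_div_pos_of_nat (n := n)))
    exact ⟨φ.1, φ.2, hh⟩
  choose φ hφ hφM using hex
  have hCp := S.Cbar_pos
  have hmid : ∀ n k, ∫ q, sqnorm (Gf (φ n) q - Gf (φ k) q) ∂μ ≤ 4 * S.Cbar * (1 / ((n:ℝ) + 1) + 1 / ((k:ℝ) + 1)) := by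
    intro n k
    have e1 := hMt _ (test_lin (hφ n) (hφ k) (1/2) (1/2))
    rw [Jf_lin hm (hφ n) (hφ k)] at e1
    simp only [Gf_lin (hφ n) (hφ k)] at e1
    have hi : Integrable (fun q : ℝ × Td d => S.H (secT q.2) ((1/2:ℝ) • Gf (φ n) q + (1/2:ℝ) • Gf (φ k) q)) μ := by
      simpa only [Gf_lin (hφ n) (hφ k)] using hHi (test_lin (hφ n) (hφ k) (1/2) (1/2))
    have hs := MemLp_sub2 (hG (hφ n)) (hG (hφ k))
    have e2 := integral_mono (hi.add (hs.const_mul (S.Cbar⁻¹ / 8))) (((hHi (hφ n)).add (hHi (hφ k))).div_const 2)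
      (fun q => H_mid S (secT q.2) (Gf (φ n) q) (Gf (φ k) q))
    simp only [Pi.add_apply] at e2
    rw [integral_add hi (hs.const_mul _), integral_div, integral_add (hHi (hφ n)) (hHi (hφ k)), integral_const_mul] at e2
    have e3 := hφM n
    have e4 := hφM k
    have e5 : S.Cbar⁻¹ / 8 * ∫ q, sqnorm (Gf (φ n) q - Gf (φ k) q) ∂μ ≤ (1 / ((n:ℝ) + 1) + 1 / ((k:ℝ) + 1)) / 2 := by linarith
    have e6 := mlL e5 (by positivity : 0 ≤ 8 * S.Cbar)
    have e7 : 8 * S.Cbar * (S.Cbar⁻¹ / 8 * ∫ q, sqnorm (Gf (φ n) q - Gf (φ k) q) ∂μ) = ∫ q, sqnorm (Gf (φ n) q - Gf (φ k) q) ∂μ := by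
      field_simp
    rw [e7] at e6
    linarith
  have hε : Tendsto (fun n : ℕ => 1 / ((n:ℝ) + 1)) atTop (𝓝 0) := tendsto_one_div_add_atTop_nhds_zero_nat
  obtain ⟨p, hpm, hp2, hpt⟩ := L2_complete (fun n => hG (hφ n)) (by
    intro ε he
    obtain ⟨N, hN⟩ := exists_nat_one_div_lt (show 0 < ε / (8 * S.Cbar) by positivity)
    refine ⟨N, fun n hn k hk => (hmid n k).trans ?_⟩
    have g1 := (Nat.one_div_le_one_div (α := ℝ) hn).trans hN.le
    have g2 := (Nat.one_div_le_one_div (α := ℝ) hk).trans hN.le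
    have := mlL (add_le_add g1 g2) (by positivity : 0 ≤ 4 * S.Cbar)
    have e : 4 * S.Cbar * (ε / (8 * S.Cbar) + ε / (8 * S.Cbar)) = ε := by field_simp; ring
    linarith)
  set α : ℝ × Td d → Vd d := fun q => DpH S (secT q.2) (p q) with hα
  have hαm : Measurable α := Dm_meas S hpm
  have hα2 : MemLp α 2 μ := by
    obtain ⟨c, C, hc, hC, -, -, h'⟩ := H_quad S
    refine memLp_of_sq hαm.aestronglyMeasurable (Integrable.mono' (g := fun q => C * (1 + sqnorm (p q)))
      (((integrable_const 1).add (sq_int hp2)).const_mul C) (sqnorm_smooth.continuous.measurable.comp hαm).aestronglyMeasurable (Eventually.of_forall fun q => ?_))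
    rw [Real.norm_of_nonneg (sqnorm_nonneg _)]; exact h' _ _
  have hηi : ∀ n, Integrable (fun q => sqnorm (Gf (φ n) q - p q)) μ := fun n => MemLp_sub2 (hG (hφ n)) hp2
  have hJ : ∀ ψ, IsTestFun ψ → Jf a b m ψ = ∫ q, dotp (α q) (Gf ψ q) ∂μ := by
    intro ψ hψ
    have hdi := dot_int hα2 (hG hψ)
    have hqi := sq_int (hG hψ)
    set Q := ∫ q, sqnorm (Gf ψ q) ∂μ
    have key : ∀ t : ℝ, t * (Jf a b m ψ - ∫ q, dotp (α q) (Gf ψ q) ∂μ) ≤ S.Cbar * t ^ 2 * Q := by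
      intro t
      refine ge_of_tendsto' (x := atTop) (f := fun n : ℕ => S.Cbar * t ^ 2 * Q + (1 / ((n:ℝ) + 1) + S.Cbar * ∫ q, sqnorm (Gf (φ n) q - p q) ∂μ))
        (by simpa using (tendsto_const_nhds (x := S.Cbar * t ^ 2 * Q)).add (hε.add (hpt.const_mul S.Cbar))) fun n => ?_
      have e1 := hMt _ (test_lin (hφ n) hψ 1 t)
      rw [Jf_lin hm (hφ n) hψ] at e1
      have hi := hHi (test_lin (hφ n) hψ 1 t)
      simp only [Gf_lin (hφ n) hψ, one_smul] at e1 hi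
      have e2 := integral_mono (hi.sub (hHi (hφ n))) (((hdi.const_mul t).add ((hηi n).const_mul S.Cbar)).add (hqi.const_mul (S.Cbar * t ^ 2)))
        (fun q => H_var S (secT q.2) (p q) (Gf (φ n) q) (Gf ψ q) t)
      simp only [Pi.add_apply, Pi.sub_apply] at e2
      have i1 : Integrable (fun q => t * dotp (α q) (Gf ψ q) + S.Cbar * sqnorm (Gf (φ n) q - p q)) μ := (hdi.const_mul t).add ((hηi n).const_mul S.Cbar)
      rw [integral_sub hi (hHi (hφ n)), integral_add i1 (hqi.const_mul (S.Cbar * t ^ 2)),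
        integral_add (hdi.const_mul t) ((hηi n).const_mul S.Cbar), integral_const_mul, integral_const_mul, integral_const_mul] at e2
      have e3 := hφM n
      linarith
    have hQ : 0 ≤ Q := integral_nonneg fun q => sqnorm_nonneg _
    set D := Jf a b m ψ - ∫ q, dotp (α q) (Gf ψ q) ∂μ with hD
    have hK : 0 < S.Cbar * Q + 1 := by positivity
    have e := key (D / (S.Cbar * Q + 1))
    have e' : D ^ 2 ≤ 0 := by
      have e4 := mlL e (by positivity : 0 ≤ (S.Cbar * Q + 1) ^ 2)
      have e5 : (S.Cbar * Q + 1) ^ 2 * (D / (S.Cbar * Q + 1) * D) = (S.Cbar * Q + 1) * D ^ 2 := by field_simp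
      have e6 : (S.Cbar * Q + 1) ^ 2 * (S.Cbar * (D / (S.Cbar * Q + 1)) ^ 2 * Q) = S.Cbar * Q * D ^ 2 := by field_simp
      rw [e5, e6] at e4
      linarith
    have : D = 0 := by nlinarith [sq_nonneg D]
    linarith
  refine ⟨α, hαm, hα2, hJ, ?_⟩
  refine ge_of_tendsto' (x := atTop) (f := fun n : ℕ => A + S.Cbar / 2 * ∫ q, sqnorm (Gf (φ n) q - p q) ∂μ)
    (by simpa using (tendsto_const_nhds (x := A)).add (hpt.const_mul (S.Cbar / 2))) fun n => ?_
  have hi1 := Hs_int S hαm hα2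
  have e2 := integral_mono (hi1.sub ((hηi n).const_mul (S.Cbar / 2))) ((dot_int hα2 (hG (hφ n))).sub (hHi (hφ n)))
    (fun q => H_cst S (secT q.2) (p q) (Gf (φ n) q))
  simp only [Pi.sub_apply] at e2
  rw [integral_sub hi1 ((hηi n).const_mul _), integral_sub (dot_int hα2 (hG (hφ n))) (hHi (hφ n)), integral_const_mul, ← hJ _ (hφ n)] at e2
  have e3 := hMt _ (hφ n)
  linarith
end
section
variable {d : ℕ}
def hst (S : MFGSetting d) (m : ℝ → PTd d) (α : ℝ → Td d → Vd d) (s : ℝ) : ℝ :=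
  ∫ y, S.Hstar (secT y) (α s y) ∂(m s : Measure (Td d))
def Rlz (a b : ℝ) (m : ℝ → PTd d) (α : ℝ → Td d → Vd d) : Prop :=
  (∀ s₁ s₂ : ℝ, a ≤ s₁ → s₁ ≤ s₂ → s₂ ≤ b → FPeq 1 m α s₁ s₂) ∧
  Measurable (fun q : ℝ × Td d => α q.1 q.2) ∧
  (∫⁻ s in Ioc a b, ∫⁻ y, ENNReal.ofReal (sqnorm (α s y)) ∂(m s : Measure (Td d))) < ⊤
section
variable {m : ℝ → PTd d} (hm : Continuous m) {a b : ℝ} {α : ℝ → Td d → Vd d}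
lemma Rlz_memLp (h : Rlz a b m α) : MemLp (fun q : ℝ × Td d => α q.1 q.2) 2 (muC hm a b) := by
  refine memLp_of_sq h.2.1.aestronglyMeasurable ?_
  have hq : Measurable fun q : ℝ × Td d => sqnorm (α q.1 q.2) := sqnorm_smooth.continuous.measurable.comp h.2.1
  refine ⟨hq.aestronglyMeasurable, ?_⟩
  rw [hasFiniteIntegral_iff_ofReal (Eventually.of_forall fun q => sqnorm_nonneg _), muC_lint hm (f := fun q => ENNReal.ofReal (sqnorm (α q.1 q.2))) (ENNReal.measurable_ofReal.comp hq)]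
  exact h.2.2
lemma hst_int {S : MFGSetting d} (hab : a ≤ b) (hαm : Measurable fun q : ℝ × Td d => α q.1 q.2)
    (h2 : MemLp (fun q : ℝ × Td d => α q.1 q.2) 2 (muC hm a b)) : IntervalIntegrable (hst S m α) volume a b ∧
    ∫ s in a..b, hst S m α s = ∫ q, S.Hstar (secT q.2) (α q.1 q.2) ∂(muC hm a b) := by
  have := muC_int hm hab (Hs_int S hαm h2)
  exact ⟨this.1, this.2.symm⟩
lemma zt_test {φ : ℝ → Vd d → ℝ} (h : IsTestFun φ) {ζ : ℝ → ℝ} (hζ : ContDiff ℝ 2 ζ) : IsTestFun fun s x => ζ s * φ s x :=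
  ⟨(hζ.comp contDiff_fst).mul h.1, fun t x z => by simp only [h.2]⟩
lemma zt_opL {φ : ℝ → Vd d → ℝ} (h : IsTestFun φ) {ζ : ℝ → ℝ} (hζ : ContDiff ℝ 2 ζ) (s : ℝ) (x : Vd d) :
    opL (fun s x => ζ s * φ s x) s x = deriv ζ s * φ s x + ζ s * opL φ s x := by
  have h1 : HasDerivAt (fun s => ζ s * φ s x) _ s := ((hζ.differentiable (by norm_num)) s).hasDerivAt.mul (test_t h s x)
  have h2 := congrFun (smul_opL h (ζ s) s) x
  have h3 : tderiv (fun s' x => ζ s * φ s' x) s x = ζ s * tderiv φ s x := by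
    rw [test_t' h]; exact ((test_t h s x).const_mul (ζ s)).deriv
  have h4 : tderiv (fun s x => ζ s * φ s x) s x = deriv ζ s * φ s x + ζ s * tderiv φ s x := by
    rw [test_t' h]; exact h1.deriv
  unfold opL at h2 ⊢
  rw [h3] at h2
  rw [h4]; linarith
lemma FP_dubois (hab : a ≤ b) (hαm : Measurable fun q : ℝ × Td d => α q.1 q.2)
    (h2 : MemLp (fun q : ℝ × Td d => α q.1 q.2) 2 (muC hm a b))
    (hJ : ∀ φ, IsTestFun φ → Jf a b m φ = ∫ q, dotp (α q.1 q.2) (Gf φ q) ∂(muC hm a b))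
    {φ : ℝ → Vd d → ℝ} (hφ : IsTestFun φ) : ∀ t ∈ Icc a b, iT (m t) (φ t) - iT (m a) (φ a) =
      ∫ s in a..t, ∫ y, (opL φ s (secT y) - dotp (α s y) (Gf φ (s, y))) ∂(m s : Measure (Td d)) := by
  have hG : ∀ {φ}, IsTestFun φ → MemLp (Gf φ) 2 (muC hm a b) := fun hφ => muC_memLp hm (Gf_cont hφ)
  have hoc : Continuous fun q : ℝ × Td d => opL φ q.1 (secT q.2) := cont_sec (opL_cont hφ) (opL_per hφ)
  have hk : Integrable (fun q : ℝ × Td d => opL φ q.1 (secT q.2) - dotp (α q.1 q.2) (Gf φ q)) (muC hm a b) :=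
    (muC_cont hm hoc).sub (dot_int h2 (hG hφ))
  have hg := iT_cont hm (test_cont hφ) (test_per hφ)
  refine dubois hab hg (muC_int hm hab hk).1 fun ζ hζ => ?_
  have hz := zt_test hφ hζ
  have hGz : ∀ q, Gf (fun s x => ζ s * φ s x) q = ζ q.1 • Gf φ q := fun q => smul_grad hφ (ζ q.1) q.1 _
  have hd : Integrable (fun q : ℝ × Td d => dotp (α q.1 q.2) (Gf (fun s x => ζ s * φ s x) q)) (muC hm a b) := dot_int h2 (hG hz)
  have hzo : Continuous fun q : ℝ × Td d => ζ q.1 * opL φ q.1 (secT q.2) := (hζ.continuous.comp continuous_fst).mul hoc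
  have hi : Integrable (fun q : ℝ × Td d => ζ q.1 * (opL φ q.1 (secT q.2) - dotp (α q.1 q.2) (Gf φ q))) (muC hm a b) := by
    refine ((muC_cont hm hzo).sub hd).congr (Eventually.of_forall fun q => ?_)
    simp only [Pi.sub_apply, hGz, dotp_smul_right]; ring
  have e1 := (muC_int hm hab hi)
  have e2 : ∫ q, ζ q.1 * (opL φ q.1 (secT q.2) - dotp (α q.1 q.2) (Gf φ q)) ∂(muC hm a b) =
      (∫ q : ℝ × Td d, ζ q.1 * opL φ q.1 (secT q.2) ∂(muC hm a b)) - Jf a b m (fun s x => ζ s * φ s x) := by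
    rw [hJ _ hz, ← integral_sub (muC_cont hm hzo) hd]
    refine integral_congr_ae (Eventually.of_forall fun q => ?_)
    simp only [hGz, dotp_smul_right]; ring
  rw [e1.2, (muC_int hm hab (muC_cont hm hzo)).2] at e2
  simp only [integral_const_mul] at e2 e1
  have hdz : Continuous (deriv ζ) := hζ.continuous_deriv (by norm_num)
  have hoi := iT_cont hm (opL_cont hφ) (opL_per hφ)
  have c1 : Continuous fun s => deriv ζ s * iT (m s) (φ s) := hdz.mul hg
  have c2 : Continuous fun s => ζ s * iT (m s) (opL φ s) := hζ.continuous.mul hoi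
  have e3 : Jf a b m (fun s x => ζ s * φ s x) = ζ a * iT (m a) (φ a) - ζ b * iT (m b) (φ b) +
      ((∫ s in a..b, deriv ζ s * iT (m s) (φ s)) + ∫ s in a..b, ζ s * iT (m s) (opL φ s)) := by
    rw [← ci_add c1 c2]
    unfold Jf
    congr 1
    · rw [iT_mul, iT_mul]
    · refine intervalIntegral.integral_congr fun s _ => ?_
      rw [show opL (fun s x => ζ s * φ s x) s = fun x => deriv ζ s * φ s x + ζ s * opL φ s x from funext fun x => zt_opL hφ hζ s x,
        iT_lin (test_CP hφ s) (CP_of (opL_cont hφ) (opL_per hφ) s)]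
  have e4 : ∫ s in a..b, ζ s * ∫ y, opL φ s (secT y) ∂(m s : Measure (Td d)) = ∫ s in a..b, ζ s * iT (m s) (opL φ s) := rfl
  rw [e4] at e2
  rw [intervalIntegral.integral_add (c1.intervalIntegrable a b) e1.1]
  linarith
lemma realize (S : MFGSetting d) {A : ℝ} (hab : a ≤ b) (h : RelC S a b m A) :
    ∃ α, Rlz a b m α ∧ ∫ s in a..b, hst S m α s ≤ A := by
  obtain ⟨β, hβm, hβ2, hJ, hA⟩ := realize0 S h.1 hab h
  refine ⟨fun s y => β (s, y), ⟨?_, hβm, ?_⟩, ?_⟩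
  · intro s₁ s₂ h1 h12 h2 φ hφ
    have hk : IntervalIntegrable (fun s => ∫ y, (opL φ s (secT y) - dotp (β (s, y)) (Gf φ (s, y))) ∂(m s : Measure (Td d))) volume a b :=
      (muC_int h.1 hab (((muC_cont h.1 (cont_sec (opL_cont hφ) (opL_per hφ))).sub (dot_int hβ2 (muC_memLp h.1 (Gf_cont hφ)))))).1
    have e1 := FP_dubois h.1 (α := fun s y => β (s, y)) hab hβm hβ2 hJ hφ s₁ ⟨h1, h12.trans h2⟩
    have e2 := FP_dubois h.1 (α := fun s y => β (s, y)) hab hβm hβ2 hJ hφ s₂ ⟨h1.trans h12, h2⟩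
    have i1 := hk.mono_set (c := a) (d := s₁) (by rw [uIcc_of_le hab, uIcc_of_le h1]; exact Icc_subset_Icc_right (h12.trans h2))
    have i2 := hk.mono_set (c := s₁) (d := s₂) (by rw [uIcc_of_le hab, uIcc_of_le h12]; exact Icc_subset_Icc h1 h2)
    have e3 := intervalIntegral.integral_add_adjacent_intervals i1 i2
    simp only [one_mul]
    have e4 : iT (m s₂) (φ s₂) - iT (m s₁) (φ s₁) = ∫ s in s₁..s₂, ∫ y, (opL φ s (secT y) - dotp (β (s, y)) (Gf φ (s, y))) ∂(m s : Measure (Td d)) := by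
      linarith
    exact e4
  · have hq : Measurable fun q : ℝ × Td d => ENNReal.ofReal (sqnorm (β q)) := ENNReal.measurable_ofReal.comp (sqnorm_smooth.continuous.measurable.comp hβm)
    rw [← muC_lint h.1 hq]
    exact (hasFiniteIntegral_iff_ofReal (Eventually.of_forall fun q => sqnorm_nonneg _)).1 (sq_int hβ2).2
  · rw [(hst_int h.1 (α := fun s y => β (s, y)) hab hβm hβ2).2]; exact hA
lemma Rlz_sub (h : Rlz a b m α) {a' b' : ℝ} (h1 : a ≤ a') (h2 : b' ≤ b) : Rlz a' b' m α :=
  ⟨fun s₁ s₂ g1 g2 g3 => h.1 s₁ s₂ (h1.trans g1) g2 (g3.trans h2), h.2.1,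
    (lintegral_mono_set (Ioc_subset_Ioc h1 h2)).trans_lt h.2.2⟩
include hm
lemma Rlz_hst {S : MFGSetting d} (hab : a ≤ b) (h : Rlz a b m α) : IntervalIntegrable (hst S m α) volume a b :=
  (hst_int hm hab h.2.1 (Rlz_memLp hm h)).1
lemma Rlz_rel {S : MFGSetting d} (hab : a ≤ b) (h : Rlz a b m α) : RelC S a b m (∫ s in a..b, hst S m α s) := by
  refine ⟨hm, fun φ hφ => ?_⟩
  have h2 := Rlz_memLp hm h
  have hG : MemLp (Gf φ) 2 (muC hm a b) := muC_memLp hm (Gf_cont hφ)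
  have hoc : Continuous fun q : ℝ × Td d => opL φ q.1 (secT q.2) := cont_sec (opL_cont hφ) (opL_per hφ)
  have e1 := h.1 a b le_rfl hab le_rfl φ hφ
  simp only [one_mul] at e1
  have e1' : iT (m b) (φ b) - iT (m a) (φ a) = ∫ s in a..b, ∫ y, (opL φ s (secT y) - dotp (α s y) (Gf φ (s, y))) ∂(m s : Measure (Td d)) := e1
  have hd := dot_int h2 hG
  have e2 := (muC_int hm hab ((muC_cont hm hoc).sub hd)).2
  have e3 := (muC_int hm hab (muC_cont hm hoc)).2
  simp only [Pi.sub_apply] at e2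
  rw [integral_sub (muC_cont hm hoc) hd] at e2
  have e4 : ∫ s in a..b, ∫ y, opL φ s (secT y) ∂(m s : Measure (Td d)) = ∫ s in a..b, iT (m s) (opL φ s) := rfl
  have hH : Integrable (fun q : ℝ × Td d => S.H (secT q.2) (Gf φ q)) (muC hm a b) := muC_cont hm (Hq_cont S hφ)
  have e5 := integral_mono (hd.sub hH) (Hs_int S h.2.1 h2) (fun q => Hstar_ge S (secT q.2) (α q.1 q.2) (Gf φ q))
  simp only [Pi.sub_apply] at e5
  rw [integral_sub hd hH] at e5
  rw [(hst_int hm hab h.2.1 h2).2, Hf_eq S hm hab hφ]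
  unfold Jf
  linarith
end
end
section
variable {d : ℕ} {m m' : ℝ → PTd d} {a b c t : ℝ} {α α' : ℝ → Td d → Vd d}
lemma FPeq_congr (hab : a ≤ b) (hm : ∀ s ∈ Icc a b, m s = m' s) (hα : ∀ s ∈ Ioc a b, α s = α' s)
    (h : FPeq 1 m α a b) : FPeq 1 m' α' a b := by
  intro φ hφ
  have := h φ hφ
  rw [hm a (left_mem_Icc.2 hab), hm b (right_mem_Icc.2 hab)] at this
  rw [this, intervalIntegral.integral_of_le hab, intervalIntegral.integral_of_le hab]
  refine setIntegral_congr_fun measurableSet_Ioc fun s hs => ?_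
  simp only [hm s (Ioc_subset_Icc_self hs), hα s hs]
lemma Rlz_congr (hm : ∀ s ∈ Icc a b, m s = m' s) (hα : ∀ s ∈ Ioc a b, α s = α' s)
    (hα' : Measurable fun q : ℝ × Td d => α' q.1 q.2) (h : Rlz a b m α) : Rlz a b m' α' := by
  refine ⟨fun s₁ s₂ h1 h12 h2 => FPeq_congr h12 (fun s hs => hm s ⟨h1.trans hs.1, hs.2.trans h2⟩)
    (fun s hs => hα s ⟨h1.trans_lt hs.1, hs.2.trans h2⟩) (h.1 s₁ s₂ h1 h12 h2), hα', lt_of_eq_of_lt ?_ h.2.2⟩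
  refine setLIntegral_congr_fun measurableSet_Ioc fun s hs => ?_
  simp only [hm s (Ioc_subset_Icc_self hs), hα s hs]
lemma FPeq_shift (h : FPeq 1 m α a b) (c : ℝ) : FPeq 1 (fun s => m (s + c)) (fun s => α (s + c)) (a - c) (b - c) := by
  intro φ hφ
  have := h _ (test_shift hφ (-c))
  simp only [tderiv_shift] at this
  simp only [sub_add_cancel]
  simp only [← sub_eq_add_neg] at this
  rw [this, ← intervalIntegral.integral_comp_sub_right _ c]
  simp only [sub_add_cancel]
lemma add_emb (c : ℝ) : MeasurableEmbedding (fun s : ℝ => s + c) := measurableEmbedding_addRight c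
lemma Rlz_shift (h : Rlz a b m α) (c : ℝ) : Rlz (a - c) (b - c) (fun s => m (s + c)) (fun s => α (s + c)) := by
  refine ⟨fun s₁ s₂ h1 h12 h2 => ?_, h.2.1.comp ((measurable_fst.add_const c).prodMk measurable_snd), lt_of_eq_of_lt ?_ h.2.2⟩
  · have := FPeq_shift (h.1 (s₁ + c) (s₂ + c) (by linarith) (by linarith) (by linarith)) c
    simpa using this
  · have := (measurePreserving_add_right volume c).setLIntegral_comp_preimage_emb (add_emb c)
      (fun s => ∫⁻ y, ENNReal.ofReal (sqnorm (α s y)) ∂(m s : Measure (Td d))) (Ioc a b)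
    rw [← this, preimage_add_const_Ioc]
lemma FP_ii (hm : Continuous m) (hab : a ≤ b) (h : Rlz a b m α) {φ : ℝ → Vd d → ℝ} (hφ : IsTestFun φ) :
    IntervalIntegrable (fun s => ∫ y, (tderiv φ s (secT y) + 1 * lapl (φ s) (secT y)
        - dotp (α s y) (gradv (φ s) (secT y))) ∂(m s : Measure (Td d))) volume a b := by
  simp only [one_mul]
  exact (muC_int hm hab (((muC_cont hm (cont_sec (opL_cont hφ) (opL_per hφ))).sub
    (dot_int (Rlz_memLp hm h) (muC_memLp hm (Gf_cont hφ)))))).1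
lemma Rlz_concat (hm : Continuous m) (hab : a ≤ b) (hbc : b ≤ c) (h1 : Rlz a b m α) (h2 : Rlz b c m α) : Rlz a c m α := by
  refine ⟨fun s₁ s₂ g1 g12 g2 => ?_, h1.2.1, ?_⟩
  · rcases le_total s₂ b with h | h
    · exact h1.1 _ _ g1 g12 h
    rcases le_total b s₁ with h' | h'
    · exact h2.1 _ _ h' g12 g2
    · intro φ hφ
      have e1 := h1.1 s₁ b g1 h' le_rfl φ hφ
      have e2 := h2.1 b s₂ le_rfl h g2 φ hφ
      rw [← intervalIntegral.integral_add_adjacent_intervals (FP_ii hm h' (Rlz_sub h1 g1 le_rfl) hφ) (FP_ii hm h (Rlz_sub h2 le_rfl g2) hφ),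
        ← e1, ← e2]
      ring
  · rw [← Ioc_union_Ioc_eq_Ioc hab hbc]
    exact (lintegral_union_le _ _ _).trans_lt (ENNReal.add_lt_top.2 ⟨h1.2.2, h2.2.2⟩)
lemma runCost_eq (S : MFGSetting d) (s : ℝ) : runCost S m α s = hst S m α s + S.Fc (m s) := rfl
lemma Fc_ii (S : MFGSetting d) (hm : Continuous m) (a b : ℝ) : IntervalIntegrable (fun s => S.Fc (m s)) volume a b :=
  ((Fc_cont S).comp hm).intervalIntegrable a b
lemma rc_ii {S : MFGSetting d} (hm : Continuous m) (hab : a ≤ b) (h : Rlz a b m α) :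
    IntervalIntegrable (runCost S m α) volume a b ∧
    ∫ s in a..b, runCost S m α s = (∫ s in a..b, hst S m α s) + ∫ s in a..b, S.Fc (m s) :=
  ⟨(Rlz_hst hm hab h).add (Fc_ii S hm a b), intervalIntegral.integral_add (Rlz_hst hm hab h) (Fc_ii S hm a b)⟩
lemma Adm_of {S : MFGSetting d} (hm : Continuous m) {T : ℝ} (hT : 0 ≤ T) (h : Rlz 0 T m α) : AdmOn S 1 (m 0) T m α :=
  ⟨rfl, W1ContOn_of_cont hm.continuousOn, fun s₁ s₂ => h.1 s₁ s₂, h.2.1, h.2.2, (rc_ii hm hT h).1⟩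
lemma Adm_to {S : MFGSetting d} {T : ℝ} {μ : PTd d} (hT : 0 ≤ T) (h : AdmOn S 1 μ T m α) :
    ∃ m', Continuous m' ∧ (∀ s ∈ Icc 0 T, m s = m' s) ∧ Rlz 0 T m' α := by
  have hc := cont_of_W1ContOn h.2.1
  refine ⟨fun s => m (projIcc 0 T hT s), hc.domRestrict.comp continuous_projIcc, fun s hs => ?_, ?_⟩
  · simp only [projIcc_of_mem hT hs]
  · refine Rlz_congr (fun s hs => ?_) (fun s hs => rfl) h.2.2.2.1 ⟨h.2.2.1, h.2.2.2.1, h.2.2.2.2.1⟩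
    simp only [projIcc_of_mem hT hs]
/-- relaxed pairs from `μ` to `ν` in time `t` with total cost at most `K` -/
def Pth (S : MFGSetting d) (t : ℝ) (μ ν : PTd d) (K : ℝ) : Prop :=
  ∃ m A, RelC S 0 t m A ∧ m 0 = μ ∧ m t = ν ∧ A + ∫ s in (0:ℝ)..t, S.Fc (m s) = K
lemma Pth_of {S : MFGSetting d} {μ : PTd d} (ht : 0 ≤ t) (h : AdmOn S 1 μ t m α) :
    Pth S t μ (m t) (∫ s in (0:ℝ)..t, runCost S m α s) := by
  obtain ⟨m', hm', he, hR⟩ := Adm_to ht h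
  refine ⟨m', _, Rlz_rel (S := S) hm' ht hR, ?_, (he t ⟨ht, le_rfl⟩).symm, ?_⟩
  · rw [← he 0 ⟨le_rfl, ht⟩, h.1]
  · rw [← (rc_ii hm' ht hR).2]
    refine intervalIntegral.integral_congr fun s hs => ?_
    rw [uIcc_of_le ht] at hs
    simp only [runCost, he s hs]
lemma Pth_to {S : MFGSetting d} {μ ν : PTd d} {K : ℝ} (ht : 0 ≤ t) (h : Pth S t μ ν K) :
    ∃ m α, Continuous m ∧ AdmOn S 1 μ t m α ∧ Rlz 0 t m α ∧ m t = ν ∧ ∫ s in (0:ℝ)..t, runCost S m α s ≤ K := by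
  obtain ⟨m, A, h, rfl, rfl, rfl⟩ := h
  obtain ⟨α, hα, hA⟩ := realize S ht h
  refine ⟨m, α, h.1, Adm_of h.1 ht hα, hα, rfl, ?_⟩
  rw [(rc_ii h.1 ht hα).2]; linarith
lemma Disc_to {S : MFGSetting d} {δ : ℝ} (hδ : 0 < δ) {μ : PTd d} (h : AdmDisc S 1 δ μ m α) :
    ∃ m', Continuous m' ∧ (∀ s, 0 ≤ s → m s = m' s) ∧ (∀ T, Rlz 0 T m' α) := by
  have hc := cont_of_W1ContOn h.2.1
  refine ⟨fun s => m (max 0 s), hc.comp_continuous (by fun_prop) (fun s => mem_Ici.2 (le_max_left _ _)), fun s hs => by simp [hs], fun T => ?_⟩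
  refine Rlz_congr (m := m) (fun s hs => by simp [hs.1]) (fun s hs => rfl) h.2.2.2.1 ⟨fun s₁ s₂ h1 h2 _ => h.2.2.1 s₁ s₂ h1 h2, h.2.2.2.1, ?_⟩
  have h5 := h.2.2.2.2.1
  have : ∀ s ∈ Ioc 0 T, (∫⁻ y, ENNReal.ofReal (sqnorm (α s y)) ∂(m s : Measure (Td d))) ≤
      ENNReal.ofReal (exp (δ * T)) * (ENNReal.ofReal (exp (-δ * s)) * ∫⁻ y, ENNReal.ofReal (sqnorm (α s y)) ∂(m s : Measure (Td d))) := by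
    intro s hs
    rw [← mul_assoc, ← ENNReal.ofReal_mul (exp_pos _).le, ← exp_add]
    refine le_mul_of_one_le_left' ?_
    rw [ENNReal.one_le_ofReal]
    refine one_le_exp ?_
    nlinarith [hs.2]
  refine (setLIntegral_mono' measurableSet_Ioc this).trans_lt ?_
  rw [lintegral_const_mul' _ _ ENNReal.ofReal_ne_top]
  exact ENNReal.mul_lt_top ENNReal.ofReal_lt_top ((lintegral_mono_set Ioc_subset_Ioi_self).trans_lt h5)
end
section
variable {d : ℕ} {m m' : ℝ → PTd d} {α α' : ℝ → Td d → Vd d} {δ t : ℝ}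
lemma sh_pre (t : ℝ) : (fun s : ℝ => s + t) ⁻¹' Ioi t = Ioi 0 := by
  simp [preimage_add_const_Ioi]
lemma sh_int (g : ℝ → ℝ) (t : ℝ) : ∫ s in Ioi t, g s = ∫ s in Ioi 0, g (s + t) := by
  rw [← sh_pre t]; exact ((measurePreserving_add_right volume t).setIntegral_preimage_emb (add_emb t) g (Ioi t)).symm
lemma sh_io (g : ℝ → ℝ) (t : ℝ) : IntegrableOn g (Ioi t) ↔ IntegrableOn (fun s => g (s + t)) (Ioi 0) := by
  rw [← sh_pre t]; exact ((measurePreserving_add_right volume t).integrableOn_comp_preimage (add_emb t)).symm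
lemma sh_lint (g : ℝ → ℝ≥0∞) (t : ℝ) : ∫⁻ s in Ioi t, g s = ∫⁻ s in Ioi 0, g (s + t) := by
  rw [← sh_pre t]; exact ((measurePreserving_add_right volume t).setLIntegral_comp_preimage_emb (add_emb t) g (Ioi t)).symm
/-- discounted splitting -/
lemma disc_split {r : ℝ → ℝ} (ht : 0 ≤ t) (h : IntegrableOn (fun s => exp (-δ * s) * r s) (Ioi 0)) :
    IntegrableOn (fun s => exp (-δ * s) * r (s + t)) (Ioi 0) ∧
    ∫ s in Ioi 0, exp (-δ * s) * r s = (∫ s in (0:ℝ)..t, exp (-δ * s) * r s) +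
      exp (-δ * t) * ∫ s in Ioi 0, exp (-δ * s) * r (s + t) := by
  have h2 : IntegrableOn (fun s => exp (-δ * s) * r s) (Ioi t) := h.mono_set (Ioi_subset_Ioi ht)
  have h1 : IntegrableOn (fun s => exp (-δ * s) * r s) (Ioc 0 t) := h.mono_set Ioc_subset_Ioi_self
  have e : ∀ s, exp (-δ * (s + t)) * r (s + t) = exp (-δ * t) * (exp (-δ * s) * r (s + t)) := fun s => by
    rw [mul_add, exp_add]; ring
  constructor
  · have := (sh_io _ t).1 h2
    simp only [e] at this
    have := this.const_mul (exp (-δ * t))⁻¹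
    refine this.congr (ae_of_all _ fun s => ?_)
    simp only []
    rw [← mul_assoc, inv_mul_cancel₀ (exp_pos _).ne', one_mul]
  · rw [← Ioc_union_Ioi_eq_Ioi ht, setIntegral_union (Ioc_disjoint_Ioi le_rfl) measurableSet_Ioi h1 h2, sh_int,
      intervalIntegral.integral_of_le ht, Ioc_union_Ioi_eq_Ioi ht]
    simp only [e, integral_const_mul]
lemma disc_glue {r : ℝ → ℝ} (ht : 0 ≤ t) (h1 : IntegrableOn (fun s => exp (-δ * s) * r s) (Ioc 0 t))
    (h2 : IntegrableOn (fun s => exp (-δ * s) * r (s + t)) (Ioi 0)) : IntegrableOn (fun s => exp (-δ * s) * r s) (Ioi 0) := by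
  rw [← Ioc_union_Ioi_eq_Ioi ht]
  refine h1.union ((sh_io _ t).2 ?_)
  refine (h2.const_mul (exp (-δ * t))).congr (ae_of_all _ fun s => ?_)
  simp only [mul_add, exp_add]; ring
def lq (m : ℝ → PTd d) (α : ℝ → Td d → Vd d) (s : ℝ) : ℝ≥0∞ := ∫⁻ y, ENNReal.ofReal (sqnorm (α s y)) ∂(m s : Measure (Td d))
def Dsc (S : MFGSetting d) (δ : ℝ) (m : ℝ → PTd d) (α : ℝ → Td d → Vd d) : Prop :=
  Continuous m ∧ (∀ T, Rlz 0 T m α) ∧ (∫⁻ s in Ioi (0:ℝ), ENNReal.ofReal (exp (-δ * s)) * lq m α s) < ⊤ ∧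
  IntegrableOn (fun s => exp (-δ * s) * runCost S m α s) (Ioi 0)
variable {S : MFGSetting d}
lemma Dsc.adm (h : Dsc S δ m α) : AdmDisc S 1 δ (m 0) m α :=
  ⟨rfl, W1ContOn_of_cont h.1.continuousOn, fun s₁ s₂ h0 h12 => (h.2.1 s₂).1 s₁ s₂ h0 h12 le_rfl, (h.2.1 0).2.1, h.2.2.1, h.2.2.2⟩
lemma adm_Dsc (hδ : 0 < δ) {μ : PTd d} (h : AdmDisc S 1 δ μ m α) :
    ∃ m', Dsc S δ m' α ∧ m' 0 = μ ∧ costDisc S δ m α = costDisc S δ m' α := by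
  obtain ⟨m', hm', he, hr⟩ := Disc_to hδ h
  have e1 : EqOn (fun s => exp (-δ * s) * runCost S m α s) (fun s => exp (-δ * s) * runCost S m' α s) (Ioi 0) :=
    fun s hs => by simp only [runCost, he s (le_of_lt hs)]
  refine ⟨m', ⟨hm', hr, ?_, ?_⟩, (he 0 le_rfl).symm.trans h.1, ?_⟩
  · refine lt_of_eq_of_lt (setLIntegral_congr_fun measurableSet_Ioi fun s hs => ?_) h.2.2.2.2.1
    simp only [lq, he s (le_of_lt hs)]
  · exact (integrableOn_congr_fun e1 measurableSet_Ioi).1 h.2.2.2.2.2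
  · exact setIntegral_congr_fun measurableSet_Ioi e1
lemma Dsc.sh (h : Dsc S δ m α) (ht : 0 ≤ t) : Dsc S δ (fun s => m (s + t)) (fun s => α (s + t)) := by
  refine ⟨h.1.comp (by fun_prop), fun T => ?_, ?_, (disc_split ht h.2.2.2).1⟩
  · have := Rlz_shift (Rlz_sub (h.2.1 (T + t)) ht le_rfl) t
    simpa using this
  · have h3 : ∫⁻ s in Ioi t, ENNReal.ofReal (exp (-δ * s)) * lq m α s < ⊤ :=
      (lintegral_mono_set (Ioi_subset_Ioi ht)).trans_lt h.2.2.1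
    rw [sh_lint] at h3
    have e : ∀ s, ENNReal.ofReal (exp (-δ * (s + t))) * lq m α (s + t) =
      ENNReal.ofReal (exp (-δ * t)) * (ENNReal.ofReal (exp (-δ * s)) * lq (fun s => m (s + t)) (fun s => α (s + t)) s) := fun s => by
      rw [mul_add, exp_add, ENNReal.ofReal_mul (exp_pos _).le, mul_comm (ENNReal.ofReal (exp (-δ * s))), mul_assoc]; rfl
    simp only [e] at h3
    rw [lintegral_const_mul' _ _ ENNReal.ofReal_ne_top] at h3
    exact ENNReal.lt_top_of_mul_ne_top_right h3.ne (by simp [exp_pos])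
lemma Dsc.glue (hδ : 0 < δ) (ht : 0 ≤ t) {m₁ : ℝ → PTd d} {α₁ : ℝ → Td d → Vd d} (hm : Continuous m₁) (h1 : Rlz 0 t m₁ α₁)
    (h : Dsc S δ m α) (he : m₁ t = m 0) : ∃ m' α', Dsc S δ m' α' ∧ m' 0 = m₁ 0 ∧
    (∀ s ∈ Ioc 0 t, runCost S m' α' s = runCost S m₁ α₁ s) ∧ ∀ s > 0, runCost S m' α' (s + t) = runCost S m α s := by
  set m' : ℝ → PTd d := fun s => if s ≤ t then m₁ s else m (s - t) with hm'
  set α' : ℝ → Td d → Vd d := fun s => if s ≤ t then α₁ s else α (s - t) with hα'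
  have ea : ∀ s ≤ t, m' s = m₁ s := fun s hs => if_pos hs
  have eb : ∀ s ≤ t, α' s = α₁ s := fun s hs => if_pos hs
  have ec : ∀ s, t ≤ s → m' s = m (s - t) := fun s hs => by
    rcases hs.eq_or_lt with rfl | hs
    · simp [hm', he]
    · exact if_neg (not_le.2 hs)
  have ed : ∀ s, t < s → α' s = α (s - t) := fun s hs => if_neg (not_le.2 hs)
  have hc : Continuous m' := by
    refine Continuous.if_le hm (h.1.comp (by fun_prop)) continuous_id continuous_const fun s hs => ?_
    simp [hs, he]
  have hma : Measurable fun q : ℝ × Td d => α' q.1 q.2 := by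
    have : (fun q : ℝ × Td d => α' q.1 q.2) = fun q => if q.1 ≤ t then α₁ q.1 q.2 else α (q.1 - t) q.2 := by
      funext q; simp only [hα']; split_ifs <;> rfl
    rw [this]
    refine Measurable.ite (measurableSet_le measurable_fst measurable_const) h1.2.1 ?_
    exact (h.2.1 0).2.1.comp (f := fun q : ℝ × Td d => (q.1 - t, q.2)) (by fun_prop)
  have hr1 : Rlz 0 t m' α' := Rlz_congr (fun s hs => (ea s hs.2).symm) (fun s hs => (eb s hs.2).symm) hma h1
  have hr2 : ∀ T, Rlz t (T + t) m' α' := fun T => by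
    have := Rlz_shift (h.2.1 T) (-t)
    simp only [sub_neg_eq_add, zero_add, ← sub_eq_add_neg] at this
    exact Rlz_congr (fun s hs => (ec s hs.1).symm) (fun s hs => (ed s hs.1).symm) hma this
  have hr : ∀ T, Rlz 0 T m' α' := fun T => by
    have : Rlz 0 (|T| + t) m' α' := Rlz_concat hc ht (by linarith [abs_nonneg T]) hr1 (hr2 _)
    exact Rlz_sub this le_rfl (by linarith [le_abs_self T])
  have er1 : ∀ s ∈ Ioc 0 t, runCost S m' α' s = runCost S m₁ α₁ s := fun s hs => by
    simp only [runCost, ea s hs.2, eb s hs.2]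
  have er2 : ∀ s > 0, runCost S m' α' (s + t) = runCost S m α s := fun s hs => by
    simp only [runCost, ec (s + t) (by linarith), ed (s + t) (by linarith), add_sub_cancel_right]
  refine ⟨m', α', ⟨hc, hr, ?_, ?_⟩, ea 0 ht, er1, er2⟩
  · rw [← Ioc_union_Ioi_eq_Ioi ht]
    refine (lintegral_union_le _ _ _).trans_lt (ENNReal.add_lt_top.2 ⟨?_, ?_⟩)
    · refine (setLIntegral_mono' measurableSet_Ioc fun s hs => ?_).trans_lt hr1.2.2
      refine mul_le_of_le_one_left' ?_
      rw [ENNReal.ofReal_le_one, exp_le_one_iff]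
      nlinarith [hs.1]
    · rw [sh_lint]
      have : ∀ s ∈ Ioi (0:ℝ), ENNReal.ofReal (exp (-δ * (s + t))) * lq m' α' (s + t) =
        ENNReal.ofReal (exp (-δ * t)) * (ENNReal.ofReal (exp (-δ * s)) * lq m α s) := fun s hs => by
        rw [mul_add, exp_add, ENNReal.ofReal_mul (exp_pos _).le, mul_comm (ENNReal.ofReal (exp (-δ * s))), mul_assoc]
        simp only [lq, ec (s + t) (by linarith [mem_Ioi.1 hs]), ed (s + t) (by linarith [mem_Ioi.1 hs]), add_sub_cancel_right]
      rw [setLIntegral_congr_fun measurableSet_Ioi this, lintegral_const_mul' _ _ ENNReal.ofReal_ne_top]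
      exact ENNReal.mul_lt_top ENNReal.ofReal_lt_top h.2.2.1
  · refine disc_glue ht ?_ ?_
    · have := ((intervalIntegrable_iff_integrableOn_Ioc_of_le ht).1 (rc_ii (S := S) hc ht hr1).1)
      have := this.bdd_mul (f := fun s => exp (-δ * s)) (c := 1) (by fun_prop) ?_
      · exact this
      · refine (ae_restrict_iff' measurableSet_Ioc).2 (ae_of_all _ fun s hs => ?_)
        rw [norm_eq_abs, abs_of_pos (exp_pos _), exp_le_one_iff]
        nlinarith [hs.1]
    · exact (integrableOn_congr_fun (fun s hs => by simp only [er2 s hs]) measurableSet_Ioi).2 h.2.2.2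
end
section
variable {d : ℕ} {m m' : ℝ → PTd d} {α α' : ℝ → Td d → Vd d} {δ t : ℝ} {S : MFGSetting d}
lemma rc_lb (S : MFGSetting d) : ∃ C0 > 0, ∀ m α s, -C0 ≤ runCost S m α s := by
  obtain ⟨C, hC, -, h2⟩ := Hstar_le S
  obtain ⟨M, hM⟩ := S.Fc_bounded
  refine ⟨C + |M|, by positivity, fun m α s => ?_⟩
  have h3 := (abs_le.1 ((hM (m s)).trans (le_abs_self M))).1
  have h4 : -C ≤ ∫ y, S.Hstar (secT y) (α s y) ∂(m s : Measure (Td d)) := by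
    by_cases hi : Integrable (fun y => S.Hstar (secT y) (α s y)) (m s : Measure (Td d))
    · calc -C = ∫ y, -C ∂(m s : Measure (Td d)) := by simp
        _ ≤ _ := integral_mono (integrable_const _) hi fun y => h2 _ _
    · rw [integral_undef hi]; linarith
  unfold runCost; linarith
lemma heat_Dsc (S : MFGSetting d) (hδ : 0 < δ) (μ : PTd d) : Dsc S δ (heat μ) (fun _ _ => 0) := by
  have hm := heat_cont μ
  have hexp : IntegrableOn (fun s => exp (-δ * s)) (Ioi 0) := integrableOn_exp_mul_Ioi (by linarith) 0
  have z0 : ∀ s, lq (heat μ) (fun _ _ => 0) s = 0 := fun s => by simp [lq, sqnorm]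
  refine ⟨hm, fun T => ⟨fun s₁ s₂ h1 h2 h3 φ hφ => ?_, measurable_const, ?_⟩, ?_, ?_⟩
  · have := heat_J μ hφ h1 h2
    unfold Jf iT opL at this
    simp only [one_mul, dotp, Pi.zero_apply, zero_mul, Finset.sum_const_zero, sub_zero]
    linarith
  · simp [sqnorm]
  · simp [z0]
  · obtain ⟨C, hC, h1, h2⟩ := Hstar_le S
    obtain ⟨M, hM⟩ := S.Fc_bounded
    have hb : ∀ y : Td d, |S.Hstar (secT y) 0| ≤ C := fun y => abs_le.2 ⟨h2 _ _, (h1 _ _).trans (by simp [sqnorm])⟩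
    have hs : Measurable fun y : Td d => S.Hstar (secT y) 0 := (Hstar_meas S).comp (meas_secT.prodMk measurable_const)
    have hr : StronglyMeasurable (runCost S (heat μ) (fun _ _ => 0)) := by
      have a1 : StronglyMeasurable fun s => ∫ y, S.Hstar (secT y) 0 ∂(kap hm s) := hs.stronglyMeasurable.integral_kernel
      have a2 : StronglyMeasurable fun s => S.Fc (heat μ s) := ((Fc_cont S).comp hm).stronglyMeasurable
      exact a1.add a2
    refine Integrable.mul_bdd (c := C + M) hexp hr.aestronglyMeasurable (ae_of_all _ fun s => ?_)
    unfold runCost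
    refine (norm_add_le _ _).trans (add_le_add ?_ (hM _))
    refine (norm_integral_le_of_norm_le_const (C := C) (ae_of_all _ fun y => hb y)).trans (by simp)
def Wd (S : MFGSetting d) (C0 δ : ℝ) (μ : PTd d) : ℝ := Vfun S 1 δ μ + C0 / δ
lemma exp_const (hδ : 0 < δ) (C0 : ℝ) : IntegrableOn (fun s => exp (-δ * s) * C0) (Ioi 0) ∧ ∫ s in Ioi 0, exp (-δ * s) * C0 = C0 / δ := by
  refine ⟨(integrableOn_exp_mul_Ioi (by linarith) 0).mul_const C0, ?_⟩
  rw [integral_mul_const, integral_exp_mul_Ioi (by linarith)]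
  simp; field_simp
lemma cost_eq (hδ : 0 < δ) (C0 : ℝ) (h : Dsc S δ m α) :
    IntegrableOn (fun s => exp (-δ * s) * (runCost S m α s + C0)) (Ioi 0) ∧
    costDisc S δ m α + C0 / δ = ∫ s in Ioi 0, exp (-δ * s) * (runCost S m α s + C0) := by
  simp only [mul_add]
  refine ⟨h.2.2.2.add (exp_const hδ C0).1, ?_⟩
  rw [integral_add h.2.2.2 (exp_const hδ C0).1, (exp_const hδ C0).2]; rfl
lemma Wd_spec {C0 : ℝ} (hC : ∀ (m : ℝ → PTd d) α s, -C0 ≤ runCost S m α s) (hδ : 0 < δ) :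
    (∀ m α, Dsc S δ m α → Wd S C0 δ (m 0) ≤ ∫ s in Ioi 0, exp (-δ * s) * (runCost S m α s + C0)) ∧
    (∀ μ, ∀ ε > 0, ∃ m α, Dsc S δ m α ∧ m 0 = μ ∧ ∫ s in Ioi 0, exp (-δ * s) * (runCost S m α s + C0) ≤ Wd S C0 δ μ + ε) := by
  have hbb : ∀ μ, BddBelow { r | ∃ m α, AdmDisc S 1 δ μ m α ∧ r = costDisc S δ m α } := fun μ => by
    refine ⟨-(C0 / δ), ?_⟩
    rintro r ⟨m, α, h, rfl⟩
    obtain ⟨m', h', -, e⟩ := adm_Dsc hδ h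
    have := (cost_eq hδ C0 h').2
    have h0 : 0 ≤ ∫ s in Ioi 0, exp (-δ * s) * (runCost S m' α s + C0) :=
      integral_nonneg fun s => mul_nonneg (exp_pos _).le (by linarith [hC m' α s])
    rw [e]; linarith
  constructor
  · intro m α h
    rw [← (cost_eq hδ C0 h).2]
    exact add_le_add_left (csInf_le (hbb _) ⟨m, α, h.adm, rfl⟩) _
  · intro μ ε hε
    have hne : { r | ∃ m α, AdmDisc S 1 δ μ m α ∧ r = costDisc S δ m α }.Nonempty := by
      have := (heat_Dsc S hδ μ).adm
      rw [heat_zero] at this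
      exact ⟨_, _, _, this, rfl⟩
    obtain ⟨r, ⟨m, α, h, rfl⟩, hr⟩ := exists_lt_of_csInf_lt hne (lt_add_of_pos_right (Vfun S 1 δ μ) hε)
    obtain ⟨m', h', h0, e⟩ := adm_Dsc hδ h
    refine ⟨m', α, h', h0, ?_⟩
    rw [← (cost_eq hδ C0 h').2, ← e]
    unfold Wd; linarith
lemma DPV (S : MFGSetting d) : ∃ C0 > 0, ∀ δ > 0, ∀ t > 0,
    (∀ μ ν K, Pth S t μ ν K → Wd S C0 δ μ ≤ K + C0 * t + exp (-δ * t) * Wd S C0 δ ν) ∧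
    (∀ μ, ∀ ε > 0, ∃ ν K, Pth S t μ ν K ∧ 0 ≤ K + C0 * t ∧ exp (-δ * t) * (K + C0 * t) + exp (-δ * t) * Wd S C0 δ ν ≤ Wd S C0 δ μ + ε) := by
  obtain ⟨C0, hC0, hC⟩ := rc_lb S
  refine ⟨C0, hC0, fun δ hδ t ht => ⟨fun μ ν K hK => ?_, fun μ ε hε => ?_⟩⟩
  · obtain ⟨m₁, α₁, hm₁, hA, hR, hend, hcost⟩ := Pth_to ht.le hK
    refine le_of_forall_pos_le_add fun ε hε => ?_
    obtain ⟨m, α, hD, h0, hc⟩ := (Wd_spec (S := S) hC hδ).2 ν ε hε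
    obtain ⟨m', α', hD', h0', e1, e2⟩ := hD.glue hδ ht.le hm₁ hR (hend.trans h0.symm)
    have h1 := (Wd_spec (S := S) hC hδ).1 m' α' hD'
    rw [h0', hA.1, (disc_split ht.le (cost_eq hδ C0 hD').1).2] at h1
    have i1 := (rc_ii (S := S) hm₁ ht.le hR).1
    have h2 : ∫ s in (0:ℝ)..t, exp (-δ * s) * (runCost S m' α' s + C0) ≤ ∫ s in (0:ℝ)..t, (runCost S m₁ α₁ s + C0) := by
      refine intervalIntegral.integral_mono_on_of_le_Ioo ht.le ?_ (i1.add intervalIntegrable_const) fun s hs => ?_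
      · rw [intervalIntegrable_iff_integrableOn_Ioc_of_le ht.le]
        exact (cost_eq hδ C0 hD').1.mono_set Ioc_subset_Ioi_self
      · rw [e1 s ⟨hs.1, hs.2.le⟩]
        refine mul_le_of_le_one_left (by linarith [hC m₁ α₁ s]) (exp_le_one_iff.2 ?_)
        nlinarith [hs.1]
    rw [intervalIntegral.integral_add i1 intervalIntegrable_const, intervalIntegral.integral_const] at h2
    have h3 : ∫ s in Ioi 0, exp (-δ * s) * (runCost S m' α' (s + t) + C0) = ∫ s in Ioi 0, exp (-δ * s) * (runCost S m α s + C0) :=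
      setIntegral_congr_fun measurableSet_Ioi fun s hs => by simp only [e2 s hs]
    rw [h3] at h1
    have h4 := mlL hc (exp_pos (-δ * t)).le
    have h5 : exp (-δ * t) ≤ 1 := exp_le_one_iff.2 (by nlinarith)
    simp only [sub_zero, smul_eq_mul] at h2
    nlinarith
  · obtain ⟨m, α, hD, h0, hc⟩ := (Wd_spec (S := S) hC hδ).2 μ ε hε
    have i1 := (rc_ii (S := S) hD.1 ht.le (hD.2.1 t)).1
    have hP := Pth_of ht.le (Adm_of (S := S) hD.1 ht.le (hD.2.1 t))
    rw [h0] at hP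
    have hs := (Wd_spec (S := S) hC hδ).1 _ _ (hD.sh ht.le)
    simp only [zero_add] at hs
    rw [(disc_split ht.le (cost_eq hδ C0 hD).1).2] at hc
    have hK : (∫ s in (0:ℝ)..t, (runCost S m α s + C0)) = (∫ s in (0:ℝ)..t, runCost S m α s) + C0 * t := by
      rw [intervalIntegral.integral_add i1 intervalIntegrable_const, intervalIntegral.integral_const]
      simp [mul_comm]
    refine ⟨_, _, hP, ?_, ?_⟩
    · rw [← hK]
      exact intervalIntegral.integral_nonneg ht.le fun s _ => by linarith [hC m α s]
    · have h2 : exp (-δ * t) * ∫ s in (0:ℝ)..t, (runCost S m α s + C0) ≤ ∫ s in (0:ℝ)..t, exp (-δ * s) * (runCost S m α s + C0) := by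
        rw [← intervalIntegral.integral_const_mul]
        refine intervalIntegral.integral_mono_on_of_le_Ioo ht.le ((i1.add intervalIntegrable_const).const_mul _) ?_ fun s hs => ?_
        · rw [intervalIntegrable_iff_integrableOn_Ioc_of_le ht.le]
          exact (cost_eq hδ C0 hD).1.mono_set Ioc_subset_Ioi_self
        · refine mlR (exp_le_exp.2 ?_) (by linarith [hC m α s])
          nlinarith [hs.2]
      rw [hK] at h2
      have h4 := mlL hs (exp_pos (-δ * t)).le
      have h5 : exp (-δ * t) * ∫ s in Ioi 0, exp (-δ * s) * (runCost S (fun s => m (s + t)) (fun s => α (s + t)) s + C0) =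
        exp (-δ * t) * ∫ s in Ioi 0, exp (-δ * s) * (runCost S m α (s + t) + C0) := rfl
      linarith
end
section
variable {d : ℕ}
def wz (N : ℝ) (x : Vd d) : ℝ := (1 + ‖x‖) ^ (-N)
lemma wz_pos (N : ℝ) (x : Vd d) : 0 < wz N x := by unfold wz; positivity
lemma wz_sh {N : ℝ} (hN : 0 ≤ N) (x h : Vd d) : (1 + ‖h‖) ^ (-N) * wz N x ≤ wz N (x + h) := by
  unfold wz
  rw [← mul_rpow (by positivity) (by positivity)]
  refine rpow_le_rpow_of_nonpos (by positivity) ?_ (by linarith)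
  nlinarith [norm_add_le x h, norm_nonneg x, norm_nonneg h]
lemma bern {N x : ℝ} (hN : 0 ≤ N) (hx : 0 ≤ x) : 1 - N * x ≤ (1 + x) ^ (-N) := by
  rw [rpow_def_of_pos (by linarith)]
  have h1 := add_one_le_exp (log (1 + x) * -N)
  have h2 := log_le_sub_one_of_pos (show 0 < 1 + x by linarith)
  nlinarith
lemma noise_exists : ∃ ρ : ProbabilityMeasure (Vd d), momI ρ ∧ ∃ N : ℝ, 0 < N ∧ ∀ (A : Set (Vd d)), MeasurableSet A → ∀ h : Vd d,
    (1 + ‖h‖) ^ (-N) * (ρ : Measure (Vd d)).real A ≤ (ρ : Measure (Vd d)).real ((fun z => z + h) ⁻¹' A) := by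
  set N : ℝ := d + 4 with hNd
  have hN : 0 < N := by positivity
  have hc : ∀ N : ℝ, Continuous (wz N : Vd d → ℝ) := fun N => by
    unfold wz
    exact (by fun_prop : Continuous fun x : Vd d => 1 + ‖x‖).rpow_const fun x => Or.inl (by positivity)
  have hi : ∀ r : ℝ, (d : ℝ) < r → Integrable (wz r : Vd d → ℝ) := fun r hr =>
    integrable_one_add_norm (by simpa using hr)
  obtain ⟨ρ, c, hcp, hρ, ht, -⟩ := dens_exists (hc N) (wz_pos N) (hi N (by linarith))
  refine ⟨ρ, ht _ ?_, N, hN, fun A hA h => ?_⟩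
  · refine (hi (d + 2) (by linarith)).mono' ((hc N).mul (by fun_prop)).aestronglyMeasurable (ae_of_all _ fun x => ?_)
    rw [norm_eq_abs, abs_of_nonneg (mul_nonneg (wz_pos N x).le (by positivity))]
    unfold wz
    rw [show -((d:ℝ) + 2) = -N + 2 by rw [hNd]; ring, rpow_add (by positivity)]
    refine mlL ?_ (by positivity)
    norm_cast
    nlinarith [norm_nonneg x]
  · set θ := (1 + ‖h‖) ^ (-N) with hθ
    have hθ0 : 0 ≤ θ := by positivity
    have mw : Measurable fun x : Vd d => ENNReal.ofReal (c * wz N x) := ENNReal.measurable_ofReal.comp (f := fun x => c * wz N x) ((hc N).measurable.const_mul c)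
    have key : ENNReal.ofReal θ * (ρ : Measure (Vd d)) A ≤ (ρ : Measure (Vd d)) ((fun z => z + h) ⁻¹' A) := by
      have hA' : MeasurableSet ((fun z : Vd d => z + h) ⁻¹' A) := (measurable_add_const h) hA
      rw [hρ, withDensity_apply _ hA, withDensity_apply _ hA', ← lintegral_indicator hA, ← lintegral_indicator hA',
        ← lintegral_const_mul _ (mw.indicator hA), ← lintegral_add_right_eq_self _ h]
      refine lintegral_mono fun x => ?_
      by_cases hx : x + h ∈ A
      · rw [indicator_of_mem hx, indicator_of_mem (show x ∈ (fun z : Vd d => z + h) ⁻¹' A from hx), ← ENNReal.ofReal_mul hθ0]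
        refine ENNReal.ofReal_le_ofReal ?_
        have := wz_sh hN.le (x + h) (-h)
        rw [norm_neg, add_neg_cancel_right] at this
        nlinarith
      · rw [indicator_of_notMem hx]; simp
    have := ENNReal.toReal_mono (measure_ne_top _ _) key
    rwa [ENNReal.toReal_mul, ENNReal.toReal_ofReal hθ0] at this
def zet : ProbabilityMeasure (Vd d) := Classical.choose noise_exists
lemma zet_mom : momI (zet : ProbabilityMeasure (Vd d)) := (Classical.choose_spec noise_exists).1
lemma trn_apply (ρ : ProbabilityMeasure (Vd d)) (μ : PTd d) (r : ℝ) {B : Set (Td d)} (hB : MeasurableSet B) :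
    Measurable (fun y => (ρ : Measure (Vd d)).real {z | y + pT (r • z) ∈ B}) ∧
    (trn ρ μ r : Measure (Td d)).real B = ∫ y, (ρ : Measure (Vd d)).real {z | y + pT (r • z) ∈ B} ∂(μ : Measure (Td d)) := by
  have hm : MeasurableSet ((fun q : Td d × Vd d => q.1 + pT (r • q.2)) ⁻¹' B) := (trn_meas r).measurable hB
  have h1 : Measurable fun y => (ρ : Measure (Vd d)) {z | y + pT (r • z) ∈ B} := measurable_measure_prodMk_left hm
  refine ⟨h1.ennreal_toReal, ?_⟩
  unfold Measure.real
  rw [integral_toReal h1.aemeasurable (ae_of_all _ fun y => measure_lt_top _ _)]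
  congr 1
  change Measure.map _ _ B = _
  rw [Measure.map_apply (trn_meas r).measurable hB, Measure.prod_apply hm]; rfl
lemma dom (τ κ : ℝ) (hτ : 0 < τ) (hκ : 0 < κ) : ∃ η > 0, ∀ μ μ' : PTd d, W1 μ μ' < η →
    ∀ B, MeasurableSet B → (1 - κ) * (trn zet μ τ : Measure (Td d)).real B ≤ (trn zet μ' τ : Measure (Td d)).real B := by
  obtain ⟨-, N, hN, hz⟩ := Classical.choose_spec (noise_exists (d := d))
  change ∀ (A : Set (Vd d)), MeasurableSet A → ∀ h : Vd d, (1 + ‖h‖) ^ (-N) * ((zet : ProbabilityMeasure (Vd d)) : Measure (Vd d)).real A ≤ ((zet : ProbabilityMeasure (Vd d)) : Measure (Vd d)).real ((fun z => z + h) ⁻¹' A) at hz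
  set t1 := (1 + τ⁻¹) ^ (-N) with ht1
  have t1p : 0 < t1 := by positivity
  refine ⟨κ * τ * t1 ^ 2 / N, by positivity, fun μ μ' hW B hB => ?_⟩
  obtain ⟨hm, e⟩ := trn_apply zet μ τ hB
  obtain ⟨-, e'⟩ := trn_apply zet μ' τ hB
  rw [e, e']
  set F := fun y => ((zet : ProbabilityMeasure (Vd d)) : Measure (Vd d)).real {z | y + pT (τ • z) ∈ B} with hF
  have hF0 : ∀ y, 0 ≤ F y := fun y => measureReal_nonneg
  have hF1 : ∀ y, F y ≤ 1 := fun y => by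
    have := measureReal_le_one (μ := ((zet : ProbabilityMeasure (Vd d)) : Measure (Vd d))) (s := {z | y + pT (τ • z) ∈ B}); exact this
  have step : ∀ y y', (1 + τ⁻¹ * dist y y') ^ (-N) * F y ≤ F y' := fun y y' => by
    obtain ⟨x, x', hx, hx', hd⟩ := lift_near y y'
    have mA : MeasurableSet {z : Vd d | y + pT (τ • z) ∈ B} :=
      (show Continuous fun z : Vd d => y + pT (τ • z) from continuous_const.add (pT_cont.comp (by fun_prop))).measurable hB
    have h1 := hz _ mA (τ⁻¹ • (x' - x))
    have h2 : (fun z => z + τ⁻¹ • (x' - x)) ⁻¹' {z : Vd d | y + pT (τ • z) ∈ B} = {z | y' + pT (τ • z) ∈ B} := by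
      ext z
      simp only [mem_preimage, mem_ofPred_eq]
      rw [← hx, ← hx', ← pT_add, ← pT_add, smul_add, smul_inv_smul₀ hτ.ne']
      congr! 2; abel
    rw [h2] at h1
    refine le_trans (mlR ?_ (hF0 y)) h1
    refine rpow_le_rpow_of_nonpos (by positivity) ?_ (by linarith)
    rw [norm_smul, norm_inv, norm_eq_abs, abs_of_pos hτ, norm_sub_rev]
    gcongr
  have st1 : ∀ y y', t1 * F y ≤ F y' := fun y y' => by
    refine le_trans (mlR ?_ (hF0 y)) (step y y')
    refine rpow_le_rpow_of_nonpos (by positivity) ?_ (by linarith)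
    nlinarith [dist_Td_le y y', inv_pos.2 hτ]
  set y0 : Td d := 0
  have hi : ∀ μ : PTd d, Integrable F (μ : Measure (Td d)) := fun μ =>
    (integrable_const (1:ℝ)).mono' hm.aestronglyMeasurable (ae_of_all _ fun y => by rw [norm_eq_abs, abs_of_nonneg (hF0 y)]; exact hF1 y)
  have lo : t1 * F y0 ≤ ∫ y, F y ∂(μ : Measure (Td d)) := by
    calc t1 * F y0 = ∫ y, t1 * F y0 ∂(μ : Measure (Td d)) := by simp
      _ ≤ _ := integral_mono (integrable_const _) (hi μ) fun y => st1 _ _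
  set Λ := N * τ⁻¹ * (F y0 / t1) with hΛ
  have hΛ0 : 0 ≤ Λ := by have := hF0 y0; positivity
  have one : ∀ y y', F y - F y' ≤ Λ * dist y y' := fun y y' => by
    have h1 := mlR (bern hN.le (by positivity : 0 ≤ τ⁻¹ * dist y y')) (hF0 y)
    have h2 : F y ≤ F y0 / t1 := by rw [le_div_iff₀ t1p]; linarith [st1 y y0]
    have h3 := mlL h2 (by positivity : 0 ≤ N * τ⁻¹ * dist y y')
    rw [hΛ]; linarith [step y y']
  have hl := (abs_le.1 (lip_W1 μ μ' hΛ0 fun y y' => abs_le.2 ⟨by have := one y' y; rw [dist_comm] at this; linarith, one y y'⟩)).2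
  have h5 := mlL hW.le hΛ0
  have h6 : Λ * (κ * τ * t1 ^ 2 / N) = κ * (t1 * F y0) := by rw [hΛ]; field_simp
  have h7 := mlL lo hκ.le
  linarith
lemma dom_lc (τ : ℝ) (κ : Icc (0:ℝ) 1) (hτ : 0 < τ) (hκ : 0 < κ.1) : ∃ η > 0, ∀ μ μ' : PTd d, W1 μ μ' < η →
    ∃ g, trn zet μ' τ = lc κ (trn zet μ τ) g := by
  obtain ⟨η, hη, h⟩ := dom (d := d) τ κ hτ hκ
  refine ⟨η, hη, fun μ μ' hW => ?_⟩
  have hd := h μ μ' hW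
  generalize trn zet μ τ = P at hd
  generalize trn zet μ' τ = P' at hd
  have k1 : 0 ≤ 1 - κ.1 := by linarith [κ.2.2]
  have hle : ENNReal.ofReal (1 - κ) • (P : Measure (Td d)) ≤ P' := by
    refine Measure.le_iff.2 fun B hB => ?_
    have := ENNReal.ofReal_le_ofReal (hd B hB)
    rwa [ENNReal.ofReal_mul k1, ofReal_measureReal, ofReal_measureReal] at this
  have hfin : IsFiniteMeasure (ENNReal.ofReal (1 - κ) • (P : Measure (Td d))) := Measure.smul_finite _ ENNReal.ofReal_ne_top
  set D := (P' : Measure (Td d)) - ENNReal.ofReal (1 - κ) • (P : Measure (Td d)) with hD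
  have hs : D + ENNReal.ofReal (1 - κ) • (P : Measure (Td d)) = P' := Measure.sub_add_cancel_of_le hle
  have h0 : ENNReal.ofReal κ ≠ 0 := by simpa using hκ
  have hu : D univ = ENNReal.ofReal κ := by
    rw [hD, Measure.sub_apply MeasurableSet.univ hle]
    simp only [measure_univ, Measure.smul_apply, smul_eq_mul, mul_one]
    rw [← ENNReal.ofReal_one, ← ENNReal.ofReal_sub _ k1]; congr 1; ring
  refine ⟨⟨(ENNReal.ofReal κ)⁻¹ • D, ⟨?_⟩⟩, ?_⟩
  · rw [Measure.smul_apply, hu, smul_eq_mul, ENNReal.inv_mul_cancel h0 ENNReal.ofReal_ne_top]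
  · apply Subtype.ext
    change (P' : Measure (Td d)) = lineComb κ P _
    unfold lineComb
    rw [← hs, add_comm]
    congr 1
    change D = ENNReal.ofReal κ • ((ENNReal.ofReal κ)⁻¹ • D)
    rw [smul_smul, ENNReal.mul_inv_cancel h0 ENNReal.ofReal_ne_top, one_smul]
end
section
variable {d : ℕ}
lemma trn_zero (ρ : ProbabilityMeasure (Vd d)) (μ : PTd d) : trn ρ μ 0 = μ := by
  refine eq_of_C2 fun f hf hp => ?_
  have h2 := iT_trn ρ μ 0 ⟨hf.continuous, hp⟩
  simp at h2
  simpa [iT] using h2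
lemma trn_comm (ρ ρ' : ProbabilityMeasure (Vd d)) (μ : PTd d) (r r' : ℝ) :
    trn ρ (trn ρ' μ r') r = trn ρ' (trn ρ μ r) r' := by
  refine eq_of_C2 fun f hf hp => ?_
  have hcp : CP f := ⟨hf.continuous, hp⟩
  change iT _ f = iT _ f
  rw [iT_trn _ _ _ hcp, iT_trn _ _ _ hcp]
  simp only [fun v => iT_trn ρ' μ r' (hcp.tr v), fun v => iT_trn ρ μ r (hcp.tr v)]
  obtain ⟨C, -, hC⟩ := per_bdd hcp.1 hcp.2
  have hc : Continuous fun q : Vd d × Vd d => iT μ (fun x => f (x + r' • q.2 + r • q.1)) :=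
    iT_cont (m := fun _ : Vd d × Vd d => μ) (f := fun (q : Vd d × Vd d) x => f (x + r' • q.2 + r • q.1)) continuous_const
      (hcp.1.comp (by fun_prop)) fun q => ((hcp.tr (r • q.1)).tr (r' • q.2)).2
  have hi : Integrable (Function.uncurry fun z z' => iT μ (fun x => f (x + r' • z' + r • z))) ((ρ : Measure (Vd d)).prod (ρ' : Measure (Vd d))) :=
    bdd_int (f := fun q : Vd d × Vd d => iT μ (fun x => f (x + r' • q.2 + r • q.1))) _ hc (C := C) fun q => iT_abs ((hcp.tr (r • q.1)).tr (r' • q.2)) _ fun x => hC _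
  refine (integral_integral_swap hi).trans ?_
  simp only [add_right_comm]
lemma trn_lc (ρ : ProbabilityMeasure (Vd d)) (t : Icc (0:ℝ) 1) (μ ν : PTd d) (r : ℝ) :
    trn ρ (lc t μ ν) r = lc t (trn ρ μ r) (trn ρ ν r) := by
  refine eq_of_C2 fun f hf hp => ?_
  have hcp : CP f := ⟨hf.continuous, hp⟩
  have il : ∀ (μ ν : PTd d) f, CP f → iT (lc t μ ν) f = (1 - t) * iT μ f + t * iT ν f := fun μ ν f h => integral_lc t μ ν (cont_sec' h.1 h.2)
  change iT _ f = iT _ f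
  rw [il _ _ _ hcp, iT_trn _ _ _ hcp, iT_trn _ _ _ hcp, iT_trn _ _ _ hcp]
  simp only [fun v => il μ ν _ (hcp.tr v)]
  obtain ⟨C, -, hC⟩ := per_bdd hcp.1 hcp.2
  have hi : ∀ μ : PTd d, Integrable (fun z => iT μ (fun x => f (x + r • z))) (ρ : Measure (Vd d)) := fun μ => by
    have hc : Continuous fun z : Vd d => iT μ (fun x => f (x + r • z)) :=
      iT_cont (m := fun _ : Vd d => μ) (f := fun (z : Vd d) x => f (x + r • z)) continuous_const
        (hcp.1.comp (by fun_prop)) fun q => (hcp.tr _).2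
    exact bdd_int _ hc (C := C) fun q => iT_abs (hcp.tr _) _ fun x => hC _
  rw [integral_add ((hi μ).const_mul _) ((hi ν).const_mul _), integral_const_mul, integral_const_mul]
lemma W1_trn {ρ : ProbabilityMeasure (Vd d)} (hρ : momI ρ) (μ : PTd d) (r : ℝ) : W1 (trn ρ μ r) μ ≤ |r| * mom ρ := by
  refine W1_le _ _ fun φ hφ => ?_
  set P := (μ : Measure (Td d)).prod (ρ : Measure (Vd d)) with hP
  obtain ⟨C, hC⟩ : ∃ C, ∀ y, |φ y| ≤ C := by
    obtain ⟨C, hC⟩ := isCompact_univ.exists_bound_of_continuousOn hφ.continuous.continuousOn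
    exact ⟨C, fun y => hC y trivial⟩
  have e1 : ∫ y, φ y ∂(trn ρ μ r : Measure (Td d)) = ∫ q, φ (q.1 + pT (r • q.2)) ∂P := by
    change ∫ y, φ y ∂(Measure.map _ _) = _
    rw [integral_map (trn_meas r).aemeasurable hφ.continuous.aestronglyMeasurable]
  have i1 : Integrable (fun q : Td d × Vd d => φ (q.1 + pT (r • q.2))) P := bdd_int _ (hφ.continuous.comp (trn_meas r)) fun q => hC _
  have i2 : Integrable (fun q : Td d × Vd d => φ q.1) P := bdd_int _ (hφ.continuous.comp continuous_fst) fun q => hC _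
  have e2 : ∫ y, φ y ∂(μ : Measure (Td d)) = ∫ q, φ q.1 ∂P := by
    rw [integral_fun_fst]; simp
  have i3 : Integrable (fun q : Td d × Vd d => |r| * (‖q.2‖ + ‖q.2‖ ^ 2)) P := (hρ.comp_snd _).const_mul _
  have e3 : |r| * mom ρ = ∫ q, |r| * (‖q.2‖ + ‖q.2‖ ^ 2) ∂P := by
    rw [integral_const_mul, integral_fun_snd (fun z => ‖z‖ + ‖z‖ ^ 2)]; simp [mom]
  rw [e1, e2, e3, ← integral_sub i1 i2]
  refine integral_mono (i1.sub i2) i3 fun q => ?_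
  have h1 := hφ.dist_le_mul (q.1 + pT (r • q.2)) q.1
  have h2 : dist (q.1 + pT (r • q.2)) q.1 ≤ |r| * ‖q.2‖ := by
    have := dist_pT (secT q.1 + r • q.2) (secT q.1)
    rwa [pT_add, pT_secT, add_sub_cancel_left, norm_smul, norm_eq_abs] at this
  rw [Real.dist_eq] at h1
  simp only [NNReal.coe_one, one_mul] at h1 ⊢
  have h3 := le_abs_self (φ (q.1 + pT (r • q.2)) - φ q.1)
  have : |r| * ‖q.2‖ ≤ |r| * (‖q.2‖ + ‖q.2‖ ^ 2) := mlL (by nlinarith [norm_nonneg q.2]) (abs_nonneg r)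
  linarith
lemma W1_lc (t : Icc (0:ℝ) 1) (μ ν : PTd d) : W1 (lc t μ ν) μ ≤ 2 * t := by
  refine W1_le _ _ fun φ hφ => ?_
  rw [integral_lc t μ ν hφ.continuous]
  have := mlL (W1_set_le ν μ hφ) t.2.1
  linarith
lemma lc_self (t : Icc (0:ℝ) 1) (μ : PTd d) : lc t μ μ = μ := by
  refine eq_of_C2 fun f hf hp => ?_
  rw [integral_lc t μ μ (cont_sec' hf.continuous hp)]; ring
instance probCirc : IsProbabilityMeasure (volume : Measure (AddCircle (1:ℝ))) := ⟨by simp [AddCircle.measure_univ]⟩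
/-- the uniform noise -/
lemma unif_exists : ∃ ρ : ProbabilityMeasure (Vd d), momI ρ ∧ ∃ h : PTd d, ∀ μ, trn ρ μ 1 = h := by
  have hms : Measurable (secT : Td d → Vd d) := meas_secT
  obtain ⟨ρ, eρ⟩ : ∃ ρ : ProbabilityMeasure (Vd d), (ρ : Measure (Vd d)) = Measure.map secT (volume : Measure (Td d)) :=
    ⟨⟨_, Measure.isProbabilityMeasure_map hms.aemeasurable⟩, rfl⟩
  obtain ⟨h, eh⟩ : ∃ h : PTd d, (h : Measure (Td d)) = volume := ⟨⟨volume, inferInstance⟩, rfl⟩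
  refine ⟨ρ, ?_, h, fun μ => eq_of_C2 fun f hf hp => ?_⟩
  · rw [momI, eρ]
    refine (integrable_map_measure (Continuous.aestronglyMeasurable (by fun_prop)) hms.aemeasurable).2 ?_
    refine (integrable_const (2:ℝ)).mono' (Measurable.aestronglyMeasurable (by fun_prop)) (ae_of_all _ fun y => ?_)
    have h1 : ‖secT y‖ ≤ 1 := (pi_norm_le_iff_of_nonneg zero_le_one).2 fun i => by
      have := ((AddCircle.equivIco 1 0) (y i)).2
      change |((AddCircle.equivIco 1 0) (y i)).1| ≤ 1
      rw [abs_of_nonneg this.1]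
      exact this.2.le.trans (by norm_num)
    simp only [Function.comp]
    rw [norm_eq_abs, abs_of_nonneg (by positivity)]
    nlinarith [norm_nonneg (secT y)]
  · have hcp : CP f := ⟨hf.continuous, hp⟩
    have hc := cont_sec' hcp.1 hcp.2
    obtain ⟨C, -, hC⟩ := per_bdd hcp.1 hcp.2
    change iT _ f = _
    rw [trn_prod _ _ _ hcp, integral_prod _ (bdd_int _ (sec_jc hcp 1) fun q => hC _), eρ, eh]
    have : ∀ y : Td d, ∫ z, f (secT y + (1:ℝ) • z) ∂(Measure.map secT (volume : Measure (Td d))) = ∫ u, f (secT u) := fun y => by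
      have hc2 : Continuous fun z : Vd d => f (secT y + (1:ℝ) • z) := hcp.1.comp (by fun_prop)
      rw [integral_map hms.aemeasurable hc2.aestronglyMeasurable]
      have e : ∀ u : Td d, f (secT y + (1:ℝ) • secT u) = (fun u => f (secT u)) (y + u) := fun u => by
        have := per_sec_add hp y (secT u)
        rw [pT_secT] at this
        simp only [one_smul]; exact this.symm
      simp only [e]
      exact integral_add_left_eq_self (fun u => f (secT u)) y
    calc _ = ∫ y : Td d, (∫ u, f (secT u)) ∂(μ : Measure (Td d)) := integral_congr_ae (ae_of_all _ fun y => this y)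
      _ = _ := by simp
lemma hst_lb (S : MFGSetting d) : ∃ C0 > 0, ∀ m α s, -C0 ≤ hst S m α s := by
  obtain ⟨C, hC, h⟩ := rc_lb S
  obtain ⟨M, hM⟩ := S.Fc_bounded
  refine ⟨C + |M|, by positivity, fun m α s => ?_⟩
  have := h m α s
  rw [runCost_eq] at this
  linarith [(abs_le.1 (hM (m s))).2, le_abs_self M]
lemma RelC_sub (S : MFGSetting d) : ∃ C0 > 0, ∀ {m : ℝ → PTd d} {a a' b A : ℝ}, RelC S a b m A → a ≤ a' → a' ≤ b →
    RelC S a' b m (A + C0 * (a' - a)) := by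
  obtain ⟨C, hC, hl⟩ := hst_lb S
  refine ⟨C, hC, fun {m a a' b A} h h1 h2 => ?_⟩
  obtain ⟨α, hα, hA⟩ := realize S (h1.trans h2) h
  have r1 := Rlz_sub hα le_rfl h2
  have r2 := Rlz_sub hα h1 le_rfl
  refine (Rlz_rel (S := S) h.1 h2 r2).mono ?_
  have i1 := Rlz_hst (S := S) h.1 h1 r1
  rw [← intervalIntegral.integral_add_adjacent_intervals i1 (Rlz_hst (S := S) h.1 h2 r2)] at hA
  have h3 : ∫ s in a..a', -C ≤ ∫ s in a..a', hst S m α s := intervalIntegral.integral_mono_on h1 intervalIntegrable_const i1 fun s _ => hl m α s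
  rw [intervalIntegral.integral_const, smul_eq_mul] at h3
  linarith
lemma steer (S : MFGSetting d) : ∃ C > 0, ∀ (g : PTd d) {m : ℝ → PTd d} {A : ℝ}, RelC S 0 1 m A →
    ∃ m', RelC S 0 1 m' (5 / 4 * |A| + C) ∧ m' 0 = g ∧ m' 1 = m 1 := by
  obtain ⟨ρ, hρ, hh, hU⟩ := unif_exists (d := d)
  obtain ⟨C1, hC1, ht⟩ := trn_rel S
  obtain ⟨C2, hC2, hs⟩ := RelC_sub S
  obtain ⟨C3, hC3, hq⟩ := heat_rel S
  have hM := mom_nonneg ρ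
  refine ⟨2 * C3 + 2 * C2 + C1 * (4 + 4 ^ 2) * mom ρ, by positivity, fun g m A h => ?_⟩
  have a1 := ht ρ hρ (a0 := 0) (b0 := 2) (R := 4) (by norm_num) (hq g le_rfl (show (0:ℝ) ≤ 1 / 2 by norm_num)) (by norm_num) (fun s hs => by
    rw [abs_of_nonneg (by linarith [hs.1]), abs_of_pos (by norm_num)]; linarith [hs.2])
  have a2 := ht ρ hρ (a0 := 2) (b0 := -2) (R := 4) (by norm_num) (hs h (show (0:ℝ) ≤ 1 / 2 by norm_num) (by norm_num)) (by norm_num) (fun s hs => by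
    rw [abs_of_nonneg (by linarith [hs.2]), abs_of_neg (by norm_num)]; linarith [hs.1])
  have a3 := a1.glue (by norm_num) (by norm_num) a2 (by norm_num [hU])
  refine ⟨_, a3.mono ?_, ?_, ?_⟩
  · have b1 : min (1 / 4) (C1 * 4 * mom ρ) ≤ 1 / 4 := min_le_left _ _
    have b2 := abs_add_le A (C2 * (1 / 2 - 0))
    rw [abs_of_nonneg (by positivity : 0 ≤ C2 * (1 / 2 - 0))] at b2
    have b3 := mlR b1 (abs_nonneg (A + C2 * (1 / 2 - 0)))
    have b4 := mlR b1 (abs_nonneg (C3 * (1 / 2 - 0)))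
    rw [abs_of_nonneg (by positivity : 0 ≤ C3 * (1 / 2 - 0))] at b4 ⊢
    have b5 := le_abs_self A
    linarith
  · simp [glue, trn_zero, heat_zero]
  · norm_num [glue, trn_zero]
end
section
variable {d : ℕ}
lemma Pth.mono {S : MFGSetting d} {t K K' : ℝ} {μ ν : PTd d} (h : Pth S t μ ν K) (hK : K ≤ K') : Pth S t μ ν K' := by
  obtain ⟨m, A, hr, h0, h1, hA⟩ := h
  exact ⟨m, A + (K' - K), hr.mono (by linarith), h0, h1, by linarith⟩
lemma Fcm_cont (S : MFGSetting d) {m : ℝ → PTd d} (hm : Continuous m) : Continuous fun s => S.Fc (m s) := (Fc_cont S).comp hm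
lemma Pth.concat {S : MFGSetting d} {t t' K K' : ℝ} {μ ν ξ : PTd d} (ht : 0 ≤ t) (ht' : 0 ≤ t') (h : Pth S t μ ν K)
    (h' : Pth S t' ν ξ K') : Pth S (t + t') μ ξ (K + K') := by
  obtain ⟨m, A, hr, h0, h1, hA⟩ := h
  obtain ⟨m', A', hr', h0', h1', hA'⟩ := h'
  have hs := hr'.shift t
  rw [zero_add, add_comm t' t] at hs
  have hg := hr.glue ht (by linarith) hs (by simp [h1, h0'])
  refine ⟨_, _, hg, by simp [glue, ht, h0], ?_, ?_⟩
  · rcases ht'.eq_or_lt with e | e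
    · subst e; simp [glue]; rw [h1, ← h1', h0']
    · simp [glue, not_le.2 e, h1']
  · rw [← intervalIntegral.integral_add_adjacent_intervals (Fc_ii S hg.1 0 t) (Fc_ii S hg.1 t (t + t'))]
    have e1 : ∫ s in (0:ℝ)..t, S.Fc (glue t m (fun s => m' (s - t)) s) = ∫ s in (0:ℝ)..t, S.Fc (m s) := by
      refine intervalIntegral.integral_congr fun s hs => ?_
      rw [uIcc_of_le ht] at hs
      simp [glue, hs.2]
    have e2 : ∫ s in t..(t + t'), S.Fc (glue t m (fun s => m' (s - t)) s) = ∫ s in (0:ℝ)..t', S.Fc (m' s) := by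
      have : ∫ s in t..(t + t'), S.Fc (glue t m (fun s => m' (s - t)) s) = ∫ s in t..(t + t'), S.Fc (m' (s - t)) := by
        refine intervalIntegral.integral_congr fun s hs => ?_
        rw [uIcc_of_le (by linarith)] at hs
        rcases hs.1.eq_or_lt with e | e
        · subst e; simp [glue, h1, h0']
        · simp [glue, not_le.2 e]
      rw [this, intervalIntegral.integral_comp_sub_right (fun s => S.Fc (m' s))]
      simp
    rw [e1, e2]; linarith
lemma Fc_int_bd (S : MFGSetting d) : ∃ M, 0 ≤ M ∧ ∀ (m : ℝ → PTd d) (a b : ℝ), a ≤ b → |∫ s in a..b, S.Fc (m s)| ≤ M * (b - a) := by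
  obtain ⟨M, hM⟩ := S.Fc_bounded
  refine ⟨|M|, abs_nonneg _, fun m a b hab => ?_⟩
  have := intervalIntegral.norm_integral_le_of_norm_le_const (a := a) (b := b) (f := fun s => S.Fc (m s)) (C := |M|) fun s _ => (hM (m s)).trans (le_abs_self M)
  rwa [norm_eq_abs, abs_of_nonneg (sub_nonneg.2 hab)] at this
lemma trn_rel1 (S : MFGSetting d) {ρ : ProbabilityMeasure (Vd d)} (hρ : momI ρ) : ∃ C > 0, ∀ {m : ℝ → PTd d} {A q : ℝ}, RelC S 0 1 m A →
    0 ≤ q → q ≤ 2 → RelC S 0 1 (fun s => trn ρ (m s) (q + -q * s)) (A + C * q * (1 + |A|)) := by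
  obtain ⟨C, hC, h⟩ := trn_rel S
  have hM := mom_nonneg ρ
  refine ⟨10 * (C * mom ρ) + 1, by positivity, fun {m A q} hr h0 h2 => ?_⟩
  refine (h ρ hρ (R := 2 * q) zero_le_one hr (by positivity) fun s hs => ?_).mono ?_
  · rw [abs_neg, abs_of_nonneg h0, abs_of_nonneg (by nlinarith [hs.2])]; nlinarith [hs.1]
  · have b1 := mlR (min_le_right (1/4) (C * (2 * q) * mom ρ)) (abs_nonneg A)
    have b2 : q ^ 2 ≤ 2 * q := by nlinarith
    have b3 := mlL b2 (by positivity : 0 ≤ C * mom ρ)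
    have b4 : 0 ≤ C * mom ρ * q * |A| := by positivity
    have b5 : 0 ≤ q * |A| := by positivity
    linarith
lemma st1 (S : MFGSetting d) : ∃ C > 0, ∀ τ, 0 < τ → τ ≤ 1 → ∀ μ : PTd d, Pth S τ μ (trn zet (heat μ τ) τ) (C * τ) := by
  obtain ⟨C3, hC3, hq⟩ := heat_rel S
  obtain ⟨C1, hC1, ht⟩ := trn_rel S
  obtain ⟨M, hM, hF⟩ := Fc_int_bd S
  have hZ := mom_nonneg (zet (d := d))
  refine ⟨5/4 * C3 + C1 * (2 + 2 ^ 2) * mom (zet (d := d)) + M, by positivity, fun τ hτ h1 μ => ?_⟩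
  have a1 := ht zet zet_mom (a0 := 0) (b0 := 1) (R := 2) hτ.le (hq μ le_rfl hτ.le) (by norm_num) (fun s hs => by
    rw [abs_of_nonneg (by linarith [hs.1]), abs_of_pos (by norm_num)]; linarith [hs.2])
  refine Pth.mono ⟨_, _, a1, by simp [trn_zero, heat_zero], by simp, rfl⟩ ?_
  have b1 := mlR (min_le_left (1/4) (C1 * 2 * mom (zet (d := d)))) (abs_nonneg (C3 * (τ - 0)))
  rw [abs_of_nonneg (by positivity : 0 ≤ C3 * (τ - 0))] at b1 ⊢
  have b2 := (abs_le.1 (hF (fun s => trn zet (heat μ s) (0 + 1 * s)) 0 τ hτ.le)).2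
  linarith
lemma st2_arith {A K F C1 C2 C4 M L Z G D q r τ : ℝ} (hC1 : 0 < C1) (hC2 : 0 < C2) (hC4 : 0 < C4) (hM : 0 ≤ M) (hL : 0 ≤ L) (hZ : 0 ≤ Z) (hG : 0 ≤ G)
    (hD : D = 2 * C1 + C2 * (1 + 2 * C1)) (hDp : 0 ≤ D) (q0 : 0 ≤ q) (qr : q ≤ 2 * r) (r0 : 0 ≤ r) (r1 : r ≤ 1) (t0 : 0 ≤ τ) (rt : τ ≤ r)
    (hA : A + F = K) (hA' : |A| ≤ |K| + M) :
    (1 - τ) * (A + C1 * q * (1 + |A|) + C2 * τ * (1 + |A + C1 * q * (1 + |A|)|)) + τ * (5/4 * |A| + C4) + (F + L * (2 + Z + 2 * G) * r) ≤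
    K + ((D + 1 + D + 5/4 + C4) * (1 + M) + L * (2 + Z + 2 * G)) * r * (1 + |K|) := by
  set X := 1 + |A| with hX
  have X1 : 1 ≤ X := by linarith [abs_nonneg A]
  have A1 := le_abs_self A
  set A2 := A + C1 * q * X with hA2
  have u1 : C1 * q * X ≤ C1 * (2 * r) * X := by gcongr
  have u2 : |A2| ≤ |A| + 2 * C1 * X := by
    refine (abs_add_le _ _).trans ?_
    rw [abs_of_nonneg (by positivity : 0 ≤ C1 * q * X)]
    have : C1 * X * r ≤ C1 * X * 1 := by gcongr
    linarith
  have u3 : C2 * τ * (1 + |A2|) ≤ C2 * r * ((1 + 2 * C1) * X) := by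
    have : 1 + |A2| ≤ (1 + 2 * C1) * X := by linarith
    gcongr
  have u0 : 0 ≤ C2 * τ * (1 + |A2|) := mul_nonneg (mul_nonneg hC2.le t0) (by positivity)
  set A3 := A2 + C2 * τ * (1 + |A2|) with hA3
  have u4 : A3 ≤ A + r * D * X := by rw [hD]; linarith
  have u5 : - A3 ≤ (1 + D) * X := by
    have : 0 ≤ C1 * q * X := by positivity
    have : 0 ≤ D * X := by positivity
    linarith [neg_abs_le A]
  have u6 : τ * (-A3) ≤ r * ((1 + D) * X) := by
    rcases le_total 0 (-A3) with h | h
    · exact mul_le_mul rt u5 h r0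
    · exact (mul_nonpos_of_nonneg_of_nonpos t0 h).trans (by positivity)
  have u7 : τ * (5/4 * |A| + C4) ≤ r * ((5/4 + C4) * X) := by
    have : 5/4 * |A| + C4 ≤ (5/4 + C4) * X := by rw [hX]; linarith [mul_nonneg hC4.le (abs_nonneg A)]
    exact mul_le_mul rt this (by positivity) r0
  have u8 : r * X * (D + 1 + D + 5/4 + C4) ≤ r * ((1 + M) * (1 + |K|)) * (D + 1 + D + 5/4 + C4) := by
    have : X ≤ (1 + M) * (1 + |K|) := by rw [hX]; linarith [mul_nonneg hM (abs_nonneg K)]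
    gcongr
  have u9 : 0 ≤ L * (2 + Z + 2 * G) * r * |K| := by positivity
  linarith
lemma st2 (S : MFGSetting d) : ∃ C > 0, ∀ (τ : Icc (0:ℝ) 1) (μ ν g : PTd d) (K : ℝ), Pth S 1 μ ν K →
    Pth S 1 (lc τ (trn zet (trn gam μ √(2 * τ)) τ) g) ν (K + C * √τ * (1 + |K|)) := by
  obtain ⟨C1, hC1, h1⟩ := trn_rel1 S (gam_mom (d := d))
  obtain ⟨C2, hC2, h2⟩ := trn_rel1 S (zet_mom (d := d))
  obtain ⟨C4, hC4, h4⟩ := steer S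
  obtain ⟨M, hM, hF⟩ := Fc_int_bd S
  obtain ⟨L, hL, hFL⟩ := Fc_lip S
  have hG := mom_nonneg (gam (d := d))
  have hZ := mom_nonneg (zet (d := d))
  set D := 2 * C1 + C2 * (1 + 2 * C1) with hD
  have hDp : 0 ≤ D := by positivity
  refine ⟨(D + 1 + D + 5/4 + C4) * (1 + M) + L * (2 + mom (zet (d := d)) + 2 * mom (gam (d := d))), by positivity, fun τ μ ν g K h => ?_⟩
  obtain ⟨m, A, hr, e0, e1, hA⟩ := h
  set r := √(τ : ℝ) with hr0
  have r0 : 0 ≤ r := sqrt_nonneg _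
  have rs : r ^ 2 = τ := sq_sqrt τ.2.1
  have r1 : r ≤ 1 := by rw [hr0, sqrt_le_one]; exact τ.2.2
  have rt : (τ : ℝ) ≤ r := by nlinarith
  set q := √(2 * (τ : ℝ)) with hq
  have q0 : 0 ≤ q := sqrt_nonneg _
  have qr : q ≤ 2 * r := by
    rw [hq, sqrt_le_iff]; exact ⟨by positivity, by nlinarith⟩
  have f1 := h1 hr q0 (by linarith)
  have f2 := h2 f1 τ.2.1 (by linarith)
  obtain ⟨ms, hs, s0, s1⟩ := h4 g hr
  have f3 := f2.mix τ hs
  have hA' : |A| ≤ |K| + M := by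
    have := hF m 0 1 zero_le_one
    have e : A = K - ∫ s in (0:ℝ)..1, S.Fc (m s) := by linarith
    rw [e]; refine (abs_sub _ _).trans ?_
    linarith
  refine Pth.mono ⟨_, _, f3, by simp [e0, s0], by simp [e1, s1, trn_zero, lc_self], rfl⟩ ?_
  set Z := mom (zet (d := d)) with eZ
  set G := mom (gam (d := d)) with eG
  have hFc : ∫ s in (0:ℝ)..1, S.Fc (lc τ (trn zet (trn gam (m s) (q + -q * s)) (τ + -τ * s)) (ms s)) ≤
      (∫ s in (0:ℝ)..1, S.Fc (m s)) + L * (2 + Z + 2 * G) * r := by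
    have : (∫ s in (0:ℝ)..1, S.Fc (m s)) + L * (2 + Z + 2 * G) * r = ∫ s in (0:ℝ)..1, (S.Fc (m s) + L * (2 + Z + 2 * G) * r) := by
      rw [ci_add (Fcm_cont S hr.1) continuous_const]; simp
    rw [this]
    refine iI_mono zero_le_one (Fcm_cont S f3.1) ((Fcm_cont S hr.1).add continuous_const) fun s hs => ?_
    have c1 := (abs_le.1 (hFL (trn zet (trn gam (m s) (q + -q * s)) (τ + -τ * s)) (lc τ (trn zet (trn gam (m s) (q + -q * s)) (τ + -τ * s)) (ms s)))).2
    have c2 := (abs_le.1 (hFL (trn gam (m s) (q + -q * s)) (trn zet (trn gam (m s) (q + -q * s)) (τ + -τ * s)))).2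
    have c3 := (abs_le.1 (hFL (m s) (trn gam (m s) (q + -q * s)))).2
    have d1 := W1_lc τ (trn zet (trn gam (m s) (q + -q * s)) (τ + -τ * s)) (ms s)
    have d2 := W1_trn zet_mom (trn gam (m s) (q + -q * s)) (τ + -τ * s)
    have d3 := W1_trn gam_mom (m s) (q + -q * s)
    rw [W1_comm] at d1 d2 d3
    rw [← eZ, abs_of_nonneg (by nlinarith [hs.2, τ.2.1])] at d2
    rw [← eG, abs_of_nonneg (by nlinarith [hs.2])] at d3
    have g2 : (τ + -τ * s) * Z ≤ r * Z := mlR (by nlinarith [hs.1, τ.2.1]) hZ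
    have g3 : (q + -q * s) * G ≤ (2 * r) * G := mlR (by nlinarith [hs.1]) hG
    have k1 := mlL (d1.trans (by linarith : 2 * (τ:ℝ) ≤ 2 * r)) hL
    have k2 := mlL (d2.trans g2) hL
    have k3 := mlL (d3.trans g3) hL
    linarith
  exact (add_le_add le_rfl hFc).trans (st2_arith hC1 hC2 hC4 hM hL hZ hG hD hDp q0 qr r0 r1 τ.2.1 rt hA hA')
lemma equi0 (S : MFGSetting d) : ∃ C > 0, ∀ τ, 0 < τ → τ ≤ 1 → ∃ η > 0, ∀ (μ μ' ν : PTd d) (K : ℝ), W1 μ μ' < η → Pth S 1 μ ν K →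
    Pth S (τ + 1) μ' ν (K + C * √τ * (1 + |K|)) := by
  obtain ⟨C1, hC1, h1⟩ := st1 S
  obtain ⟨C2, hC2, h2⟩ := st2 S
  refine ⟨C1 + C2, by positivity, fun τ t0 t1 => ?_⟩
  obtain ⟨η, hη, hd⟩ := dom_lc (d := d) τ ⟨τ, t0.le, t1⟩ t0 t0
  refine ⟨η, hη, fun μ μ' ν K hW hP => ?_⟩
  obtain ⟨g, hg⟩ := hd μ μ' hW
  have p1 := h1 τ t0 t1 μ'
  have p2 := h2 ⟨τ, t0.le, t1⟩ μ ν (trn gam g √(2 * τ)) K hP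
  have e : trn zet (heat μ' τ) τ = lc ⟨τ, t0.le, t1⟩ (trn zet (trn gam μ √(2 * τ)) τ) (trn gam g √(2 * τ)) := by
    rw [heat, trn_comm, hg, trn_lc, trn_comm gam zet]
  rw [e] at p1
  refine (p1.concat t0.le zero_le_one p2).mono ?_
  have : τ ≤ √τ := by
    have := sq_sqrt t0.le
    have : √τ ≤ 1 := by rwa [sqrt_le_one]
    nlinarith [sqrt_nonneg τ]
  simp only []
  have b1 := mlL this hC1.le
  have b2 : 0 ≤ C1 * √τ * |K| := by positivity
  linarith
lemma equi (S : MFGSetting d) (K0 : ℝ) {ε : ℝ} (hε : 0 < ε) : ∃ τ > 0, τ ≤ ε ∧ τ ≤ 1 ∧ ∃ η > 0, ∀ (μ μ' ν : PTd d) (K : ℝ), W1 μ μ' < η →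
    Pth S 1 μ ν K → |K| ≤ K0 → Pth S (τ + 1) μ' ν (K + ε) := by
  obtain ⟨C, hC, h⟩ := equi0 S
  have hp : 0 < ε / (C * (1 + |K0|)) := by positivity
  set τ := min (min 1 ε) ((ε / (C * (1 + |K0|))) ^ 2) with hτ
  have t0 : 0 < τ := lt_min (lt_min one_pos hε) (by positivity)
  have t1 : τ ≤ 1 := (min_le_left _ _).trans (min_le_left _ _)
  obtain ⟨η, hη, hh⟩ := h τ t0 t1
  refine ⟨τ, t0, (min_le_left _ _).trans (min_le_right _ _), t1, η, hη, fun μ μ' ν K hW hP hK => (hh μ μ' ν K hW hP).mono ?_⟩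
  have b1 : √τ ≤ ε / (C * (1 + |K0|)) := by
    rw [sqrt_le_iff]; exact ⟨hp.le, min_le_right _ _⟩
  have b2 : 1 + |K| ≤ 1 + |K0| := by linarith [le_abs_self K0]
  have : C * √τ * (1 + |K|) ≤ C * (ε / (C * (1 + |K0|))) * (1 + |K0|) := by gcongr
  have e : C * (ε / (C * (1 + |K0|))) * (1 + |K0|) = ε := by
    have : (1 + |K0|) ≠ 0 := by positivity
    field_simp
  linarith
end
section
variable {d : ℕ}
lemma ev_of {P : ℝ → Prop} {δ0 : ℝ} (h0 : 0 < δ0) (h : ∀ δ, 0 < δ → δ ≤ δ0 → P δ) : ∀ᶠ δ in 𝓝[>] (0:ℝ), P δ := by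
  filter_upwards [Ioc_mem_nhdsGT h0] with δ hδ using h δ hδ.1 hδ.2
lemma glim (S : MFGSetting d) {lam : ℝ} (hlam : IsLimitValueV S 1 lam) (C0 : ℝ) {t ε : ℝ} (ht : 0 < t) (hε : 0 < ε) :
    ∀ᶠ δ in 𝓝[>] (0:ℝ), ∀ ν, |(1 - exp (-δ * t)) * Wd S C0 δ ν - t * (C0 - lam)| ≤ ε := by
  set c := C0 - lam with hc
  obtain ⟨δ1, hδ1, h1⟩ := hlam (min 1 (ε / (2 * t))) (lt_min one_pos (by positivity))
  have h2 : 0 < ε / (2 * t ^ 2 * (|c| + 1)) := by positivity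
  refine ev_of (lt_min hδ1 h2) fun δ d0 dl ν => ?_
  have b1 := h1 δ d0 (dl.trans (min_le_left _ _)) ν
  have dl2 := dl.trans (min_le_right _ _)
  have e1 : δ * Wd S C0 δ ν = δ * Vfun S 1 δ ν + C0 := by
    rw [Wd]; field_simp
  set X := δ * Wd S C0 δ ν with hX
  have b2 : |X - c| < min 1 (ε / (2 * t)) := by
    rw [e1, hc]; convert b1 using 2; ring
  have b3 := b2.le.trans (min_le_right _ _)
  have b4 : |X| ≤ |c| + 1 := by
    have := abs_add_le (X - c) c
    rw [sub_add_cancel] at this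
    linarith [b2.le.trans (min_le_left _ _)]
  set g := (1 - exp (-δ * t)) / δ with hg
  have g1 : g ≤ t := by
    rw [hg, div_le_iff₀ d0]; linarith [add_one_le_exp (-δ * t)]
  have g2 : t - g ≤ δ * t ^ 2 := by
    have : t - δ * t ^ 2 ≤ g := by
      rw [hg, le_div_iff₀ d0]
      have k1 := add_one_le_exp (δ * t)
      have k2 : exp (-δ * t) * exp (δ * t) = 1 := by rw [← exp_add]; simp
      have k3 := exp_pos (-δ * t)
      have k4 : exp (-δ * t) * (δ * t + 1) ≤ 1 := by nlinarith
      have k5 : 0 < δ * t := by positivity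
      have k6 : exp (-δ * t) ≤ 1 - δ * t + (δ * t) ^ 2 := by
        by_contra hcon
        push Not at hcon
        nlinarith [pow_pos k5 3]
      nlinarith
    linarith
  have e2 : (1 - exp (-δ * t)) * Wd S C0 δ ν - t * c = t * (X - c) - (t - g) * X := by
    rw [hg, hX]; field_simp; ring
  rw [e2]
  refine (abs_sub _ _).trans ?_
  rw [abs_mul, abs_mul, abs_of_pos ht, abs_of_nonneg (sub_nonneg.2 g1)]
  have c1 : t * |X - c| ≤ t * (ε / (2 * t)) := by gcongr
  have c2 : (t - g) * |X| ≤ (ε / (2 * t ^ 2 * (|c| + 1))) * t ^ 2 * (|c| + 1) := by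
    refine mul_le_mul (g2.trans ?_) b4 (abs_nonneg _) (by positivity)
    gcongr
  have c3 : t * (ε / (2 * t)) = ε / 2 := by field_simp
  have c4 : (ε / (2 * t ^ 2 * (|c| + 1))) * t ^ 2 * (|c| + 1) = ε / 2 := by
    have : |c| + 1 ≠ 0 := by positivity
    field_simp
  linarith
end
section
variable {d : ℕ}
def muZ (d : ℕ) : PTd d := Classical.choose (Classical.choose_spec (unif_exists (d := d))).2
lemma steerP (S : MFGSetting d) : ∃ C > 0, ∀ (μ ν g : PTd d) (K : ℝ), Pth S 1 μ ν K → Pth S 1 g ν (5/4 * |K| + C) := by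
  obtain ⟨C, hC, h⟩ := steer S
  obtain ⟨M, hM, hF⟩ := Fc_int_bd S
  refine ⟨C + 5/4 * M + M, by positivity, fun μ ν g K hK => ?_⟩
  obtain ⟨m, A, hr, e0, e1, hA⟩ := hK
  obtain ⟨m', hr', e0', e1'⟩ := h g hr
  refine Pth.mono ⟨m', _, hr', e0', by rw [e1', e1], rfl⟩ ?_
  have b1 := hF m 0 1 zero_le_one
  have b2 := (abs_le.1 (hF m' 0 1 zero_le_one)).2
  have e : A = K - ∫ s in (0:ℝ)..1, S.Fc (m s) := by linarith
  have : |A| ≤ |K| + M := by rw [e]; refine (abs_sub _ _).trans ?_; linarith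
  linarith
lemma reach (S : MFGSetting d) : ∃ (ν0 : PTd d) (K : ℝ), ∀ μ, Pth S 1 μ ν0 K := by
  obtain ⟨C1, hC1, h1⟩ := st1 S
  obtain ⟨C, hC, h⟩ := steerP S
  exact ⟨_, _, fun μ => h _ _ μ _ (h1 1 one_pos le_rfl (muZ d))⟩
lemma exp_lb {δ : ℝ} (h : δ ≤ 1/4) : 3/4 ≤ exp (-δ * 1) := by linarith [add_one_le_exp (-δ * 1)]
lemma osc (S : MFGSetting d) {lam : ℝ} (hlam : IsLimitValueV S 1 lam) {C0 : ℝ} (hC0 : 0 < C0) (hD : ∀ δ > 0, ∀ t > 0,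
    (∀ μ ν K, Pth S t μ ν K → Wd S C0 δ μ ≤ K + C0 * t + exp (-δ * t) * Wd S C0 δ ν) ∧
    (∀ μ, ∀ ε > 0, ∃ ν K, Pth S t μ ν K ∧ 0 ≤ K + C0 * t ∧ exp (-δ * t) * (K + C0 * t) + exp (-δ * t) * Wd S C0 δ ν ≤ Wd S C0 δ μ + ε)) :
    ∃ R, ∀ᶠ δ in 𝓝[>] (0:ℝ), ∀ μ ν, Wd S C0 δ μ - Wd S C0 δ ν ≤ R := by
  obtain ⟨ν0, K2, h2⟩ := reach S
  obtain ⟨C, hC, hs⟩ := steerP S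
  set c := C0 - lam with hc
  set R1 := K2 + C0 + 1 - c with hR1
  set R2 := R1 + 2 + c with hR2
  set C6 := 5/4 * C0 + C + C0 + 1 with hC6
  obtain ⟨δ1, hδ1, hV⟩ := hlam 1 one_pos
  have hev : ∀ᶠ δ in 𝓝[>] (0:ℝ), 0 < δ ∧ δ ≤ min (1/4) δ1 := ev_of (lt_min (by norm_num) hδ1) fun δ h h' => ⟨h, h'⟩
  refine ⟨R1 + (2 * R2 + 3 * C6), ?_⟩
  filter_upwards [hev, glim S hlam C0 one_pos one_pos] with δ ⟨d0, dl⟩ hg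
  set W := Wd S C0 δ with hW
  have dl1 := dl.trans (min_le_left _ _)
  have hg1 : ∀ ν, c - 1 ≤ (1 - exp (-δ * 1)) * W ν ∧ (1 - exp (-δ * 1)) * W ν ≤ c + 1 := fun ν => by
    have := abs_le.1 (hg ν); constructor <;> linarith
  have up : ∀ μ, W μ ≤ W ν0 + R1 := fun μ => by
    have := (hD δ d0 1 one_pos).1 μ ν0 K2 (h2 μ)
    have h3 := (hg1 ν0).1
    linarith
  have E := exp_lb dl1
  have E1 : exp (-δ * 1) ≤ 1 := exp_le_one_iff.2 (by linarith)
  have bd : BddAbove (range fun μ => W ν0 - W μ) := by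
    refine ⟨2 * ((1 + |lam|) / δ), ?_⟩
    have hb : ∀ μ, |Vfun S 1 δ μ| ≤ (1 + |lam|) / δ := fun μ => by
      rw [le_div_iff₀ d0]
      have h1 := (hV δ d0 (dl.trans (min_le_right _ _)) μ).le
      have h2 := abs_add_le (δ * Vfun S 1 δ μ - -lam) (-lam)
      rw [sub_add_cancel, abs_neg, abs_mul, abs_of_pos d0] at h2
      linarith
    rintro _ ⟨μ, rfl⟩
    have h1 := abs_le.1 (hb μ)
    have h2 := abs_le.1 (hb ν0)
    simp only [hW, Wd]
    linarith
  set O := ⨆ μ, (W ν0 - W μ) with hO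
  have le : ∀ μ, W ν0 - W μ ≤ O := fun μ => le_ciSup bd μ
  have O_le : O ≤ 2/3 * (O + R2) + C6 := by
    have : Nonempty (PTd d) := ⟨ν0⟩
    refine ciSup_le fun μ => ?_
    obtain ⟨ν, K, hP, hK, hKW⟩ := (hD δ d0 1 one_pos).2 μ 1 one_pos
    rw [mul_one C0] at hK hKW
    have hP' := hs _ _ ν0 _ hP
    have k1 := (hD δ d0 1 one_pos).1 _ _ _ hP'
    have k2 : |K| ≤ K + C0 + C0 := by rw [abs_le]; constructor <;> linarith
    have k3 := up μ
    have k4 := (hg1 ν).2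
    have k5 := le ν
    have k6 : exp (-δ * 1) * (K + C0) ≤ O + R2 := by linarith
    have k7 : 3/4 * (K + C0) ≤ exp (-δ * 1) * (K + C0) := mlR E hK
    linarith
  intro μ ν
  have := up μ
  have := le ν
  linarith
lemma asym (S : MFGSetting d) {lam : ℝ} (hlam : IsLimitValueV S 1 lam) : ∃ W : ℝ → PTd d → ℝ,
    (∀ t > 0, ∀ ε > 0, ∀ᶠ δ in 𝓝[>] (0:ℝ), ∀ μ ν K, Pth S t μ ν K → W δ μ ≤ K + lam * t + ε + W δ ν) ∧
    (∀ t > 0, ∀ ε > 0, ∀ᶠ δ in 𝓝[>] (0:ℝ), ∀ μ, ∃ ν K, Pth S t μ ν K ∧ K + lam * t + W δ ν ≤ W δ μ + ε) ∧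
    (∃ R, ∀ᶠ δ in 𝓝[>] (0:ℝ), ∀ μ ν, W δ μ - W δ ν ≤ R) ∧
    (∀ ε > 0, ∃ η > 0, ∀ᶠ δ in 𝓝[>] (0:ℝ), ∀ μ μ', W1 μ μ' < η → W δ μ' ≤ W δ μ + ε) := by
  obtain ⟨C0, hC0, hD⟩ := DPV S
  obtain ⟨R, hR⟩ := osc S hlam hC0 hD
  have ev1 : ∀ᶠ δ in 𝓝[>] (0:ℝ), 0 < δ ∧ δ ≤ 1 := ev_of one_pos fun δ h h' => ⟨h, h'⟩
  have A1 : ∀ t > 0, ∀ ε > 0, ∀ᶠ δ in 𝓝[>] (0:ℝ), ∀ μ ν K, Pth S t μ ν K → Wd S C0 δ μ ≤ K + lam * t + ε + Wd S C0 δ ν := by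
    intro t ht ε hε
    filter_upwards [ev1, glim S hlam C0 ht hε] with δ hδ hg μ ν K hP
    have h1 := (hD δ hδ.1 t ht).1 μ ν K hP
    have h2 := (abs_le.1 (hg ν)).1
    linarith
  have A2 : ∀ t > 0, ∃ K0, ∀ ε > 0, ∀ᶠ δ in 𝓝[>] (0:ℝ), ∀ μ, ∃ ν K, Pth S t μ ν K ∧ |K| ≤ K0 ∧ K + lam * t + Wd S C0 δ ν ≤ Wd S C0 δ μ + ε := by
    intro t ht
    set K1 := exp t * |R + t * (C0 - lam) + 2| with hK1
    refine ⟨K1 + C0 * t, fun ε hε => ?_⟩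
    have hp : 0 < min 1 (ε / 3) := lt_min one_pos (by positivity)
    have ev2 : ∀ᶠ δ in 𝓝[>] (0:ℝ), 0 < δ ∧ δ ≤ ε / (3 * (t * K1 + 1)) := ev_of (by positivity) fun δ h h' => ⟨h, h'⟩
    filter_upwards [ev1, ev2, hR, glim S hlam C0 ht hp] with δ hδ hδ2 hR hg μ
    obtain ⟨ν, K, hP, hK, hKW⟩ := (hD δ hδ.1 t ht).2 μ _ hp
    have k1 := abs_le.1 (hg ν)
    have k2 := hR μ ν
    have m1 := min_le_left 1 (ε / 3)
    have m2 := min_le_right 1 (ε / 3)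
    set e := exp (-δ * t) with he
    have k3 : e * (K + C0 * t) ≤ |R + t * (C0 - lam) + 2| := le_trans (by linarith) (le_abs_self _)
    have k4 : K + C0 * t ≤ K1 := by
      have : exp t * e ≥ 1 := by rw [he, ← exp_add]; exact one_le_exp (by nlinarith)
      calc K + C0 * t = 1 * (K + C0 * t) := by ring
        _ ≤ (exp t * e) * (K + C0 * t) := by gcongr
        _ = exp t * (e * (K + C0 * t)) := by ring
        _ ≤ _ := by rw [hK1]; gcongr
    have k5 : (1 - e) * (K + C0 * t) ≤ ε / 3 := by
      have q1 : 1 - e ≤ δ * t := by linarith [add_one_le_exp (-δ * t)]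
      have q2 := mul_le_mul q1 k4 hK (by have := hδ.1; positivity)
      have q3 := (le_div_iff₀ (by positivity)).1 hδ2.2
      have := hδ.1
      linarith
    refine ⟨ν, K, hP, ?_, by linarith⟩
    have : 0 < C0 * t := by positivity
    rw [abs_le]; constructor <;> linarith [hK.trans k4]
  refine ⟨Wd S C0, A1, ?_, ⟨R, hR⟩, ?_⟩
  · intro t ht ε hε
    obtain ⟨K0, h⟩ := A2 t ht
    filter_upwards [h ε hε] with δ h μ
    obtain ⟨ν, K, h1, h2, h3⟩ := h μ
    exact ⟨ν, K, h1, h3⟩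
  · intro ε hε
    obtain ⟨K0, h⟩ := A2 1 one_pos
    have hε' : 0 < ε / (3 + |lam|) := by positivity
    obtain ⟨τ, t0, tε, t1, η, hη, hq⟩ := equi S K0 hε'
    refine ⟨η, hη, ?_⟩
    filter_upwards [h _ hε', A1 (τ + 1) (by positivity) _ hε'] with δ h h1 μ μ' hW
    obtain ⟨ν, K, p1, p2, p3⟩ := h μ
    have p4 := h1 _ _ _ (hq μ μ' ν K hW p1 p2)
    have p5 : lam * τ ≤ |lam| * (ε / (3 + |lam|)) :=
      (mlR (le_abs_self lam) t0.le).trans (by gcongr)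
    have p6 : (3 + |lam|) * (ε / (3 + |lam|)) = ε := by field_simp
    linarith
end
section
variable {d : ℕ}
instance neP : Nonempty (PTd d) := ⟨muZ d⟩
lemma corr (S : MFGSetting d) {lam : ℝ} (hlam : IsLimitValueV S 1 lam) : ∃ χ : PTd d → ℝ, W1Continuous χ ∧
    (∀ t > 0, ∀ μ ν K, Pth S t μ ν K → χ μ ≤ K + lam * t + χ ν) ∧
    (∀ t > 0, ∀ ε > 0, ∀ μ, ∃ ν K, Pth S t μ ν K ∧ K + lam * t + χ ν ≤ χ μ + ε) := by
  obtain ⟨W, hA, hB, ⟨R, hR⟩, hC⟩ := asym S hlam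
  set U : Ultrafilter ℝ := Ultrafilter.of (𝓝[>] (0:ℝ)) with hU
  have hUl : (U : Filter ℝ) ≤ 𝓝[>] (0:ℝ) := Ultrafilter.of_le _
  have ev : ∀ {p : ℝ → Prop}, (∀ᶠ δ in 𝓝[>] (0:ℝ), p δ) → ∀ᶠ δ in (U : Filter ℝ), p δ := fun h => hUl h
  have hlim : ∀ μ, ∃ c, Tendsto (fun δ => W δ μ - W δ (muZ d)) U (𝓝 c) := fun μ => by
    obtain ⟨c, -, hc⟩ := (isCompact_Icc (a := -R) (b := R)).ultrafilter_le_nhds' (U.map fun δ => W δ μ - W δ (muZ d)) (by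
      rw [Ultrafilter.mem_map]
      exact ev (hR.mono fun δ h => ⟨by linarith [h (muZ d) μ], h _ _⟩))
    exact ⟨c, hc⟩
  choose χ hχ using hlim
  have cC : ∀ ε > 0, ∃ η > 0, ∀ μ μ', W1 μ μ' < η → χ μ' ≤ χ μ + ε := fun ε hε => by
    obtain ⟨η, hη, h⟩ := hC ε hε
    refine ⟨η, hη, fun μ μ' hW => le_of_tendsto_of_tendsto (hχ μ') ((hχ μ).add_const ε) (ev (h.mono fun δ h => ?_))⟩
    have := h μ μ' hW
    simp only []; linarith
  refine ⟨χ, ?_, ?_, ?_⟩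
  · intro μ ε hε
    obtain ⟨η, hη, h⟩ := cC (ε / 2) (by positivity)
    refine ⟨η, hη, fun ν hW => ?_⟩
    have h1 := h μ ν hW
    have h2 := h ν μ (by rwa [W1_comm])
    rw [abs_lt]; constructor <;> linarith
  · intro t ht μ ν K hP
    refine le_of_forall_pos_le_add fun ε hε => ?_
    refine le_of_tendsto_of_tendsto (hχ μ) (((hχ ν).const_add (K + lam * t)).add_const ε) (ev ((hA t ht ε hε).mono fun δ h => ?_))
    have := h μ ν K hP
    simp only []; linarith
  · intro t ht ε hε μ
    have hε' : 0 < ε / 5 := by positivity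
    obtain ⟨ν, hν⟩ := (ev ((hB t ht _ hε').mono fun δ h => h μ)).choice
    obtain ⟨νs, -, hs⟩ := isCompact_univ.ultrafilter_le_nhds' (U.map ν) (Filter.univ_mem (f := ((U.map ν : Ultrafilter (PTd d)) : Filter (PTd d))))
    have hs : Tendsto ν U (𝓝 νs) := hs
    obtain ⟨η, hη, h1⟩ := hC _ hε'
    obtain ⟨η', hη', h2⟩ := cC _ hε'
    have hw := tendsto_W1 hs
    have e1 := (tendsto_order.1 hw).2 η hη
    have e2 := (tendsto_order.1 hw).2 η' hη'
    have e3 := (tendsto_order.1 (hχ νs)).1 (χ νs - ε / 5) (by linarith)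
    have e4 := (tendsto_order.1 (hχ μ)).2 (χ μ + ε / 5) (by linarith)
    obtain ⟨δ, ⟨K, hP, hK⟩, a1, a2, a3, a4, a5⟩ := (hν.and (e1.and (e2.and (e3.and (e4.and (ev h1)))))).exists
    refine ⟨ν δ, K, hP, ?_⟩
    have b1 := a5 (ν δ) νs a1
    have b2 := h2 νs (ν δ) (by rwa [W1_comm])
    linarith
lemma corr_is (S : MFGSetting d) {lam : ℝ} {χ : PTd d → ℝ} (hc : W1Continuous χ)
    (hA : ∀ t > 0, ∀ μ ν K, Pth S t μ ν K → χ μ ≤ K + lam * t + χ ν)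
    (hB : ∀ t > 0, ∀ ε > 0, ∀ μ, ∃ ν K, Pth S t μ ν K ∧ K + lam * t + χ ν ≤ χ μ + ε) : IsCorrector S 1 lam χ := by
  refine ⟨hc, fun μ t ht => ?_⟩
  have lb : ∀ r ∈ DPPval S 1 χ lam t μ, χ μ ≤ r := by
    rintro r ⟨m, α, h, rfl⟩
    have := hA t ht _ _ _ (Pth_of ht.le h)
    linarith
  have ex : ∀ ε > 0, ∃ r ∈ DPPval S 1 χ lam t μ, r ≤ χ μ + ε := fun ε hε => by
    obtain ⟨ν, K, hP, hK⟩ := hB t ht ε hε μ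
    obtain ⟨m, α, hm, h, -, he, hc⟩ := Pth_to ht.le hP
    refine ⟨_, ⟨m, α, h, rfl⟩, ?_⟩
    rw [he]; linarith
  refine le_antisymm (le_csInf ?_ lb) (le_of_forall_pos_le_add fun ε hε => ?_)
  · obtain ⟨r, hr, -⟩ := ex 1 one_pos
    exact ⟨r, hr⟩
  · obtain ⟨r, hr, hl⟩ := ex ε hε
    exact (csInf_le ⟨_, lb⟩ hr).trans hl
end
section
variable {d : ℕ}
lemma dppR {S : MFGSetting d} {lam : ℝ} {χ : PTd d → ℝ}
    (hA : ∀ t > 0, ∀ μ ν K, Pth S t μ ν K → χ μ ≤ K + lam * t + χ ν) {m : ℝ → PTd d} {α : ℝ → Td d → Vd d} (hm : Continuous m)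
    {a b : ℝ} (hab : a ≤ b) (h : Rlz a b m α) : χ (m a) ≤ (∫ s in a..b, runCost S m α s) + lam * (b - a) + χ (m b) := by
  rcases hab.eq_or_lt with e | e
  · subst e; simp
  have h1 := (Rlz_rel (S := S) hm hab h).shift (-a)
  rw [add_neg_cancel, ← sub_eq_add_neg] at h1
  have h2 := hA (b - a) (sub_pos.2 e) (m a) (m b) _ ⟨_, _, h1, by simp, by simp, rfl⟩
  rw [(rc_ii (S := S) hm hab h).2]
  have e : ∫ s in (0:ℝ)..(b - a), S.Fc (m (s - -a)) = ∫ s in a..b, S.Fc (m s) := by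
    rw [intervalIntegral.integral_comp_sub_right (fun s => S.Fc (m s))]; simp
  rw [e] at h2; exact h2
lemma near {S : MFGSetting d} {lam : ℝ} {χ : PTd d → ℝ}
    (hA : ∀ t > 0, ∀ μ ν K, Pth S t μ ν K → χ μ ≤ K + lam * t + χ ν)
    (hB : ∀ t > 0, ∀ ε > 0, ∀ μ, ∃ ν K, Pth S t μ ν K ∧ K + lam * t + χ ν ≤ χ μ + ε) (n : ℝ) (hn : 0 < n) {ε : ℝ} (hε : 0 < ε) :
    ∃ m : ℝ → PTd d, Continuous m ∧ ∀ a b, -n ≤ a → a ≤ b → b ≤ n →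
      RelC S a b m (χ (m a) - χ (m b) - lam * (b - a) - (∫ s in a..b, S.Fc (m s)) + ε) := by
  obtain ⟨ν, K, hP, hK⟩ := hB (2 * n) (by positivity) ε hε (muZ d)
  obtain ⟨m0, A0, hr0, e0, e1, hA0⟩ := hP
  obtain ⟨α0, hα0, hc0⟩ := realize S (by positivity) hr0
  have hcost := (rc_ii (S := S) hr0.1 (by positivity) hα0).2
  have hs := Rlz_shift hα0 n
  have hm : Continuous fun s => m0 (s + n) := hr0.1.comp (by fun_prop)
  rw [zero_sub, show 2 * n - n = n by ring] at hs
  refine ⟨fun s => m0 (s + n), hm, fun a b h1 h2 h3 => ?_⟩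
  set m := fun s => m0 (s + n) with em
  set α := fun s => α0 (s + n) with eα
  have r1 := Rlz_sub hs le_rfl (h2.trans h3)
  have r2 := Rlz_sub (Rlz_sub hs h1 le_rfl) le_rfl h3
  have r3 := Rlz_sub hs (h1.trans h2) le_rfl
  have d1 := dppR hA hm h1 r1
  have d3 := dppR hA hm h3 r3
  have i1 := (rc_ii (S := S) hm h1 r1).1
  have i2 := rc_ii (S := S) hm h2 r2
  have i3 := (rc_ii (S := S) hm h3 r3).1
  have tot : ∫ s in (-n)..n, runCost S m α s = ∫ s in (0:ℝ)..(2*n), runCost S m0 α0 s := by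
    have : ∀ s, runCost S m α s = runCost S m0 α0 (s + n) := fun s => rfl
    simp only [this]
    rw [intervalIntegral.integral_comp_add_right (runCost S m0 α0)]; congr 1 <;> ring
  rw [← intervalIntegral.integral_add_adjacent_intervals (i1.trans i2.1) i3, ← intervalIntegral.integral_add_adjacent_intervals i1 i2.1, hcost] at tot
  refine (Rlz_rel (S := S) hm h2 r2).mono ?_
  have q1 : m (-n) = muZ d := by simp [em, e0]
  have q2 : m n = ν := by rw [← e1, em]; simp only []; congr 1; ring
  rw [q1] at d1
  rw [q2] at d3
  rw [i2.2] at tot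
  linarith
lemma const_test {f : Vd d → ℝ} (hf : ContDiff ℝ 2 f) (hp : Per f) (c : ℝ) : IsTestFun fun (_ : ℝ) x => c * f x :=
  ⟨contDiff_const.mul (hf.comp contDiff_snd), fun t x z => by simp only []; rw [hp x z]⟩
lemma eqc1 (S : MFGSetting d) {f : Vd d → ℝ} (hf : ContDiff ℝ 2 f) (hp : Per f) (c : ℝ) : ∃ B > 0, ∀ (m : ℝ → PTd d) (s t A : ℝ),
    s ≤ t → RelC S s t m A → c * (iT (m s) f - iT (m t) f) ≤ A + B * (t - s) := by
  set φ : ℝ → Vd d → ℝ := fun _ x => c * f x with hφ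
  have hT : IsTestFun φ := const_test hf hp c
  obtain ⟨B1, hB1, h1⟩ := per_bdd_on (opL_cont hT) (opL_per hT) (isCompact_singleton (x := (0:ℝ)))
  obtain ⟨B2, hB2, h2⟩ := per_bdd_on (hm_cont S hT) (hm_per S hT) (isCompact_singleton (x := (0:ℝ)))
  refine ⟨B1 + B2 + 1, by positivity, fun m s t A hst hr => ?_⟩
  have h := hr.2 φ hT
  have k1 : ∀ u, opL φ u = opL φ 0 := fun u => by funext x; simp [opL, tderiv, hφ]
  have k2 : ∀ u, hamF S φ u = hamF S φ 0 := fun u => rfl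
  have g1 : ∫ u in s..t, -B1 ≤ ∫ u in s..t, iT (m u) (opL φ u) := by
    refine intervalIntegral.integral_mono_on hst intervalIntegrable_const (opL_int hr.1 hT s t) fun u _ => ?_
    rw [k1]
    exact (abs_le.1 (iT_abs (CP_of (opL_cont hT) (opL_per hT) 0) (m u) fun x => h1 0 rfl x)).1
  have g2 : ∫ u in s..t, iT (m u) (hamF S φ u) ≤ ∫ u in s..t, B2 := by
    refine intervalIntegral.integral_mono_on hst (hm_int S hr.1 hT s t) intervalIntegrable_const fun u _ => ?_
    rw [k2]
    exact (abs_le.1 (iT_abs (CP_of (hm_cont S hT) (hm_per S hT) 0) (m u) fun x => h2 0 rfl x)).2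
  rw [intervalIntegral.integral_const, smul_eq_mul] at g1 g2
  simp only [Jf, Hf] at h
  have e : ∀ u v, iT (m v) (φ u) = c * iT (m v) f := fun u v => iT_mul _ _ _
  rw [e s s, e t t] at h
  linarith
lemma eqc (S : MFGSetting d) {f : Vd d → ℝ} (hf : ContDiff ℝ 2 f) (hp : Per f) (A : ℝ) {ε : ℝ} (hε : 0 < ε) : ∃ η > 0, ∀ (m : ℝ → PTd d) (s t : ℝ),
    s ≤ t → t - s < η → RelC S s t m A → |iT (m s) f - iT (m t) f| ≤ ε := by
  set c := 2 * (|A| + 1) / ε with hc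
  have c0 : 0 < c := by positivity
  obtain ⟨B1, hB1, h1⟩ := eqc1 S hf hp c
  obtain ⟨B2, hB2, h2⟩ := eqc1 S hf hp (-c)
  refine ⟨(|A| + 1) / (B1 + B2), by positivity, fun m s t hst hl hr => ?_⟩
  have k1 := h1 m s t A hst hr
  have k2 := h2 m s t A hst hr
  have k3 := (lt_div_iff₀ (by positivity)).1 hl
  have k4 : c * ε = 2 * (|A| + 1) := by rw [hc]; field_simp
  have k5 := le_abs_self A
  have k6 := mul_nonneg hB1.le (sub_nonneg.2 hst)
  have k7 := mul_nonneg hB2.le (sub_nonneg.2 hst)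
  rw [abs_le]
  constructor <;> refine le_of_mul_le_mul_left ?_ c0 <;> linarith
lemma iT_tendsto {l : Filter ℕ} {mn : ℕ → PTd d} {μ : PTd d} (h : Tendsto mn l (𝓝 μ)) {f : Vd d → ℝ} (hf : CP f) :
    Tendsto (fun n => iT (mn n) f) l (𝓝 (iT μ f)) := by
  have : Continuous fun μ : PTd d => iT μ f := iT_cont (m := fun μ : PTd d => μ) (f := fun _ => f) continuous_id (hf.1.comp continuous_snd) fun _ => hf.2
  exact (this.tendsto μ).comp h
lemma int_lim {mn : ℕ → ℝ → PTd d} {m : ℝ → PTd d} (hn : ∀ n, Continuous (mn n)) (h : ∀ s, Tendsto (fun n => mn n s) atTop (𝓝 (m s)))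
    {f : ℝ → Vd d → ℝ} (hf : Continuous fun q : ℝ × Vd d => f q.1 q.2) (hp : ∀ p, Per (f p)) (a b : ℝ) :
    Tendsto (fun n => ∫ s in a..b, iT (mn n s) (f s)) atTop (𝓝 (∫ s in a..b, iT (m s) (f s))) := by
  obtain ⟨C, hC, hb⟩ := per_bdd_on hf hp (isCompact_uIcc (a := a) (b := b))
  refine intervalIntegral.tendsto_integral_filter_of_dominated_convergence (fun _ => C) ?_ ?_ intervalIntegrable_const ?_
  · exact .of_forall fun n => (iT_cont (hn n) hf hp).aestronglyMeasurable
  · exact .of_forall fun n => ae_of_all _ fun s hs => iT_abs (CP_of hf hp s) _ (hb s (uIoc_subset_uIcc hs))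
  · exact ae_of_all _ fun s _ => iT_tendsto (h s) (CP_of hf hp s)
lemma RelC_lim {S : MFGSetting d} {mn : ℕ → ℝ → PTd d} {m : ℝ → PTd d} (hn : ∀ n, Continuous (mn n)) (hm : Continuous m)
    (h : ∀ s, Tendsto (fun n => mn n s) atTop (𝓝 (m s))) {a b : ℝ} {An : ℕ → ℝ} {A : ℝ} (hA : Tendsto An atTop (𝓝 A))
    (hr : ∀ᶠ n in atTop, RelC S a b (mn n) (An n)) : RelC S a b m A := by
  refine ⟨hm, fun φ hφ => ?_⟩
  refine le_of_tendsto_of_tendsto ?_ hA (hr.mono fun n h => h.2 φ hφ)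
  have e1 := int_lim hn h (opL_cont hφ) (opL_per hφ) a b
  have e2 := int_lim hn h (hm_cont S hφ) (hm_per S hφ) a b
  exact (((iT_tendsto (h a) (test_CP hφ a)).sub (iT_tendsto (h b) (test_CP hφ b))).add e1).sub e2
lemma Fc_lim (S : MFGSetting d) {mn : ℕ → ℝ → PTd d} {m : ℝ → PTd d} (hn : ∀ n, Continuous (mn n))
    (h : ∀ s, Tendsto (fun n => mn n s) atTop (𝓝 (m s))) (a b : ℝ) :
    Tendsto (fun n => ∫ s in a..b, S.Fc (mn n s)) atTop (𝓝 (∫ s in a..b, S.Fc (m s))) := by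
  obtain ⟨C, hC⟩ := S.Fc_bounded
  refine intervalIntegral.tendsto_integral_filter_of_dominated_convergence (fun _ => C) ?_ ?_ intervalIntegrable_const ?_
  · exact .of_forall fun n => (Fcm_cont S (hn n)).aestronglyMeasurable
  · exact .of_forall fun n => ae_of_all _ fun s _ => hC _
  · exact ae_of_all _ fun s _ => ((Fc_cont S).tendsto _).comp (h s)
end
section
variable {d : ℕ}
lemma subs {mn : ℕ → ℝ → PTd d} (hE : ∀ f : Vd d → ℝ, ContDiff ℝ 2 f → Per f → ∀ N : ℕ, ∀ ε > 0, ∃ η > (0:ℝ), ∀ n ≥ N, ∀ s t : ℝ,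
      |s| ≤ N → |t| ≤ N → |s - t| < η → |iT (mn n s) f - iT (mn n t) f| ≤ ε) :
    ∃ (φ : ℕ → ℕ) (m : ℝ → PTd d), StrictMono φ ∧ Continuous m ∧ ∀ s, Tendsto (fun n => mn (φ n) s) atTop (𝓝 (m s)) := by
  obtain ⟨M, φ, hφ, hM⟩ := CompactSpace.tendsto_subseq (fun n => (fun q : ℚ => mn n q : ℚ → PTd d))
  rw [tendsto_pi_nhds] at hM
  have hU : ∀ t : ℝ, ∃ μ, Tendsto (fun n => mn (φ n) t) (Ultrafilter.of atTop : Ultrafilter ℕ) (𝓝 μ) := fun t => by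
    obtain ⟨μ, -, h⟩ := (isCompact_univ (X := PTd d)).ultrafilter_le_nhds ((Ultrafilter.of atTop).map fun n => mn (φ n) t) (by simp)
    exact ⟨μ, h⟩
  choose m hm using hU
  have hle : (Ultrafilter.of atTop : Ultrafilter ℕ) ≤ (atTop : Filter ℕ) := Ultrafilter.of_le _
  have hlim : ∀ s, Tendsto (fun n => mn (φ n) s) atTop (𝓝 (m s)) := fun s => by
    refine tendsto_C2 fun f hf hp => ?_
    have hc : CauchySeq fun n => iT (mn (φ n) s) f := by
      rw [Metric.cauchySeq_iff']
      intro ε hε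
      obtain ⟨N, hN⟩ := exists_nat_ge (|s| + 1)
      obtain ⟨η, hη, h⟩ := hE f hf hp N (ε / 5) (by positivity)
      obtain ⟨q, hq1, hq2⟩ := exists_rat_btwn (show s < s + min η 1 by simp [hη])
      have hq3 : |(q:ℝ) - s| < min η 1 := abs_lt.2 ⟨by linarith [lt_min hη one_pos], by linarith⟩
      have hqN : |(q:ℝ)| ≤ N := by
        have := abs_sub_abs_le_abs_sub (q:ℝ) s
        linarith [min_le_right η 1]
      have hcq := Metric.cauchySeq_iff'.1 (iT_tendsto (hM q) ⟨hf.continuous, hp⟩).cauchySeq (ε / 5) (by positivity)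
      obtain ⟨K, hK⟩ := hcq
      have key : ∀ n ≥ max K N, |iT (mn (φ n) q) f - iT (mn (φ n) s) f| ≤ ε / 5 := fun n hn =>
        h _ ((le_of_max_le_right hn).trans (hφ.id_le n)) _ _ hqN (by linarith) (hq3.trans_le (min_le_left _ _))
      refine ⟨max K N, fun n hn => ?_⟩
      have k1 := key n hn
      have k2 := key _ le_rfl
      have k3 := hK n (le_of_max_le_left hn)
      have k4 := hK (max K N) (le_max_left _ _)
      rw [Real.dist_eq] at k3 k4 ⊢
      simp only [Function.comp] at k3 k4
      rw [abs_le] at k1 k2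
      rw [abs_lt] at k3 k4 ⊢
      constructor <;> linarith
    obtain ⟨L, hL⟩ := cauchySeq_tendsto_of_complete hc
    have : L = iT (m s) f := tendsto_nhds_unique (hL.mono_left hle) (iT_tendsto (hm s) ⟨hf.continuous, hp⟩)
    rw [this] at hL; exact hL
  refine ⟨φ, m, hφ, cont_C2 fun f hf hp => ?_, hlim⟩
  rw [Metric.continuous_iff]
  intro s ε hε
  obtain ⟨N, hN⟩ := exists_nat_ge (|s| + 1)
  obtain ⟨η, hη, h⟩ := hE f hf hp N (ε / 2) (by positivity)
  refine ⟨min η 1, lt_min hη one_pos, fun t ht => ?_⟩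
  rw [Real.dist_eq] at ht ⊢
  have l := ((iT_tendsto (hlim t) ⟨hf.continuous, hp⟩).sub (iT_tendsto (hlim s) ⟨hf.continuous, hp⟩)).abs
  refine lt_of_le_of_lt (le_of_tendsto l ?_) (half_lt_self hε)
  filter_upwards [eventually_ge_atTop N] with n hn
  refine h _ (hn.trans (hφ.id_le n)) t s ?_ (by linarith) (ht.trans_le (min_le_left _ _))
  have := abs_sub_abs_le_abs_sub t s
  linarith [min_le_right η 1]
lemma curve {S : MFGSetting d} {lam : ℝ} {χ : PTd d → ℝ} (hc : Continuous χ)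
    (hA : ∀ t > 0, ∀ μ ν K, Pth S t μ ν K → χ μ ≤ K + lam * t + χ ν)
    (hB : ∀ t > 0, ∀ ε > 0, ∀ μ, ∃ ν K, Pth S t μ ν K ∧ K + lam * t + χ ν ≤ χ μ + ε) :
    ∃ m : ℝ → PTd d, Continuous m ∧ ∀ a b, a ≤ b →
      RelC S a b m (χ (m a) - χ (m b) - lam * (b - a) - ∫ s in a..b, S.Fc (m s)) := by
  choose mn hmn hr using fun n : ℕ => near hA hB ((n:ℝ) + 1) (by positivity) (ε := 1 / ((n:ℝ) + 1)) (by positivity)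
  obtain ⟨C, hC⟩ := (isCompact_univ (X := PTd d)).exists_bound_of_continuousOn hc.continuousOn
  obtain ⟨M, hM0, hM⟩ := Fc_int_bd S
  have hbd : ∀ N n : ℕ, N ≤ n → ∀ a b : ℝ, |a| ≤ N → |b| ≤ N → a ≤ b → RelC S a b (mn n) (2 * C + (|lam| + M) * (2 * N) + 1) := by
    intro N n hn a b ha hb hab
    have hn' : (N:ℝ) ≤ n := by exact_mod_cast hn
    rw [abs_le] at ha hb
    refine (hr n a b (by linarith) hab (by linarith)).mono ?_
    have c1 := abs_le.1 (hC (mn n a) trivial)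
    have c2 := abs_le.1 (hC (mn n b) trivial)
    have c3 := (abs_le.1 (hM (mn n) a b hab)).1
    have c4 : -lam * (b - a) ≤ |lam| * (b - a) := mlR (neg_le_abs _) (by linarith)
    have c5 : (|lam| + M) * (b - a) ≤ (|lam| + M) * (2 * N) := mlL (by linarith) (by positivity)
    have c6 : 1 / ((n:ℝ) + 1) ≤ 1 := by rw [div_le_one (by positivity)]; linarith [Nat.cast_nonneg (α := ℝ) n]
    linarith
  obtain ⟨φ, m, hφ, hm, hl⟩ := subs (mn := mn) fun f hf hp N ε hε => by
    obtain ⟨η, hη, h⟩ := eqc S hf hp (2 * C + (|lam| + M) * (2 * N) + 1) hε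
    refine ⟨η, hη, fun n hn s t hs ht hst => ?_⟩
    rcases le_total s t with e | e
    · exact h _ s t e (by linarith [(abs_lt.1 hst).1]) (hbd N n hn s t hs ht e)
    · rw [abs_sub_comm]
      exact h _ t s e (by linarith [(abs_lt.1 hst).2]) (hbd N n hn t s ht hs e)
  refine ⟨m, hm, fun a b hab => ?_⟩
  have l0 : Tendsto (fun n : ℕ => 1 / ((φ n : ℝ) + 1)) atTop (𝓝 0) := tendsto_one_div_add_atTop_nhds_zero_nat.comp hφ.tendsto_atTop
  have l1 := ((((hc.tendsto _).comp (hl a)).sub ((hc.tendsto _).comp (hl b))).sub (tendsto_const_nhds (x := lam * (b - a)))).sub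
    (Fc_lim S (fun n => hmn (φ n)) hl a b)
  have l2 := l1.add l0
  rw [add_zero] at l2
  refine RelC_lim (fun n => hmn (φ n)) hm hl l2 ?_
  obtain ⟨N, hN⟩ := exists_nat_ge (max |a| |b|)
  filter_upwards [eventually_ge_atTop N] with n hn
  have e : (N:ℝ) ≤ φ n := by exact_mod_cast hn.trans (hφ.id_le n)
  have h1 := (abs_le.1 ((le_max_left _ _).trans hN)).1
  have h2 := (abs_le.1 ((le_max_right _ _).trans hN)).2
  exact hr (φ n) a b (by linarith) hab (by linarith)
def Cal (S : MFGSetting d) (lam : ℝ) (χ : PTd d → ℝ) (m : ℝ → PTd d) (α : ℝ → Td d → Vd d) (a b : ℝ) : Prop :=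
  Rlz a b m α ∧ ∫ s in a..b, runCost S m α s ≤ χ (m a) - χ (m b) - lam * (b - a)
lemma calib {S : MFGSetting d} {lam : ℝ} {χ : PTd d → ℝ} (hc : W1Continuous χ)
    (hA : ∀ t > 0, ∀ μ ν K, Pth S t μ ν K → χ μ ≤ K + lam * t + χ ν)
    (hB : ∀ t > 0, ∀ ε > 0, ∀ μ, ∃ ν K, Pth S t μ ν K ∧ K + lam * t + χ ν ≤ χ μ + ε) :
    ∃ (m : ℝ → PTd d) (α : ℝ → Td d → Vd d), IsCalibrated S 1 lam m α := by
  obtain ⟨m, hm, hR⟩ := curve (cont_of_W1Continuous hc) hA hB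
  choose αk hα hαc using fun k : ℤ => realize S (show (k:ℝ) ≤ k + 1 by linarith) (hR k (k + 1) (by linarith))
  set α : ℝ → Td d → Vd d := fun s y => αk (⌈s⌉ - 1) s y with hαd
  have hmeas : Measurable fun q : ℝ × Td d => α q.1 q.2 := by
    have h1 : Measurable fun p : ℤ × (ℝ × Td d) => αk p.1 p.2.1 p.2.2 :=
      measurable_from_prod_countable_right fun k => (hα k).2.1
    have h2 : Measurable fun q : ℝ × Td d => ((⌈q.1⌉ - 1 : ℤ), q) :=
      ((Int.measurable_ceil.comp measurable_fst).sub_const 1).prodMk measurable_id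
    exact h1.comp h2
  have hk : ∀ k : ℤ, ∀ s ∈ Ioc (k:ℝ) (k + 1), αk k s = α s := fun k s hs => by
    have : ⌈s⌉ = k + 1 := by rw [Int.ceil_eq_iff]; push_cast; exact ⟨by linarith [hs.1], hs.2⟩
    simp only [hαd, this, add_sub_cancel_right]
  have c1 : ∀ k : ℤ, Cal S lam χ m α k (k + 1) := fun k => by
    have r : Rlz (k:ℝ) (k + 1) m α := Rlz_congr (fun _ _ => rfl) (hk k) hmeas (hα k)
    refine ⟨r, ?_⟩
    rw [(rc_ii (S := S) hm (by linarith) r).2]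
    have : ∫ s in (k:ℝ)..(k + 1), hst S m α s = ∫ s in (k:ℝ)..(k + 1), hst S m (αk k) s := by
      refine intervalIntegral.integral_congr_ae (ae_of_all _ fun s hs => ?_)
      rw [uIoc_of_le (by linarith)] at hs
      simp only [hst, hk k s hs]
    rw [this]
    linarith [hαc k]
  have cc : ∀ a b c, a ≤ b → b ≤ c → Cal S lam χ m α a b → Cal S lam χ m α b c → Cal S lam χ m α a c := fun a b c h1 h2 r1 r2 => by
    refine ⟨Rlz_concat hm h1 h2 r1.1 r2.1, ?_⟩
    rw [← intervalIntegral.integral_add_adjacent_intervals (rc_ii hm h1 r1.1).1 (rc_ii hm h2 r2.1).1]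
    linarith [r1.2, r2.2]
  have cN : ∀ N : ℕ, Cal S lam χ m α (-(N:ℝ) - 1) (N + 1) := fun N => by
    induction N with
    | zero =>
      refine cc _ 0 _ (by simp) (by simp) ?_ ?_
      · simpa using c1 (-1)
      · simpa using c1 0
    | succ N ih =>
      have h0 : (0:ℝ) ≤ N := Nat.cast_nonneg N
      have e1 := c1 (-(N:ℤ) - 2)
      have e2 := c1 ((N:ℤ) + 1)
      push_cast at e1 e2 ⊢
      rw [show -(N:ℝ) - 2 + 1 = -(N:ℝ) - 1 by ring] at e1
      rw [show -((N:ℝ) + 1) - 1 = -(N:ℝ) - 2 by ring]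
      exact cc _ (-(N:ℝ) - 1) _ (by linarith) (by linarith) e1 (cc _ (N + 1) _ (by linarith) (by linarith) ih e2)
  have hall : ∀ a b : ℝ, ∃ N : ℕ, -(N:ℝ) - 1 ≤ a ∧ b ≤ N + 1 := fun a b => by
    obtain ⟨N, hN⟩ := exists_nat_ge (max |a| |b|)
    exact ⟨N, by linarith [(abs_le.1 ((le_max_left _ _).trans hN)).1], by linarith [(abs_le.1 ((le_max_right _ _).trans hN)).2]⟩
  have rl : ∀ a b, Rlz a b m α := fun a b => by
    obtain ⟨N, h1, h2⟩ := hall a b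
    exact Rlz_sub (cN N).1 h1 h2
  have ii : ∀ a b, a ≤ b → IntervalIntegrable (runCost S m α) volume a b := fun a b h => (rc_ii hm h (rl a b)).1
  refine ⟨m, α, W1ContOn_of_cont hm.continuousOn, fun s₁ s₂ h => (rl s₁ s₂).1 s₁ s₂ le_rfl h le_rfl, hmeas, fun a b => (rl a b).2.2, fun a b => ?_,
    χ, corr_is S hc hA hB, fun a b hab => ?_⟩
  · rcases le_total a b with h | h
    · exact ii a b h
    · exact (ii b a h).symm
  · obtain ⟨N, h1, h2⟩ := hall a b
    have d1 := dppR hA hm h1 (rl _ _)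
    have d2 := dppR hA hm hab.le (rl _ _)
    have d3 := dppR hA hm h2 (rl _ _)
    have t := (cN N).2
    rw [← intervalIntegral.integral_add_adjacent_intervals ((ii _ _ h1).trans (ii _ _ hab.le)) (ii _ _ h2),
      ← intervalIntegral.integral_add_adjacent_intervals (ii _ _ h1) (ii _ _ hab.le)] at t
    linarith
end
end

/-- Proposition 2.6 of the paper.  There exists a calibrated curve;
consequently, the projected Mather set is non-empty. -/
theorem mather_nonempty (d : ℕ) (S : MFGSetting d) (lam : ℝ)
    (hlam : IsLimitValueV S 1 lam) :
    (∃ (m : ℝ → PTd d) (α : ℝ → Td d → Vd d), IsCalibrated S 1 lam m α) ∧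
    (MatherSet S 1 lam).Nonempty := by
  obtain ⟨χ, hc, hA, hB⟩ := corr S hlam
  obtain ⟨m, α, h⟩ := calib hc hA hB
  exact ⟨⟨m, α, h⟩, ⟨m 0, m, α, h, rfl⟩⟩
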